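/- Fix an integer r ≥ 3 and a real ε > 0. Then with high probability Φ(H^r_{n,M}) > [e^{−(r−1)}·rM/n]^{n/r}·e^{−o(n)}; precisely: for all δ > 0 and ρ > 0 there is n₀ such that for every n ≥ n₀ divisible by r and every integer M with (1+ε)(n/r)·log n < M ≤ C(n,r), one has P( Φ(H^r_{n,M}) > (e^{−(r−1)}·rM/n)^{n/r}·e^{−δn} ) ≥ 1 − ρ. -/

import Mathlib

open Finset

/-- The set of perfect matchings of the `r`-graph `H` on vertex set `V`. -/
def pmSet (V : Finset ℕ) (H : Finset (Finset ℕ)) : Finset (Finset (Finset ℕ)) :=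
  H.powerset.filter (fun M => (∀ A ∈ M, ∀ B ∈ M, A ≠ B → A ∩ B = ∅) ∧ M.biUnion id = V)

/-- The number of perfect matchings of `H` (denoted `Φ(H)`). -/
def pmCount (V : Finset ℕ) (H : Finset (Finset ℕ)) : ℕ := (pmSet V H).card

/-- All `r`-element subsets of `[n]`. -/
def Kn (n r : ℕ) : Finset (Finset ℕ) := Finset.powersetCard r (Finset.range n)

section basics

variable {U : Finset ℕ} {H : Finset (Finset ℕ)} {S : Finset (Finset ℕ)}

theorem mem_pmSet : S ∈ pmSet U H ↔ S ⊆ H ∧ (∀ A ∈ S, ∀ B ∈ S, A ≠ B → A ∩ B = ∅) ∧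
    S.biUnion id = U := by
  simp [pmSet, Finset.mem_filter, Finset.mem_powerset]

theorem pm_sub (hS : S ∈ pmSet U H) : S ⊆ H := (mem_pmSet.1 hS).1

theorem pm_edge_sub (hS : S ∈ pmSet U H) {f : Finset ℕ} (hf : f ∈ S) : f ⊆ U := by
  have := (mem_pmSet.1 hS).2.2
  rw [← this]; exact Finset.subset_biUnion_of_mem id hf

theorem pm_eq_of_mem (hS : S ∈ pmSet U H) {f g : Finset ℕ} (hf : f ∈ S) (hg : g ∈ S) {v : ℕ}
    (h1 : v ∈ f) (h2 : v ∈ g) : f = g := by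
  by_contra hne
  have := (mem_pmSet.1 hS).2.1 f hf g hg hne
  have h3 : v ∈ f ∩ g := mem_inter.2 ⟨h1, h2⟩
  rw [this] at h3; simp at h3

theorem pm_exists (hS : S ∈ pmSet U H) {v : ℕ} (hv : v ∈ U) : ∃ f ∈ S, v ∈ f := by
  have := (mem_pmSet.1 hS).2.2
  rw [← this] at hv
  simpa using hv

/-- edge of S containing v -/
def edgeAt (S : Finset (Finset ℕ)) (v : ℕ) : Finset ℕ := (S.filter (fun f => v ∈ f)).biUnion id

theorem edgeAt_eq (hS : S ∈ pmSet U H) {f : Finset ℕ} (hf : f ∈ S) {v : ℕ} (hv : v ∈ f) :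
    edgeAt S v = f := by
  have : S.filter (fun f => v ∈ f) = {f} := by
    ext g; simp only [mem_filter, mem_singleton]
    constructor
    · rintro ⟨h1, h2⟩; exact pm_eq_of_mem hS h1 hf h2 hv
    · rintro rfl; exact ⟨hf, hv⟩
  simp [edgeAt, this]

theorem edgeAt_mem (hS : S ∈ pmSet U H) {v : ℕ} (hv : v ∈ U) : edgeAt S v ∈ S ∧ v ∈ edgeAt S v := by
  obtain ⟨f, hf, hvf⟩ := pm_exists hS hv
  rw [edgeAt_eq hS hf hvf]; exact ⟨hf, hvf⟩

theorem pmSet_mono {H' : Finset (Finset ℕ)} (h : H ⊆ H') : pmSet U H ⊆ pmSet U H' := by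
  intro S hS
  rw [mem_pmSet] at *
  exact ⟨hS.1.trans h, hS.2⟩

theorem pmCount_mono {H' : Finset (Finset ℕ)} (h : H ⊆ H') : pmCount U H ≤ pmCount U H' :=
  card_le_card (pmSet_mono h)

theorem pmSet_congr {H' : Finset (Finset ℕ)} (h : ∀ f, f ⊆ U → (f ∈ H ↔ f ∈ H')) :
    pmSet U H = pmSet U H' := by
  ext S
  constructor
  · intro hS
    have := mem_pmSet.1 hS
    exact mem_pmSet.2 ⟨fun f hf => (h f (pm_edge_sub hS hf)).1 (this.1 hf), this.2⟩
  · intro hS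
    have := mem_pmSet.1 hS
    exact mem_pmSet.2 ⟨fun f hf => (h f (pm_edge_sub hS hf)).2 (this.1 hf), this.2⟩

theorem pmCount_congr {H' : Finset (Finset ℕ)} (h : ∀ f, f ⊆ U → (f ∈ H ↔ f ∈ H')) :
    pmCount U H = pmCount U H' := by rw [pmCount, pmSet_congr h, pmCount]

theorem pm_sdiff (hne : ∅ ∉ H) (hS : S ∈ pmSet U H) {F : Finset (Finset ℕ)} (hF : F ⊆ S) :
    S \ F ∈ pmSet (U \ F.biUnion id) H := by
  have h := mem_pmSet.1 hS
  refine mem_pmSet.2 ⟨sdiff_subset.trans h.1, ?_, ?_⟩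
  · intro A hA B hB; exact h.2.1 A (mem_sdiff.1 hA).1 B (mem_sdiff.1 hB).1
  · ext v
    simp only [mem_biUnion, mem_sdiff, id]
    constructor
    · rintro ⟨f, ⟨hf, hfF⟩, hv⟩
      refine ⟨pm_edge_sub hS hf hv, ?_⟩
      rintro ⟨g, hg, hvg⟩
      exact hfF (pm_eq_of_mem hS hf (hF hg) hv hvg ▸ hg)
    · rintro ⟨hv, hv2⟩
      obtain ⟨f, hf, hvf⟩ := pm_exists hS hv
      exact ⟨f, ⟨hf, fun h => hv2 ⟨f, h, hvf⟩⟩, hvf⟩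

theorem pm_union (hne : ∅ ∉ H) {F : Finset (Finset ℕ)} (hFH : F ⊆ H)
    (hd : ∀ A ∈ F, ∀ B ∈ F, A ≠ B → A ∩ B = ∅) (hFU : F.biUnion id ⊆ U)
    (hS : S ∈ pmSet (U \ F.biUnion id) H) :
    S ∪ F ∈ pmSet U H ∧ Disjoint S F := by
  have h := mem_pmSet.1 hS
  have hdis : ∀ A ∈ S, ∀ B ∈ F, A ∩ B = ∅ := by
    intro A hA B hB
    ext v; simp only [mem_inter, notMem_empty, iff_false, not_and]
    intro hvA hvB
    have := pm_edge_sub hS hA hvA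
    exact (mem_sdiff.1 this).2 (mem_biUnion.2 ⟨B, hB, hvB⟩)
  refine ⟨mem_pmSet.2 ⟨union_subset h.1 hFH, ?_, ?_⟩, ?_⟩
  · intro A hA B hB hAB
    rcases mem_union.1 hA with hA | hA <;> rcases mem_union.1 hB with hB | hB
    · exact h.2.1 A hA B hB hAB
    · exact hdis A hA B hB
    · rw [inter_comm]; exact hdis B hB A hA
    · exact hd A hA B hB hAB
  · rw [union_biUnion, h.2.2]; exact sdiff_union_of_subset hFU
  · rw [Finset.disjoint_left]
    intro A hA hA'
    have := hdis A hA A hA'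
    rw [inter_self] at this
    exact hne (this ▸ hFH hA')

theorem card_containing (hne : ∅ ∉ H) {F : Finset (Finset ℕ)} (hFH : F ⊆ H)
    (hd : ∀ A ∈ F, ∀ B ∈ F, A ≠ B → A ∩ B = ∅) (hFU : F.biUnion id ⊆ U) :
    ((pmSet U H).filter (fun S => F ⊆ S)).card = pmCount (U \ F.biUnion id) H := by
  refine Finset.card_bij' (fun S _ => S \ F) (fun S _ => S ∪ F) ?_ ?_ ?_ ?_
  · intro S hS
    rw [mem_filter] at hS
    exact pm_sdiff hne hS.1 hS.2
  · intro S hS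
    rw [mem_filter]
    exact ⟨(pm_union hne hFH hd hFU hS).1, subset_union_right⟩
  · intro S hS
    rw [mem_filter] at hS
    exact sdiff_union_of_subset hS.2
  · intro S hS
    exact union_sdiff_cancel_right (pm_union hne hFH hd hFU hS).2

theorem card_containing_le (hne : ∅ ∉ H) (F : Finset (Finset ℕ)) :
    ((pmSet U H).filter (fun S => F ⊆ S)).card ≤ pmCount (U \ F.biUnion id) H := by
  refine Finset.card_le_card_of_injOn (fun S => S \ F) ?_ ?_
  · intro S hS
    rw [mem_coe, mem_filter] at hS
    exact pm_sdiff hne hS.1 hS.2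
  · intro S hS S' hS' h
    rw [mem_coe, mem_filter] at hS hS'
    have : S \ F = S' \ F := h
    rw [← sdiff_union_of_subset hS.2, this, sdiff_union_of_subset hS'.2]

theorem card_containing_one (hne : ∅ ∉ H) {f : Finset ℕ} (hf : f ∈ H) (hfU : f ⊆ U) :
    ((pmSet U H).filter (fun S => f ∈ S)).card = pmCount (U \ f) H := by
  have := card_containing (U := U) hne (F := {f}) (by simpa using hf) (by
    intro A hA B hB h; simp at hA hB; subst hA hB; exact absurd rfl h) (by simpa using hfU)
  simpa using this

theorem pmCount_vertex (hne : ∅ ∉ H) {v : ℕ} (hv : v ∈ U) :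
    pmCount U H = ∑ f ∈ H.filter (fun f => v ∈ f ∧ f ⊆ U), pmCount (U \ f) H := by
  rw [pmCount, Finset.card_eq_sum_card_fiberwise (f := fun S => edgeAt S v)
    (t := H.filter (fun f => v ∈ f ∧ f ⊆ U))]
  · refine sum_congr rfl fun f hf => ?_
    rw [mem_filter] at hf
    rw [← card_containing_one hne hf.1 hf.2.2]
    congr 1
    ext S; simp only [mem_filter]
    refine and_congr_right fun hS => ⟨fun h => h ▸ (edgeAt_mem hS hv).1, fun h => edgeAt_eq hS h hf.2.1⟩
  · intro S hS
    have hS : S ∈ pmSet U H := hS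
    have := edgeAt_mem hS hv
    rw [mem_coe, mem_filter]
    exact ⟨pm_sub hS this.1, this.2, pm_edge_sub hS this.1⟩

theorem pm_card {r : ℕ} (hr : ∀ f ∈ H, f.card = r) (hS : S ∈ pmSet U H) : S.card * r = U.card := by
  have h := mem_pmSet.1 hS
  rw [← h.2.2, Finset.card_biUnion, Finset.sum_congr rfl (g := fun _ => r)]
  · simp
  · intro f hf; exact hr f (h.1 hf)
  · intro A hA B hB hAB; exact disjoint_iff_inter_eq_empty.2 (h.2.1 A hA B hB hAB)

theorem pmCount_edge_sum (hne : ∅ ∉ H) {m r : ℕ} (hr : ∀ f ∈ H, f.card = r) (hr0 : 0 < r)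
    (hU : U.card = m * r) :
    ∑ f ∈ H.filter (fun f => f ⊆ U), pmCount (U \ f) H = m * pmCount U H := by
  have h1 : ∀ f ∈ H.filter (fun f => f ⊆ U), pmCount (U \ f) H =
      ∑ S ∈ pmSet U H, if f ∈ S then 1 else 0 := by
    intro f hf
    rw [mem_filter] at hf
    rw [← card_containing_one hne hf.1 hf.2, Finset.card_filter]
  rw [sum_congr rfl h1, sum_comm]
  have h2 : ∀ S ∈ pmSet U H, (∑ f ∈ H.filter (fun f => f ⊆ U), if f ∈ S then 1 else 0) = m := by
    intro S hS
    rw [← Finset.card_filter]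
    have : (H.filter (fun f => f ⊆ U)).filter (fun f => f ∈ S) = S := by
      ext f; simp only [mem_filter]
      exact ⟨fun h => h.2, fun h => ⟨⟨pm_sub hS h, pm_edge_sub hS h⟩, h⟩⟩
    rw [this]
    have := pm_card hr hS
    rw [hU] at this
    exact Nat.eq_of_mul_eq_mul_right hr0 this
  rw [sum_congr rfl h2]
  simp [pmCount, mul_comm]

theorem pmCount_insert_le (hne : ∅ ∉ H) {e : Finset ℕ} (he : e.Nonempty) :
    pmCount U (insert e H) ≤ pmCount U H + pmCount (U \ e) H := by
  classical
  by_cases heH : e ∈ H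
  · rw [insert_eq_of_mem heH]; omega
  rw [pmCount, ← Finset.card_filter_add_card_filter_not (fun S => e ∈ S), add_comm]
  refine Nat.add_le_add ?_ ?_
  · refine card_le_card fun S hS => ?_
    rw [mem_filter] at hS
    have h := mem_pmSet.1 hS.1
    refine mem_pmSet.2 ⟨fun f hf => ?_, h.2⟩
    rcases mem_insert.1 (h.1 hf) with h1 | h1
    · exact absurd (h1 ▸ hf) hS.2
    · exact h1
  · have hne' : ∅ ∉ insert e H := by
      simp [he.ne_empty.symm, hne]
    have := card_containing_le (U := U) hne' {e}
    simp only [singleton_subset_iff, singleton_biUnion, id] at this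
    refine this.trans (le_of_eq (pmCount_congr fun f hf => ?_))
    rw [mem_insert]
    constructor
    · rintro (rfl | h)
      · exfalso
        obtain ⟨v, hv⟩ := he
        exact (mem_sdiff.1 (hf hv)).2 hv
      · exact h
    · exact Or.inr

end basics


section bregman

variable {U : Finset ℕ} {H : Finset (Finset ℕ)} {S : Finset (Finset ℕ)}

/-- available vertices -/
noncomputable def av (U : Finset ℕ) (key : ℕ → ℕ) (S : Finset (Finset ℕ)) (v : ℕ) : Finset ℕ :=
  U.filter (fun u => ∀ u' ∈ edgeAt S u, key v ≤ key u')

noncomputable def NN (U : Finset ℕ) (H : Finset (Finset ℕ)) (ω : Finset ℕ → ℝ) (key : ℕ → ℕ)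
    (S : Finset (Finset ℕ)) (v : ℕ) : ℝ :=
  ∑ f ∈ H.filter (fun f => v ∈ f ∧ f ⊆ av U key S v), ω f

noncomputable def leadSet (U : Finset ℕ) (key : ℕ → ℕ) (S : Finset (Finset ℕ)) : Finset ℕ :=
  U.filter (fun v => ∀ u ∈ edgeAt S v, key v ≤ key u)

theorem edgeAt_erase {f : Finset ℕ} {u : ℕ}
    (huf : u ∉ f) : edgeAt (S.erase f) u = edgeAt S u := by
  have : (S.erase f).filter (fun g => u ∈ g) = S.filter (fun g => u ∈ g) := by
    ext g; simp only [mem_filter, mem_erase]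
    constructor
    · rintro ⟨⟨_, h1⟩, h2⟩; exact ⟨h1, h2⟩
    · rintro ⟨h1, h2⟩; exact ⟨⟨fun h => huf (h ▸ h2), h1⟩, h2⟩
  simp [edgeAt, this]

theorem bregman_key (hne : ∅ ∉ H) (ω : Finset ℕ → ℝ) (hω : ∀ f ∈ H, 0 < ω f) (key : ℕ → ℕ) :
    ∀ k : ℕ, ∀ U : Finset ℕ, U.card = k → Set.InjOn key U →
    ∑ S ∈ pmSet U H, ∏ v ∈ leadSet U key S, (ω (edgeAt S v) / NN U H ω key S v) ≤ 1 := by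
  intro k
  induction k using Nat.strong_induction_on with
  | _ k ih =>
  intro U hUk hinj
  rcases U.eq_empty_or_nonempty with rfl | hUne
  · have hsub : pmSet ∅ H ⊆ {∅} := by
      intro S hS
      rw [mem_singleton]
      by_contra h
      obtain ⟨f, hf⟩ := nonempty_iff_ne_empty.2 h
      have := pm_edge_sub hS hf
      rw [subset_empty] at this
      exact hne (this ▸ pm_sub hS hf)
    calc _ ≤ ∑ S ∈ ({∅} : Finset (Finset (Finset ℕ))), (1:ℝ) := by
          refine le_trans (le_of_eq ?_) (Finset.sum_le_sum_of_subset_of_nonneg hsub (fun _ _ _ => zero_le_one))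
          refine sum_congr rfl fun S _ => ?_
          simp [leadSet]
      _ = 1 := by simp
  obtain ⟨v, hvU, hmin⟩ := Finset.exists_min_image U key hUne
  set E := H.filter (fun f => v ∈ f ∧ f ⊆ U) with hE
  set N := ∑ f ∈ E, ω f with hN
  have hmaps : ∀ S ∈ pmSet U H, edgeAt S v ∈ E := by
    intro S hS
    have := edgeAt_mem hS hvU
    exact mem_filter.2 ⟨pm_sub hS this.1, this.2, pm_edge_sub hS this.1⟩
  rw [← Finset.sum_fiberwise_of_maps_to hmaps]
  have hNN : ∀ S ∈ pmSet U H, NN U H ω key S v = N := by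
    intro S hS
    have : av U key S v = U := by
      rw [av, filter_true_of_mem]
      intro u hu u' hu'
      exact hmin u' (pm_edge_sub hS (edgeAt_mem hS hu).1 hu')
    rw [NN, this]
  have key1 : ∀ f ∈ E, ∑ S ∈ (pmSet U H).filter (fun S => edgeAt S v = f),
      ∏ w ∈ leadSet U key S, (ω (edgeAt S w) / NN U H ω key S w) ≤ ω f / N := by
    intro f hf
    have hf' := mem_filter.1 hf
    have hNpos : 0 < N := Finset.sum_pos (fun g hg => hω g (mem_filter.1 hg).1) ⟨f, hf⟩
    have hcard : (U \ f).card < k := by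
      rw [← hUk]
      exact card_lt_card (sdiff_ssubset hf'.2.2 ⟨v, hf'.2.1⟩)
    have IH := ih _ hcard (U \ f) rfl (hinj.mono (by simp))
    have hfac : ∀ S ∈ (pmSet U H).filter (fun S => edgeAt S v = f),
        ∏ w ∈ leadSet U key S, (ω (edgeAt S w) / NN U H ω key S w) =
        ω f / N * ∏ w ∈ leadSet (U \ f) key (S.erase f),
          (ω (edgeAt (S.erase f) w) / NN (U \ f) H ω key (S.erase f) w) := by
      intro S hS
      rw [mem_filter] at hS
      obtain ⟨hS, hSv⟩ := hS
      have hfS : f ∈ S := hSv ▸ (edgeAt_mem hS hvU).1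
      have hlead : leadSet U key S = insert v (leadSet (U \ f) key (S.erase f)) := by
        ext w
        simp only [leadSet, mem_insert, mem_filter, mem_sdiff]
        constructor
        · rintro ⟨hw, hl⟩
          by_cases hwf : w ∈ f
          · left
            have := edgeAt_eq hS hfS hwf
            rw [this] at hl
            exact hinj hw hvU (le_antisymm (hl v hf'.2.1) (hmin w hw))
          · right
            exact ⟨⟨hw, hwf⟩, by rw [edgeAt_erase hwf]; exact hl⟩
        · rintro (rfl | ⟨⟨hw, hwf⟩, hl⟩)
          · exact ⟨hvU, fun u hu => hmin u (pm_edge_sub hS (edgeAt_mem hS hvU).1 hu)⟩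
          · rw [edgeAt_erase hwf] at hl
            exact ⟨hw, hl⟩
      rw [hlead, prod_insert]
      · rw [hNN S hS, hSv]
        congr 1
        refine prod_congr rfl fun w hw => ?_
        simp only [leadSet, mem_filter, mem_sdiff] at hw
        obtain ⟨⟨hw, hwf⟩, hl⟩ := hw
        rw [edgeAt_erase hwf]
        congr 1
        have : av U key S w = av (U \ f) key (S.erase f) w := by
          ext u
          simp only [av, mem_filter, mem_sdiff]
          constructor
          · rintro ⟨hu, hl⟩
            have huf : u ∉ f := by
              intro huf
              rw [edgeAt_eq hS hfS huf] at hl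
              have h1 := hl v hf'.2.1
              have h2 := hmin w hw
              have := hinj hw hvU (le_antisymm h1 h2)
              exact hwf (this ▸ hf'.2.1)
            exact ⟨⟨hu, huf⟩, by rw [edgeAt_erase huf]; exact hl⟩
          · rintro ⟨⟨hu, huf⟩, hl⟩
            rw [edgeAt_erase huf] at hl
            exact ⟨hu, hl⟩
        rw [NN, NN, this]
      · simp only [leadSet, mem_filter, mem_sdiff]
        rintro ⟨⟨_, h⟩, _⟩
        exact h hf'.2.1
    rw [sum_congr rfl hfac, ← mul_sum]
    refine mul_le_of_le_one_right (div_nonneg (hω f hf'.1).le hNpos.le) (le_trans ?_ IH)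
    rw [← Finset.sum_image (s := (pmSet U H).filter (fun S => edgeAt S v = f)) (g := fun S => S.erase f)
      (f := fun S => ∏ w ∈ leadSet (U \ f) key S, (ω (edgeAt S w) / NN (U \ f) H ω key S w))]
    · refine Finset.sum_le_sum_of_subset_of_nonneg ?_ ?_
      · intro S hS
        obtain ⟨S', hS', rfl⟩ := mem_image.1 hS
        rw [mem_filter] at hS'
        have hfS : f ∈ S' := hS'.2 ▸ (edgeAt_mem hS'.1 hvU).1
        have := pm_sdiff hne hS'.1 (F := {f}) (by simpa using hfS)
        simpa [sdiff_singleton_eq_erase] using this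
      · intro S hS _
        refine prod_nonneg fun w hw => div_nonneg ?_ (sum_nonneg fun g hg => (hω g (mem_filter.1 hg).1).le)
        have hw' : w ∈ U \ f := (mem_filter.1 hw).1
        exact (hω _ (pm_sub hS (edgeAt_mem hS hw').1)).le
    · intro S hS S' hS' h
      rw [mem_coe, mem_filter] at hS hS'
      have h1 : f ∈ S := hS.2 ▸ (edgeAt_mem hS.1 hvU).1
      have h2 : f ∈ S' := hS'.2 ▸ (edgeAt_mem hS'.1 hvU).1
      have h : S.erase f = S'.erase f := h
      rw [← insert_erase h1, h, insert_erase h2]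
  refine (sum_le_sum key1).trans ?_
  rw [← sum_div]
  exact div_self_le_one _

end bregman

section levels
variable {U : Finset ℕ} {H : Finset (Finset ℕ)} {S : Finset (Finset ℕ)} {L : ℕ}

def lev (σ : {x // x ∈ U} → Fin L) (v : ℕ) : ℕ := if h : v ∈ U then (σ ⟨v, h⟩ : ℕ) else 0

theorem card_lev (hL : 0 < L) {X : Finset ℕ} (hX : X ⊆ U) {v : ℕ} (hv : v ∈ X) {l : ℕ} (hl : l < L) :
    (((univ : Finset ({x // x ∈ U} → Fin L)).filter
      (fun σ => lev σ v = l ∧ ∀ u ∈ X, l ≤ lev σ u)).card : ℝ) =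
    (L:ℝ) ^ U.card * ((1 / L) * (((L:ℝ) - l) / L) ^ (X.card - 1)) := by
  classical
  have h1 : (univ : Finset ({x // x ∈ U} → Fin L)).filter
      (fun σ => lev σ v = l ∧ ∀ u ∈ X, l ≤ lev σ u) =
      Fintype.piFinset (fun u : {x // x ∈ U} => if u.1 = v then {(⟨l, hl⟩ : Fin L)} else
        if u.1 ∈ X then Finset.Ici (⟨l, hl⟩ : Fin L) else univ) := by
    ext σ
    simp only [mem_filter, mem_univ, true_and, Fintype.mem_piFinset]
    constructor
    · rintro ⟨h1, h2⟩ ⟨u, hu⟩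
      dsimp only
      split_ifs with h3 h4
      · subst h3
        simp only [lev, hu, dif_pos] at h1
        simp [Fin.ext_iff, h1]
      · have := h2 u h4
        simp only [lev, hu, dif_pos] at this
        simpa [Fin.le_def] using this
      · exact mem_univ _
    · intro h
      have hvv := h ⟨v, hX hv⟩
      simp only [if_true, mem_singleton] at hvv
      have hlv : lev σ v = l := by simp [lev, hX hv, hvv]
      refine ⟨hlv, fun u hu => ?_⟩
      by_cases huv : u = v
      · rw [huv, hlv]
      · have := h ⟨u, hX hu⟩
        simp only [huv, if_false, hu, if_true, mem_Ici] at this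
        simpa [lev, hX hu, Fin.le_def] using this
  rw [h1, Fintype.card_piFinset]
  have h2 : ∀ u : {x // x ∈ U}, (if u.1 = v then {(⟨l, hl⟩ : Fin L)} else
        if u.1 ∈ X then Finset.Ici (⟨l, hl⟩ : Fin L) else univ).card =
        (fun w => if w = v then 1 else if w ∈ X then L - l else L) u.1 := by
    intro u
    dsimp only
    split_ifs <;> simp
  rw [prod_congr rfl (fun u _ => h2 u), Finset.prod_coe_sort U (fun w => if w = v then 1 else if w ∈ X then L - l else L)]
  rw [← Finset.prod_sdiff hX, ← Finset.mul_prod_erase X _ hv]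
  rw [prod_congr rfl (g := fun _ => L), prod_congr (s₁ := X.erase v) rfl (g := fun _ => L - l)]
  · simp only [prod_const, if_true, one_mul, card_sdiff_of_subset hX, card_erase_of_mem hv]
    have hc : X.card ≤ U.card := card_le_card hX
    have hc1 : 1 ≤ X.card := card_pos.2 ⟨v, hv⟩
    push_cast [Nat.cast_sub hl.le]
    obtain ⟨a, ha⟩ := Nat.exists_eq_add_of_le hc
    obtain ⟨b, hb⟩ := Nat.exists_eq_add_of_le hc1
    rw [ha, hb]
    have : (L:ℝ) ≠ 0 := by positivity
    simp only [Nat.add_sub_cancel_left, div_pow]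
    field_simp
    ring
  · intro u hu
    rw [mem_erase] at hu
    simp [hu.1, hu.2]
  · intro u hu
    rw [mem_sdiff] at hu
    have : u ≠ v := fun h => hu.2 (h ▸ hv)
    simp [this, hu.2]

end levels

section levels2
variable {U : Finset ℕ} {H : Finset (Finset ℕ)} {S : Finset (Finset ℕ)} {L : ℕ}

theorem sum_log_le {ι : Type*} (A : Finset ι) (g : ι → ℝ) (hg : ∀ i ∈ A, 0 ≤ g i) (a : ℝ) (ha : 0 < a)
    (h : ∑ i ∈ A, (1 + g i) ≤ A.card * a) : ∑ i ∈ A, Real.log (1 + g i) ≤ A.card * Real.log a := by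
  have h1 : ∀ i ∈ A, Real.log (1 + g i) ≤ Real.log a + ((1 + g i) / a - 1) := by
    intro i hi
    have h0 : 0 < 1 + g i := by linarith [hg i hi]
    have := Real.log_le_sub_one_of_pos (div_pos h0 ha)
    rw [Real.log_div h0.ne' ha.ne'] at this
    linarith
  refine (sum_le_sum h1).trans ?_
  rw [sum_add_distrib, sum_sub_distrib, ← sum_div]
  simp only [sum_const, nsmul_eq_mul, mul_one]
  have : (∑ i ∈ A, (1 + g i)) / a ≤ A.card := by rw [div_le_iff₀ ha]; exact h
  linarith

open scoped Classical in
theorem nontrans_card {r C : ℕ} (hr : ∀ f ∈ H, f.card = r) (hS : S ∈ pmSet U H)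
    (hC : ∀ u ∈ U, ∀ u' ∈ U, u ≠ u' → (H.filter (fun f => f ⊆ U ∧ u ∈ f ∧ u' ∈ f)).card ≤ C) :
    (H.filter (fun f => f ⊆ U ∧ ¬ Set.InjOn (edgeAt S) f)).card ≤ U.card * (r * C) := by
  have hsub : H.filter (fun f => f ⊆ U ∧ ¬ Set.InjOn (edgeAt S) f) ⊆
      U.biUnion (fun u => ((edgeAt S u).erase u).biUnion (fun u' =>
        H.filter (fun f => f ⊆ U ∧ u ∈ f ∧ u' ∈ f))) := by
    intro f hf
    rw [mem_filter] at hf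
    obtain ⟨hf, hfU, hn⟩ := hf
    simp only [Set.InjOn, not_forall] at hn
    obtain ⟨u, hu, u', hu', he, hne⟩ := hn
    rw [mem_coe] at hu hu'
    simp only [mem_biUnion, mem_filter, mem_erase]
    refine ⟨u, hfU hu, u', ⟨fun h => hne h.symm, ?_⟩, hf, hfU, hu, hu'⟩
    rw [he]; exact (edgeAt_mem hS (hfU hu')).2
  refine (card_le_card hsub).trans (card_biUnion_le_card_mul _ _ _ fun u hu => ?_)
  have he := edgeAt_mem hS hu
  refine (card_biUnion_le_card_mul _ _ C fun u' hu' => ?_).trans ?_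
  · rw [mem_erase] at hu'
    exact hC u hu u' (pm_edge_sub hS he.1 hu'.2) (fun h => hu'.1 h.symm)
  · refine Nat.mul_le_mul_right _ ((card_erase_le).trans ?_)
    rw [hr _ (pm_sub hS he.1)]

theorem card_trans {r : ℕ} (hr : ∀ f ∈ H, f.card = r) (hS : S ∈ pmSet U H) {f : Finset ℕ}
    (hf : f ∈ H) (hfU : f ⊆ U) (hi : Set.InjOn (edgeAt S) f) :
    (f.biUnion (edgeAt S)).card = r * r := by
  rw [card_biUnion, sum_congr rfl (g := fun _ => r)]
  · rw [sum_const, hr f hf, smul_eq_mul]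
  · intro u hu
    exact hr _ (pm_sub hS (edgeAt_mem hS (hfU hu)).1)
  · intro u hu u' hu' hne
    refine disjoint_iff_inter_eq_empty.2 ?_
    exact (mem_pmSet.1 hS).2.1 _ (edgeAt_mem hS (hfU hu)).1 _ (edgeAt_mem hS (hfU hu')).1
      (fun h => hne (hi hu hu' h))

noncomputable def NP (U : Finset ℕ) (H : Finset (Finset ℕ)) (ω : Finset ℕ → ℝ) (S : Finset (Finset ℕ))
    (l v : ℕ) (σ : {x // x ∈ U} → Fin L) : ℝ :=
  ∑ f ∈ H.filter (fun f => v ∈ f ∧ f ⊆ U),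
    if (∀ u ∈ f.biUnion (edgeAt S), l ≤ lev σ u) then ω f else 0

noncomputable def Aset (U : Finset ℕ) (S : Finset (Finset ℕ)) (L l : ℕ) :
    Finset (ℕ × ({x // x ∈ U} → Fin L)) :=
  (U ×ˢ univ).filter (fun q => lev q.2 q.1 = l ∧ ∀ u ∈ edgeAt S q.1, l ≤ lev q.2 u)

theorem card_Aset {r m : ℕ} (hr : ∀ f ∈ H, f.card = r) (hU : U.card = m * r) (hS : S ∈ pmSet U H)
    (hL : 0 < L) {l : ℕ} (hl : l < L) :
    ((Aset U S L l).card : ℝ) = (m * r) * ((L:ℝ) ^ U.card * ((1 / L) * (((L:ℝ) - l) / L) ^ (r - 1))) := by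
  rw [Aset, card_filter, sum_product, Nat.cast_sum, sum_congr rfl
    (g := fun _ => (L:ℝ) ^ U.card * ((1 / L) * (((L:ℝ) - l) / L) ^ (r - 1)))]
  · rw [sum_const, hU]; simp
  · intro v hv
    have he := edgeAt_mem hS hv
    dsimp only
    rw [← card_filter, card_lev hL (pm_edge_sub hS he.1) he.2 hl, hr _ (pm_sub hS he.1)]

theorem sum_NP_le {r m C : ℕ} (hr : ∀ f ∈ H, f.card = r) (hr1 : 1 ≤ r) (hU : U.card = m * r)
    (hS : S ∈ pmSet U H)
    (hC : ∀ u ∈ U, ∀ u' ∈ U, u ≠ u' → (H.filter (fun f => f ⊆ U ∧ u ∈ f ∧ u' ∈ f)).card ≤ C)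
    (ω : Finset ℕ → ℝ) (lam : ℝ) (hω : ∀ f ∈ H, 0 < ω f) (hlam : ∀ f ∈ H, ω f ≤ lam) (d : ℝ)
    (hd : ∑ f ∈ H.filter (fun f => f ⊆ U), ω f ≤ m * d) (hlam0 : 0 ≤ lam)
    (hL : 0 < L) {l : ℕ} (hl : l < L) :
    ∑ q ∈ Aset U S L l, NP U H ω S l q.1 q.2 ≤
      (Aset U S L l).card * (lam * (r ^ 2 * C) + d * (((L:ℝ) - l) / L) ^ (r * (r - 1))) := by
  classical
  set t : ℝ := ((L:ℝ) - l) / L with ht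
  have hLR : (0:ℝ) < L := by exact_mod_cast hL
  have hlR : (l:ℝ) < L := by exact_mod_cast hl
  have ht0 : 0 ≤ t := div_nonneg (by linarith) hLR.le
  set Q : ℝ := (L:ℝ) ^ U.card * ((1 / L) * t ^ (r - 1)) with hQ
  have hQ0 : 0 ≤ Q := by positivity
  rw [card_Aset hr hU hS hL hl]
  rw [Aset, sum_filter, sum_product]
  have h1 : ∀ v ∈ U, ∑ σ : {x // x ∈ U} → Fin L,
      (if lev σ v = l ∧ ∀ u ∈ edgeAt S v, l ≤ lev σ u then NP U H ω S l v σ else 0) ≤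
      ∑ f ∈ H.filter (fun f => v ∈ f ∧ f ⊆ U),
        ω f * (Q * (t ^ (r * (r-1)) + if Set.InjOn (edgeAt S) f then 0 else 1)) := by
    intro v hv
    have he := edgeAt_mem hS hv
    have h2 : ∀ σ : {x // x ∈ U} → Fin L,
      (if lev σ v = l ∧ ∀ u ∈ edgeAt S v, l ≤ lev σ u then NP U H ω S l v σ else 0) =
      ∑ f ∈ H.filter (fun f => v ∈ f ∧ f ⊆ U), ω f *
        (if (lev σ v = l ∧ ∀ u ∈ edgeAt S v, l ≤ lev σ u) ∧ (∀ u ∈ f.biUnion (edgeAt S), l ≤ lev σ u)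
          then 1 else 0) := by
      intro σ
      by_cases h : lev σ v = l ∧ ∀ u ∈ edgeAt S v, l ≤ lev σ u
      · rw [if_pos h, NP]
        refine sum_congr rfl fun f _ => ?_
        by_cases h' : ∀ u ∈ f.biUnion (edgeAt S), l ≤ lev σ u
        · rw [if_pos h', if_pos ⟨h, h'⟩, mul_one]
        · rw [if_neg h', if_neg (fun h2 => h' h2.2), mul_zero]
      · rw [if_neg h]
        simp [h]
    rw [sum_congr rfl (fun σ _ => h2 σ), sum_comm]
    refine sum_le_sum fun f hf => ?_
    rw [mem_filter] at hf
    obtain ⟨hf, hvf, hfU⟩ := hf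
    rw [← mul_sum]
    refine mul_le_mul_of_nonneg_left ?_ (hω f hf).le
    rw [Finset.sum_boole]
    by_cases hi : Set.InjOn (edgeAt S) f
    · rw [if_pos hi, add_zero]
      have hX : f.biUnion (edgeAt S) ⊆ U := by
        rw [biUnion_subset]
        intro u hu; exact pm_edge_sub hS (edgeAt_mem hS (hfU hu)).1
      have hvX : v ∈ f.biUnion (edgeAt S) := mem_biUnion.2 ⟨v, hvf, he.2⟩
      have := card_lev hL hX hvX hl
      rw [card_trans hr hS hf hfU hi] at this
      have h3 : (L:ℝ) ^ U.card * ((1 / L) * t ^ (r * r - 1)) = Q * t ^ (r * (r - 1)) := by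
        rw [hQ]
        have : r * r - 1 = (r - 1) + r * (r-1) := by
          obtain ⟨k, rfl⟩ := Nat.exists_eq_add_of_le hr1
          simp only [Nat.add_sub_cancel_left]
          have : (1 + k) * (1 + k) = 1 + (k + (1 + k) * k) := by ring
          omega
        rw [this, pow_add]; ring
      rw [← h3, ← this]
      exact_mod_cast card_le_card (fun σ hσ => by
        rw [mem_filter] at hσ ⊢
        exact ⟨hσ.1, hσ.2.1.1, hσ.2.2⟩)
    · rw [if_neg hi]
      have := card_lev hL (pm_edge_sub hS he.1) he.2 hl
      rw [hr _ (pm_sub hS he.1)] at this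
      have h4 : Q ≤ Q * (t ^ (r * (r-1)) + 1) := by
        have : 0 ≤ Q * t ^ (r * (r-1)) := by positivity
        linarith
      refine le_trans ?_ h4
      rw [hQ, ← this]
      exact_mod_cast card_le_card (fun σ hσ => by
        rw [mem_filter] at hσ ⊢
        exact ⟨hσ.1, hσ.2.1⟩)
  refine (sum_le_sum h1).trans ?_
  have h5 : ∑ v ∈ U, ∑ f ∈ H.filter (fun f => v ∈ f ∧ f ⊆ U),
        ω f * (Q * (t ^ (r * (r-1)) + if Set.InjOn (edgeAt S) f then 0 else 1)) =
      ∑ f ∈ H.filter (fun f => f ⊆ U), r * 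
        (ω f * (Q * (t ^ (r * (r-1)) + if Set.InjOn (edgeAt S) f then 0 else 1))) := by
    rw [Finset.sum_comm' (t' := H.filter (fun f => f ⊆ U)) (s' := fun f => f)]
    · refine sum_congr rfl fun f hf => ?_
      rw [sum_const, hr f (mem_filter.1 hf).1, nsmul_eq_mul]
    · intro v f
      simp only [mem_filter]
      constructor
      · rintro ⟨_, h1, h2, h3⟩; exact ⟨h2, h1, h3⟩
      · rintro ⟨h1, h2, h3⟩; exact ⟨h3 h1, h2, h1, h3⟩
  rw [h5]
  have h6 : ∑ f ∈ H.filter (fun f => f ⊆ U), r * 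
        (ω f * (Q * (t ^ (r * (r-1)) + if Set.InjOn (edgeAt S) f then 0 else 1))) =
      r * Q * t ^ (r * (r-1)) * ∑ f ∈ H.filter (fun f => f ⊆ U), ω f +
      r * Q * ∑ f ∈ H.filter (fun f => f ⊆ U ∧ ¬ Set.InjOn (edgeAt S) f), ω f := by
    rw [← filter_filter, sum_filter (p := fun f => ¬ Set.InjOn (edgeAt S) _), mul_sum, mul_sum, ← sum_add_distrib]
    refine sum_congr rfl fun f _ => ?_
    by_cases hi : Set.InjOn (edgeAt S) f
    · simp [hi]; ring
    · simp [hi]; ring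
  rw [h6]
  have h7 : ∑ f ∈ H.filter (fun f => f ⊆ U ∧ ¬ Set.InjOn (edgeAt S) f), ω f ≤ (m * r) * (r * C) * lam := by
    refine (sum_le_card_nsmul _ _ lam fun f hf => hlam f (mem_filter.1 hf).1).trans ?_
    rw [nsmul_eq_mul]
    refine mul_le_mul_of_nonneg_right ?_ hlam0
    have := nontrans_card hr hS hC
    rw [hU] at this
    exact_mod_cast this
  have hrQ : 0 ≤ r * Q := by positivity
  have h8 := mul_le_mul_of_nonneg_left hd (mul_nonneg hrQ (pow_nonneg ht0 (r * (r-1))))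
  have h9 := mul_le_mul_of_nonneg_left h7 hrQ
  refine (add_le_add h8 h9).trans (le_of_eq ?_)
  ring

end levels2

section breg
variable {U : Finset ℕ} {H : Finset (Finset ℕ)} {S : Finset (Finset ℕ)} {L : ℕ}

noncomputable def FF (r L : ℕ) (b d : ℝ) : ℝ :=
  r * ∑ j ∈ range L, (1 / (L:ℝ)) * (((j:ℝ) + 1) / L) ^ (r - 1) *
    Real.log (b + d * (((j:ℝ) + 1) / L) ^ (r * (r - 1)))

/-- key with ties broken by index -/
def keyOf (σ : {x // x ∈ U} → Fin L) (v : ℕ) : ℕ := lev σ v * (U.sup id + 1) + v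

theorem keyOf_inj (σ : {x // x ∈ U} → Fin L) : Set.InjOn (keyOf σ) U := by
  intro v hv u hu h
  have h1 : v < U.sup id + 1 := Nat.lt_succ_of_le (Finset.le_sup (f := id) hv)
  have h2 : u < U.sup id + 1 := Nat.lt_succ_of_le (Finset.le_sup (f := id) hu)
  unfold keyOf at h
  have h3 := congrArg (· % (U.sup id + 1)) h
  simp only [Nat.mul_add_mod_self_right, Nat.mod_eq_of_lt h1, Nat.mod_eq_of_lt h2] at h3
  exact h3

theorem keyOf_le (σ : {x // x ∈ U} → Fin L) {v u : ℕ} (hu : u ∈ U)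
    (h : keyOf σ v ≤ keyOf σ u) : lev σ v ≤ lev σ u := by
  have h2 : u < U.sup id + 1 := Nat.lt_succ_of_le (Finset.le_sup (f := id) hu)
  unfold keyOf at h
  by_contra hlt
  push Not at hlt
  have : (lev σ u + 1) * (U.sup id + 1) ≤ lev σ v * (U.sup id + 1) := Nat.mul_le_mul_right _ hlt
  rw [add_mul, one_mul] at this
  omega

theorem prod_lead (ω : Finset ℕ → ℝ) (hne : ∅ ∉ H) (hS : S ∈ pmSet U H) (key : ℕ → ℕ)
    (hk : Set.InjOn key U) : ∏ v ∈ leadSet U key S, ω (edgeAt S v) = ∏ f ∈ S, ω f := by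
  refine Finset.prod_bij (fun v _ => edgeAt S v) ?_ ?_ ?_ ?_
  · intro v hv
    exact (edgeAt_mem hS (mem_filter.1 hv).1).1
  · intro v hv u hu h
    have hv := mem_filter.1 hv
    have hu := mem_filter.1 hu
    have h : edgeAt S v = edgeAt S u := h
    refine hk hv.1 hu.1 (le_antisymm (hv.2 u ?_) (hu.2 v ?_))
    · rw [h]; exact (edgeAt_mem hS hu.1).2
    · rw [← h]; exact (edgeAt_mem hS hv.1).2
  · intro f hf
    have hfne : f.Nonempty := nonempty_iff_ne_empty.2 (fun h => hne (h ▸ pm_sub hS hf))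
    obtain ⟨v, hv, hm⟩ := Finset.exists_min_image f key hfne
    have he := edgeAt_eq hS hf hv
    refine ⟨v, mem_filter.2 ⟨pm_edge_sub hS hf hv, ?_⟩, he⟩
    rw [he]; exact hm
  · intros; rfl

theorem NN_bounds (ω : Finset ℕ → ℝ) (hω : ∀ f ∈ H, 0 < ω f) (hS : S ∈ pmSet U H)
    (σ : {x // x ∈ U} → Fin L) {v : ℕ} (hv : v ∈ leadSet U (keyOf σ) S) :
    0 < NN U H ω (keyOf σ) S v ∧ NN U H ω (keyOf σ) S v ≤ NP U H ω S (lev σ v) v σ := by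
  have hv := mem_filter.1 hv
  have he := edgeAt_mem hS hv.1
  constructor
  · refine Finset.sum_pos (fun g hg => hω g (mem_filter.1 hg).1) ⟨edgeAt S v, mem_filter.2 ⟨pm_sub hS he.1, he.2, ?_⟩⟩
    intro u hu
    refine mem_filter.2 ⟨pm_edge_sub hS he.1 hu, ?_⟩
    rw [edgeAt_eq hS he.1 hu]; exact hv.2
  · unfold NN NP
    rw [← sum_filter]
    refine Finset.sum_le_sum_of_subset_of_nonneg ?_ (fun f hf _ => (hω f (mem_filter.1 (mem_filter.1 hf).1).1).le)
    intro f hf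
    have hf := mem_filter.1 hf
    refine mem_filter.2 ⟨mem_filter.2 ⟨hf.1, hf.2.1, hf.2.2.trans (filter_subset _ _)⟩, ?_⟩
    intro u hu
    obtain ⟨w, hw, hu⟩ := mem_biUnion.1 hu
    have hw' := mem_filter.1 (hf.2.2 hw)
    exact keyOf_le σ (pm_edge_sub hS (edgeAt_mem hS hw'.1).1 hu) (hw'.2 u hu)

theorem sum_X_le {r m C : ℕ} (hr : ∀ f ∈ H, f.card = r) (hr1 : 1 ≤ r) (hU : U.card = m * r)
    (hS : S ∈ pmSet U H)
    (hC : ∀ u ∈ U, ∀ u' ∈ U, u ≠ u' → (H.filter (fun f => f ⊆ U ∧ u ∈ f ∧ u' ∈ f)).card ≤ C)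
    (ω : Finset ℕ → ℝ) (lam : ℝ) (hω : ∀ f ∈ H, 0 < ω f) (hlam : ∀ f ∈ H, ω f ≤ lam) (d : ℝ)
    (hd : ∑ f ∈ H.filter (fun f => f ⊆ U), ω f ≤ m * d) (hlam0 : 0 ≤ lam) (hd0 : 0 ≤ d)
    (hL : 0 < L) :
    ∑ σ : {x // x ∈ U} → Fin L, ∑ v ∈ leadSet U (keyOf σ) S, Real.log (NN U H ω (keyOf σ) S v) ≤
      (L:ℝ) ^ U.card * (m * FF r L (1 + lam * (r ^ 2 * C)) d) := by
  classical
  have hLR : (0:ℝ) < L := by exact_mod_cast hL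
  have hNP0 : ∀ l v (σ : {x // x ∈ U} → Fin L), 0 ≤ NP U H ω S l v σ := by
    intro l v σ
    refine sum_nonneg fun f hf => ?_
    split_ifs
    · exact (hω f (mem_filter.1 hf).1).le
    · exact le_rfl
  have h1 : ∀ σ : {x // x ∈ U} → Fin L, 
      ∑ v ∈ leadSet U (keyOf σ) S, Real.log (NN U H ω (keyOf σ) S v) ≤
      ∑ l ∈ range L, ∑ v ∈ U, if lev σ v = l ∧ ∀ u ∈ edgeAt S v, l ≤ lev σ u then
        Real.log (1 + NP U H ω S l v σ) else 0 := by
    intro σ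
    rw [sum_comm]
    refine (sum_le_sum (g := fun v => ∑ l ∈ range L, if lev σ v = l ∧ ∀ u ∈ edgeAt S v, l ≤ lev σ u then
        Real.log (1 + NP U H ω S l v σ) else 0) ?_).trans (Finset.sum_le_sum_of_subset_of_nonneg (filter_subset _ _) ?_)
    · intro v hv
      have hb := NN_bounds ω hω hS σ hv
      have hv' := mem_filter.1 hv
      have hlt : lev σ v < L := by
        simp only [lev, hv'.1, dif_pos]; exact (σ _).2
      refine le_trans ?_ (single_le_sum (f := fun l => if lev σ v = l ∧ ∀ u ∈ edgeAt S v, l ≤ lev σ u then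
        Real.log (1 + NP U H ω S l v σ) else 0) ?_ (mem_range.2 hlt))
      · rw [if_pos]
        · exact Real.log_le_log hb.1 (by linarith [hb.2])
        · exact ⟨rfl, fun u hu => keyOf_le σ (pm_edge_sub hS (edgeAt_mem hS hv'.1).1 hu) (hv'.2 u hu)⟩
      · intro l _
        split_ifs
        · exact Real.log_nonneg (by linarith [hNP0 l v σ])
        · exact le_rfl
    · intro v _ _
      refine sum_nonneg fun l _ => ?_
      split_ifs
      · exact Real.log_nonneg (by linarith [hNP0 l v σ])
      · exact le_rfl
  refine (sum_le_sum fun σ _ => h1 σ).trans ?_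
  rw [sum_comm]
  have h2 : ∀ l ∈ range L, ∑ σ : {x // x ∈ U} → Fin L, ∑ v ∈ U,
      (if lev σ v = l ∧ ∀ u ∈ edgeAt S v, l ≤ lev σ u then Real.log (1 + NP U H ω S l v σ) else 0) ≤
      (m * r) * ((L:ℝ) ^ U.card * ((1 / L) * (((L:ℝ) - l) / L) ^ (r - 1))) *
       Real.log (1 + lam * (r ^ 2 * C) + d * (((L:ℝ) - l) / L) ^ (r * (r - 1))) := by
    intro l hl
    rw [mem_range] at hl
    have ht0 : 0 ≤ ((L:ℝ) - l) / L := div_nonneg (by have : (l:ℝ) < L := by exact_mod_cast hl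
                                                     linarith) hLR.le
    have hA : ∑ σ : {x // x ∈ U} → Fin L, ∑ v ∈ U,
      (if lev σ v = l ∧ ∀ u ∈ edgeAt S v, l ≤ lev σ u then Real.log (1 + NP U H ω S l v σ) else 0) =
      ∑ q ∈ Aset U S L l, Real.log (1 + NP U H ω S l q.1 q.2) := by
      rw [sum_comm, Aset, sum_filter, sum_product]
    rw [hA, ← card_Aset hr hU hS hL hl]
    refine sum_log_le _ _ (fun q _ => hNP0 _ _ _) _ (by positivity) ?_
    rw [sum_add_distrib, sum_const, nsmul_eq_mul, mul_one]
    have := sum_NP_le hr hr1 hU hS hC ω lam hω hlam d hd hlam0 hL hl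
    refine (add_le_add_right this _).trans (le_of_eq ?_)
    ring
  refine (sum_le_sum h2).trans (le_of_eq ?_)
  rw [FF, ← Finset.sum_range_reflect, mul_sum, mul_sum, mul_sum]
  refine sum_congr rfl fun j hj => ?_
  rw [mem_range] at hj
  have : (L:ℝ) - ((L - 1 - j : ℕ):ℝ) = j + 1 := by
    rw [Nat.sub_sub, Nat.cast_sub (by omega)]; push_cast; ring
  rw [this]
  ring

theorem weighted_bregman {r m C : ℕ} (hr : ∀ f ∈ H, f.card = r) (hr1 : 1 ≤ r) (hU : U.card = m * r)
    (hC : ∀ u ∈ U, ∀ u' ∈ U, u ≠ u' → (H.filter (fun f => f ⊆ U ∧ u ∈ f ∧ u' ∈ f)).card ≤ C)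
    (ω : Finset ℕ → ℝ) (lam : ℝ) (hω : ∀ f ∈ H, 0 < ω f) (hlam : ∀ f ∈ H, ω f ≤ lam) (d : ℝ)
    (hd : ∑ f ∈ H.filter (fun f => f ⊆ U), ω f ≤ m * d) (hlam0 : 0 ≤ lam) (hd0 : 0 ≤ d)
    (hL : 0 < L) :
    ∑ S ∈ pmSet U H, ∏ f ∈ S, ω f ≤ Real.exp (m * FF r L (1 + lam * (r ^ 2 * C)) d) := by
  classical
  have hne : ∅ ∉ H := fun h => by have := hr _ h; simp at this; omega
  set a : ℝ := m * FF r L (1 + lam * (r ^ 2 * C)) d with ha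
  set X : Finset (Finset ℕ) → ({x // x ∈ U} → Fin L) → ℝ :=
    fun S σ => ∑ v ∈ leadSet U (keyOf σ) S, Real.log (NN U H ω (keyOf σ) S v) with hX
  have hLR : (0:ℝ) < L := by exact_mod_cast hL
  set Q : ℝ := (L:ℝ) ^ U.card with hQ
  have hQ0 : 0 < Q := by positivity
  have hcard : ((univ : Finset ({x // x ∈ U} → Fin L)).card : ℝ) = Q := by
    rw [hQ]; simp
  have h1 : ∀ σ : {x // x ∈ U} → Fin L, ∑ S ∈ pmSet U H, (∏ f ∈ S, ω f) * Real.exp (- X S σ) ≤ 1 := by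
    intro σ
    refine le_trans (le_of_eq ?_) (bregman_key hne ω hω (keyOf σ) _ U rfl (keyOf_inj σ))
    refine sum_congr rfl fun S hS => ?_
    rw [prod_div_distrib, prod_lead ω hne hS _ (keyOf_inj σ), div_eq_mul_inv]
    congr 1
    rw [Real.exp_neg, hX]
    dsimp only
    rw [Real.exp_sum]
    congr 1
    exact prod_congr rfl fun v hv => Real.exp_log (NN_bounds ω hω hS σ hv).1
  have h2 : ∀ S ∈ pmSet U H, Q * Real.exp (-a) ≤ ∑ σ : {x // x ∈ U} → Fin L, Real.exp (- X S σ) := by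
    intro S hS
    have h3 := sum_X_le hr hr1 hU hS hC ω lam hω hlam d hd hlam0 hd0 hL
    have h4 : ∀ σ : {x // x ∈ U} → Fin L, Real.exp (-a) * (1 + a - X S σ) ≤ Real.exp (- X S σ) := by
      intro σ
      have h5 : Real.exp (- X S σ) = Real.exp (-a) * Real.exp (a - X S σ) := by
        rw [← Real.exp_add]; ring_nf
      rw [h5]
      refine mul_le_mul_of_nonneg_left ?_ (Real.exp_pos _).le
      linarith [Real.add_one_le_exp (a - X S σ)]
    refine le_trans ?_ (sum_le_sum fun σ _ => h4 σ)
    rw [← mul_sum, sum_sub_distrib, sum_const, nsmul_eq_mul, hcard, mul_comm]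
    refine mul_le_mul_of_nonneg_left ?_ (Real.exp_pos _).le
    have : ∑ σ, X S σ ≤ Q * a := h3
    linarith
  have h3 : (∑ S ∈ pmSet U H, ∏ f ∈ S, ω f) * (Q * Real.exp (-a)) ≤ Q := by
    rw [sum_mul]
    calc _ ≤ ∑ S ∈ pmSet U H, (∏ f ∈ S, ω f) * ∑ σ : {x // x ∈ U} → Fin L, Real.exp (- X S σ) :=
          sum_le_sum fun S hS => mul_le_mul_of_nonneg_left (h2 S hS)
            (prod_nonneg fun f hf => (hω f (pm_sub hS hf)).le)
      _ = ∑ σ : {x // x ∈ U} → Fin L, ∑ S ∈ pmSet U H, (∏ f ∈ S, ω f) * Real.exp (- X S σ) := by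
          rw [sum_comm]; exact sum_congr rfl fun S _ => mul_sum _ _ _
      _ ≤ ∑ σ : {x // x ∈ U} → Fin L, (1:ℝ) := sum_le_sum fun σ _ => h1 σ
      _ = Q := by rw [sum_const, nsmul_eq_mul, hcard, mul_one]
  have h4 : (∑ S ∈ pmSet U H, ∏ f ∈ S, ω f) * Real.exp (-a) ≤ 1 := by
    have : Q * ((∑ S ∈ pmSet U H, ∏ f ∈ S, ω f) * Real.exp (-a)) ≤ Q * 1 := by linarith
    exact le_of_mul_le_mul_left this hQ0
  rw [Real.exp_neg, ← div_eq_mul_inv, div_le_one (Real.exp_pos _)] at h4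
  exact h4

end breg

section asymp

theorem riemann_rpow (s : ℝ) (hs : 0 ≤ s) (L : ℕ) (hL : 0 < L) :
    ∑ j ∈ range L, (1 / (L:ℝ)) * (((j:ℝ) + 1) / L) ^ s ≤ 1 / (s + 1) + 1 / L := by
  have hLR : (0:ℝ) < L := by exact_mod_cast hL
  have hm : MonotoneOn (fun x : ℝ => x ^ s) (Set.Icc 0 (0 + (L:ℕ))) := by
    intro x hx y hy hxy
    exact Real.rpow_le_rpow hx.1 hxy hs
  have h1 := hm.sum_le_integral
  rw [integral_rpow (Or.inl (by linarith))] at h1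
  simp only [zero_add] at h1
  have h2 : ∑ j ∈ range L, ((j:ℝ) + 1) ^ s ≤ (L:ℝ) ^ (s+1) / (s+1) + (L:ℝ) ^ s := by
    have h3 : ∑ j ∈ range L, ((j:ℝ) + 1) ^ s ≤ ∑ j ∈ range (L+1), (j:ℝ) ^ s := by
      rw [Finset.sum_range_succ']
      have : (0:ℝ) ≤ ((0:ℕ):ℝ) ^ s := Real.rpow_nonneg (by simp) _
      push_cast at this ⊢
      linarith
    rw [Finset.sum_range_succ] at h3
    have h0 : (0:ℝ) ^ (s+1) = 0 := Real.zero_rpow (by linarith)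
    rw [h0, sub_zero] at h1
    linarith
  have h4 : ∀ j ∈ range L, (1 / (L:ℝ)) * (((j:ℝ) + 1) / L) ^ s = (1 / (L:ℝ)^(s+1)) * ((j:ℝ)+1)^s := by
    intro j _
    rw [Real.div_rpow (by positivity) hLR.le, Real.rpow_add hLR, Real.rpow_one]
    field_simp
  rw [sum_congr rfl h4, ← mul_sum]
  have hp : 0 < (L:ℝ)^(s+1) := Real.rpow_pos_of_pos hLR _
  refine (mul_le_mul_of_nonneg_left h2 (by positivity)).trans (le_of_eq ?_)
  rw [Real.rpow_add hLR, Real.rpow_one]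
  have : 0 < (L:ℝ)^s := Real.rpow_pos_of_pos hLR _
  have : s + 1 ≠ 0 := by positivity
  field_simp

theorem log_bound (a b d t : ℝ) (R : ℕ) (ha : 0 < a) (ha1 : a ≤ 1) (hb : 0 < b) (hd : 0 < d) (ht : 0 ≤ t) :
    Real.log (b + d * t ^ R) ≤ Real.log d + (b/d) ^ a / a - 1 / a + t ^ (R * a) / a := by
  have h1 : b + d * t ^ R = d * (t ^ R + b / d) := by field_simp; ring
  have hx : 0 < t ^ R + b / d := by positivity
  rw [h1, Real.log_mul hd.ne' hx.ne']
  have h2 : a * Real.log (t ^ R + b / d) ≤ (t ^ R + b / d) ^ a - 1 := by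
    rw [← Real.log_rpow hx]
    exact Real.log_le_sub_one_of_pos (Real.rpow_pos_of_pos hx _)
  have h3 := Real.rpow_add_le_add_rpow (pow_nonneg ht R) (div_pos hb hd).le ha.le ha1
  have h4 : (t ^ R) ^ a = t ^ (R * a) := by
    rw [Real.rpow_mul ht, Real.rpow_natCast]
  rw [h4] at h3
  have h5 : Real.log (t ^ R + b / d) ≤ (t ^ (R * a) + (b/d)^a - 1) / a := by
    rw [le_div_iff₀ ha]; linarith
  have : (t ^ (R * a) + (b/d)^a - 1) / a = (b/d) ^ a / a - 1 / a + t ^ (R * a) / a := by ring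
  linarith

theorem FF_asymp (r : ℕ) (hr : 2 ≤ r) (b : ℝ) (hb : 1 ≤ b) (δ : ℝ) (hδ : 0 < δ) :
    ∃ d0 : ℝ, 0 < d0 ∧ ∀ d : ℝ, d0 ≤ d → ∃ L : ℕ, 0 < L ∧ FF r L b d ≤ Real.log d - (r - 1) + δ := by
  obtain ⟨a, ha, ha1, ha2⟩ : ∃ a : ℝ, 0 < a ∧ a ≤ 1 ∧ (r:ℝ)^2 * a ≤ δ / 3 := by
    have hr2 : (0:ℝ) < (r:ℝ)^2 := by positivity
    refine ⟨min 1 (δ / 3 / (r:ℝ)^2), by positivity, min_le_left _ _, ?_⟩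
    calc _ ≤ (r:ℝ)^2 * (δ / 3 / (r:ℝ)^2) := mul_le_mul_of_nonneg_left (min_le_right _ _) hr2.le
      _ = _ := by field_simp
  have hrR : (2:ℝ) ≤ r := by exact_mod_cast hr
  -- d0
  have hlim : Filter.Tendsto (fun d : ℝ => (b/d)^a / a) Filter.atTop (nhds 0) := by
    have h1 : Filter.Tendsto (fun d : ℝ => b / d) Filter.atTop (nhds 0) :=
      Filter.Tendsto.div_atTop tendsto_const_nhds Filter.tendsto_id
    have h2 := (h1.rpow_const (p := a) (Or.inr ha.le)).div_const a
    simpa [Real.zero_rpow ha.ne'] using h2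
  have hev : ∀ᶠ d : ℝ in Filter.atTop, (b/d)^a / a < δ / 3 := hlim.eventually_lt_const (by positivity)
  have hev2 : ∀ᶠ d : ℝ in Filter.atTop, 1 / a ≤ Real.log d := Real.tendsto_log_atTop.eventually_ge_atTop _
  obtain ⟨d0, hd0⟩ := Filter.eventually_atTop.1 (hev.and (hev2.and (Filter.eventually_gt_atTop 0)))
  refine ⟨d0, (hd0 d0 le_rfl).2.2, fun d hd => ?_⟩
  obtain ⟨h1, h2, hdpos⟩ := hd0 d hd
  set c0 : ℝ := Real.log d + (b/d) ^ a / a - 1 / a with hc0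
  have hba : 0 ≤ (b/d)^a / a := by positivity
  have hc0p : 0 ≤ c0 := by rw [hc0]; linarith
  obtain ⟨L, hL⟩ := exists_nat_gt ((r * c0 + r / a) / (δ / 3))
  have hq : 0 ≤ (r * c0 + r / a) / (δ / 3) := by positivity
  have hLR : (0:ℝ) < L := lt_of_le_of_lt hq hL
  have hLpos : 0 < L := by exact_mod_cast hLR
  refine ⟨L, hLpos, ?_⟩
  have h3 : (r * c0 + r / a) / L ≤ δ / 3 := by
    rw [div_le_iff₀ hLR]; rw [div_lt_iff₀ (by positivity)] at hL; linarith
  have hs1 := riemann_rpow (r - 1) (by linarith) L hLpos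
  have hra : 0 ≤ (r:ℝ) * (r-1) * a := mul_nonneg (mul_nonneg (by linarith) (by linarith)) ha.le
  have hs2 := riemann_rpow (r - 1 + r * (r-1) * a) (by linarith) L hLpos
  have hF : FF r L b d ≤ r * ∑ j ∈ range L, (c0 * ((1 / (L:ℝ)) * (((j:ℝ) + 1) / L) ^ ((r:ℝ) - 1)) +
      (1 / a) * ((1 / (L:ℝ)) * (((j:ℝ) + 1) / L) ^ ((r:ℝ) - 1 + r * (r-1) * a))) := by
    unfold FF
    refine mul_le_mul_of_nonneg_left (sum_le_sum fun j _ => ?_) (by positivity)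
    set t : ℝ := ((j:ℝ) + 1) / L with ht
    have htp : 0 < t := by positivity
    have h5 := log_bound a b d t (r * (r-1)) ha ha1 (by linarith) hdpos htp.le
    have h6 : t ^ (r - 1) = t ^ ((r:ℝ) - 1) := by
      rw [← Real.rpow_natCast, Nat.cast_sub (by omega)]; simp
    have h7 : ((r * (r-1) : ℕ) : ℝ) = r * (r - 1) := by
      rw [Nat.cast_mul, Nat.cast_sub (by omega)]; simp
    rw [h7] at h5
    rw [h6, Real.rpow_add htp]
    have h8 : 0 ≤ (1 / (L:ℝ)) * t ^ ((r:ℝ) - 1) := by positivity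
    refine (mul_le_mul_of_nonneg_left h5 h8).trans (le_of_eq ?_)
    rw [hc0]; ring
  rw [sum_add_distrib, ← mul_sum _ _ c0, ← mul_sum _ _ (1/a)] at hF
  have h9 := mul_le_mul_of_nonneg_left hs1 hc0p
  have h10 := mul_le_mul_of_nonneg_left hs2 (by positivity : 0 ≤ 1 / a)
  have h11 := mul_le_mul_of_nonneg_left (add_le_add h9 h10) (by positivity : (0:ℝ) ≤ r)
  refine hF.trans (h11.trans ?_)
  have hr0 : (r:ℝ) ≠ 0 := by positivity
  have e1 : (r:ℝ) * (c0 * (1 / ((r:ℝ) - 1 + 1) + 1 / L) + 1 / a * (1 / ((r:ℝ) - 1 + r * (r-1) * a + 1) + 1 / L))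
     = c0 + (r * c0 + r / a) / L + 1 / a * (1 / (1 + (r-1) * a)) := by
    have hq1 : (0:ℝ) < 1 + (r-1) * a := by
      have : 0 ≤ ((r:ℝ) - 1) * a := mul_nonneg (by linarith) ha.le
      linarith
    have hq2 : (r:ℝ) - 1 + r * (r-1) * a + 1 = r * (1 + (r-1) * a) := by ring
    have hq3 : (r:ℝ) - 1 + 1 = r := by ring
    rw [hq2, hq3]
    field_simp
    ring
  rw [e1]
  have e2 : 1 / a * (1 / (1 + ((r:ℝ)-1) * a)) - 1 / a ≤ - (r - 1) + r^2 * a := by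
    have hq1 : (0:ℝ) < 1 + (r-1) * a := by
      have : 0 ≤ ((r:ℝ) - 1) * a := mul_nonneg (by linarith) ha.le
      linarith
    have : 1 / a * (1 / (1 + ((r:ℝ)-1) * a)) - 1 / a = - (r - 1) / (1 + (r-1) * a) := by
      have hq1' := hq1.ne'
      obtain ⟨y, hy⟩ : ∃ y, y = 1 + ((r:ℝ)-1) * a := ⟨_, rfl⟩
      have hy2 : (r:ℝ) - 1 = (y - 1) / a := by rw [hy]; field_simp; ring
      rw [← hy] at hq1' ⊢
      rw [hy2]
      field_simp
      ring
    rw [this, div_le_iff₀ hq1]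
    nlinarith [mul_nonneg ha.le (by linarith : (0:ℝ) ≤ r - 1), mul_nonneg (mul_nonneg ha.le ha.le) (by linarith : (0:ℝ) ≤ r - 1), sq_nonneg ((r:ℝ) * a), mul_nonneg (mul_nonneg (mul_nonneg ha.le ha.le) (by linarith : (0:ℝ) ≤ r - 1)) (sq_nonneg (r:ℝ))]
  rw [hc0] at *
  linarith

end asymp

section flat
variable {U : Finset ℕ} {H : Finset (Finset ℕ)}

theorem pm_sum_inter (hne : ∅ ∉ H) (Q : Finset (Finset ℕ)) (hQ : ∀ f ∈ Q, f ∈ H ∧ f ⊆ U) :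
    ∑ S ∈ pmSet U H, (S ∩ Q).card = ∑ f ∈ Q, pmCount (U \ f) H := by
  have h1 : ∀ f ∈ Q, pmCount (U \ f) H = ∑ S ∈ pmSet U H, if f ∈ S then 1 else 0 := by
    intro f hf
    rw [← card_containing_one hne (hQ f hf).1 (hQ f hf).2, Finset.card_filter]
  rw [sum_congr rfl h1, sum_comm]
  refine sum_congr rfl fun S _ => ?_
  rw [← card_filter]
  congr 1
  ext f; simp [and_comm]

theorem prod_weight (S Q : Finset (Finset ℕ)) (c : ℝ) :
    ∏ f ∈ S, (if f ∈ Q then Real.exp c else 1) = Real.exp (c * (S ∩ Q).card) := by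
  rw [prod_ite, prod_const_one, mul_one, prod_const, ← Real.exp_nat_mul, mul_comm]
  congr 3

/-- hypotheses on (U,H) -/
structure Nice (U : Finset ℕ) (H : Finset (Finset ℕ)) (r C m : ℕ) (D δ : ℝ) : Prop where
  mpos : 0 < m
  card : U.card = m * r
  unif : ∀ f ∈ H, f.card = r
  codeg : ∀ u ∈ U, ∀ u' ∈ U, u ≠ u' → (H.filter (fun f => f ⊆ U ∧ u ∈ f ∧ u' ∈ f)).card ≤ C
  edges : ((H.filter (fun f => f ⊆ U)).card : ℝ) ≤ (1 + δ) * m * D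
  large : Real.exp (m * (Real.log D - (r - 1) - δ)) ≤ pmCount U H

theorem Nice.mono {r C m : ℕ} {D δ δ' : ℝ} (h : Nice U H r C m D δ) (hd : δ ≤ δ') (hD : 0 ≤ D) :
    Nice U H r C m D δ' := by
  refine ⟨h.mpos, h.card, h.unif, h.codeg, h.edges.trans ?_, le_trans ?_ h.large⟩
  · have : 0 ≤ (m:ℝ) * D := by positivity
    nlinarith
  · refine Real.exp_le_exp.2 (mul_le_mul_of_nonneg_left (by linarith) (by positivity))

theorem flat_light (r : ℕ) (hr : 2 ≤ r) (C : ℕ) (ε3 : ℝ) (h3 : 0 < ε3) (h31 : ε3 ≤ 1) :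
    ∃ D0 : ℝ, 0 < D0 ∧ ∀ (U : Finset ℕ) (H : Finset (Finset ℕ)) (m : ℕ) (D : ℝ), D0 ≤ D →
      Nice U H r C m D (ε3/32) →
      ((H.filter (fun f => f ⊆ U ∧ (pmCount (U \ f) H : ℝ) * D < ε3 / 32 * pmCount U H)).card : ℝ) ≤
        ε3 * m * D := by
  obtain ⟨d0, hd0, hF⟩ := FF_asymp r hr (1 + 1 * (r ^ 2 * C)) (by
    have : (0:ℝ) ≤ 1 * (r^2 * C) := by positivity
    linarith) (ε3 / 16) (by positivity)
  refine ⟨2 * d0, by positivity, fun U H m D hD hN => ?_⟩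
  have hne : ∅ ∉ H := fun h => by have := hN.unif _ h; simp at this; omega
  have hDp : 0 < D := by linarith
  have hm : (0:ℝ) < m := by exact_mod_cast hN.mpos
  set Q := H.filter (fun f => f ⊆ U ∧ (pmCount (U \ f) H : ℝ) * D < ε3 / 32 * pmCount U H) with hQ
  by_contra hcon
  push Not at hcon
  have hQH : ∀ f ∈ Q, f ∈ H ∧ f ⊆ U := fun f hf => by
    have := mem_filter.1 hf; exact ⟨this.1, this.2.1⟩
  set d := D * (1 + ε3 / 32 - ε3 / 2 * (2/3)) with hd
  have hdd : d0 ≤ d := by rw [hd]; nlinarith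
  have hdp : 0 < d := by linarith
  obtain ⟨L, hL, hFL⟩ := hF d hdd
  have hQsub : Q ⊆ H.filter (fun f => f ⊆ U) := fun f hf => mem_filter.2 (hQH f hf)
  have hexp : Real.exp (-(1/2:ℝ)) ≤ 2/3 := by
    rw [Real.exp_neg, inv_le_comm₀ (Real.exp_pos _) (by norm_num)]
    have := Real.add_one_le_exp (1/2:ℝ)
    linarith
  have hsum : ∑ f ∈ H.filter (fun f => f ⊆ U), (if f ∈ Q then Real.exp (-(1/2:ℝ)) else 1) ≤ m * d := by
    have h5 : ∀ f ∈ H.filter (fun f => f ⊆ U), (if f ∈ Q then Real.exp (-(1/2:ℝ)) else 1) ≤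
        1 - (1/3) * (if f ∈ Q then 1 else 0) := by
      intro f _
      split_ifs
      · linarith
      · norm_num
    refine (sum_le_sum h5).trans ?_
    rw [sum_sub_distrib, ← mul_sum, sum_const, sum_boole]
    have : (H.filter (fun f => f ⊆ U)).filter (fun f => f ∈ Q) = Q := by
      ext f; rw [mem_filter]; exact ⟨fun h => h.2, fun h => ⟨hQsub h, h⟩⟩
    rw [this, nsmul_eq_mul, mul_one, hd]
    have := hN.edges
    nlinarith
  have hB := weighted_bregman (U := U) (H := H) (m := m) (C := C) hN.unif (by omega) hN.card hN.codeg
    (fun f => if f ∈ Q then Real.exp (-(1/2:ℝ)) else 1) 1 (fun f _ => by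
      split_ifs
      · exact Real.exp_pos _
      · exact one_pos) (fun f _ => by
      split_ifs
      · linarith
      · exact le_rfl) d hsum zero_le_one hdp.le hL
  have hpos : (0:ℝ) < pmCount U H := lt_of_lt_of_le (Real.exp_pos _) hN.large
  set a : ℝ := (1/2) * (1 + ε3 / 32) * m * (ε3 / 32) with ha
  have h_inter : (∑ S ∈ pmSet U H, ((S ∩ Q).card : ℝ)) ≤ (1 + ε3 / 32) * m * (ε3 / 32) * pmCount U H := by
    have h6 := pm_sum_inter hne Q hQH
    have h7 : (∑ S ∈ pmSet U H, ((S ∩ Q).card : ℝ)) = ∑ f ∈ Q, (pmCount (U \ f) H : ℝ) := by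
      exact_mod_cast h6
    rw [h7]
    have h8 : ∀ f ∈ Q, (pmCount (U \ f) H : ℝ) ≤ ε3 / 32 * pmCount U H / D := by
      intro f hf
      rw [le_div_iff₀ hDp]; exact (mem_filter.1 hf).2.2.le
    refine (sum_le_card_nsmul _ _ _ h8).trans ?_
    rw [nsmul_eq_mul]
    have h9 : (Q.card : ℝ) ≤ (1 + ε3/32) * m * D := le_trans (by exact_mod_cast card_le_card hQsub) hN.edges
    refine (mul_le_mul_of_nonneg_right h9 (by positivity)).trans (le_of_eq ?_)
    field_simp
  have hlow : (pmCount U H : ℝ) * Real.exp (-a) ≤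
      ∑ S ∈ pmSet U H, ∏ f ∈ S, (if f ∈ Q then Real.exp (-(1/2:ℝ)) else 1) := by
    have h10 : ∀ S ∈ pmSet U H, Real.exp (-a) * (1 + a - 1/2 * (S ∩ Q).card) ≤
        ∏ f ∈ S, (if f ∈ Q then Real.exp (-(1/2:ℝ)) else 1) := by
      intro S _
      rw [prod_weight]
      have : Real.exp (-(1/2) * ((S ∩ Q).card:ℝ)) = Real.exp (-a) * Real.exp (a - 1/2 * (S ∩ Q).card) := by
        rw [← Real.exp_add]; ring_nf
      rw [this]
      refine mul_le_mul_of_nonneg_left ?_ (Real.exp_pos _).le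
      linarith [Real.add_one_le_exp (a - 1/2 * ((S ∩ Q).card:ℝ))]
    refine le_trans ?_ (sum_le_sum h10)
    rw [← mul_sum, sum_sub_distrib, sum_const, ← mul_sum, nsmul_eq_mul, mul_comm]
    refine mul_le_mul_of_nonneg_left ?_ (Real.exp_pos _).le
    change (pmCount U H : ℝ) ≤ (pmCount U H : ℝ) * (1 + a) - _
    have : (1/2) * (∑ S ∈ pmSet U H, ((S ∩ Q).card : ℝ)) ≤ a * pmCount U H := by
      rw [ha]; linarith
    linarith
  have h11 : Real.exp (m * (Real.log D - (r - 1) - ε3/32)) * Real.exp (-a) ≤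
      Real.exp (m * (Real.log d - (r - 1) + ε3/16)) := by
    refine (mul_le_mul_of_nonneg_right hN.large (Real.exp_pos _).le).trans (hlow.trans (hB.trans ?_))
    exact Real.exp_le_exp.2 (mul_le_mul_of_nonneg_left hFL hm.le)
  rw [← Real.exp_add, Real.exp_le_exp] at h11
  have hq : 0 < 1 + ε3 / 32 - ε3 / 2 * (2/3) := by nlinarith
  have hlogd : Real.log d ≤ Real.log D + (ε3 / 32 - ε3 / 2 * (2/3)) := by
    rw [hd, Real.log_mul hDp.ne' hq.ne']
    linarith [Real.log_le_sub_one_of_pos hq]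
  have h12 : (m:ℝ) * (Real.log D - (r - 1) - ε3/32 - (1/2) * (1 + ε3 / 32) * (ε3 / 32)) ≤
      m * (Real.log D + (ε3 / 32 - ε3 / 2 * (2/3)) - (r - 1) + ε3/16) := by
    refine le_trans (le_of_eq ?_) (h11.trans (mul_le_mul_of_nonneg_left (by linarith) hm.le))
    rw [ha]; ring
  have h13 := le_of_mul_le_mul_left h12 hm
  nlinarith

theorem flat_heavy (r : ℕ) (hr : 2 ≤ r) (C : ℕ) (ε3 : ℝ) (h3 : 0 < ε3) (h31 : ε3 ≤ 1) :
    ∃ D0 : ℝ, 0 < D0 ∧ ∀ (U : Finset ℕ) (H : Finset (Finset ℕ)) (m : ℕ) (D : ℝ), D0 ≤ D →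
      Nice U H r C m D (ε3/32) → ∀ P : Finset (Finset ℕ), P.card ≤ 2 * m →
      (∑ S ∈ pmSet U H, ((S.filter (fun f => 16 / ε3 * pmCount U H < (pmCount (U \ f) H : ℝ) * D ∨
        f ∈ P)).card : ℝ)) ≤ ε3 * m * pmCount U H := by
  obtain ⟨d0, hd0, hF⟩ := FF_asymp r hr (1 + Real.exp 1 * (r ^ 2 * C)) (by
    have : (0:ℝ) ≤ Real.exp 1 * (r^2 * C) := by positivity
    linarith) (ε3 / 8) (by positivity)
  refine ⟨max d0 (32 / ε3), by positivity, fun U H m D hD hN P hP => ?_⟩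
  have hne : ∅ ∉ H := fun h => by have := hN.unif _ h; simp at this; omega
  have hD1 : d0 ≤ D := (le_max_left _ _).trans hD
  have hD2 : 32 / ε3 ≤ D := (le_max_right _ _).trans hD
  have hDp : 0 < D := by linarith
  have hm : (0:ℝ) < m := by exact_mod_cast hN.mpos
  have hpos : (0:ℝ) < pmCount U H := lt_of_lt_of_le (Real.exp_pos _) hN.large
  set Q0 := H.filter (fun f => f ⊆ U ∧ 16 / ε3 * pmCount U H < (pmCount (U \ f) H : ℝ) * D) with hQ0
  set Q := H.filter (fun f => f ⊆ U ∧ (16 / ε3 * pmCount U H < (pmCount (U \ f) H : ℝ) * D ∨ f ∈ P)) with hQ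
  have hQH : ∀ f ∈ Q, f ∈ H ∧ f ⊆ U := fun f hf => by
    have := mem_filter.1 hf; exact ⟨this.1, this.2.1⟩
  have hQsub : Q ⊆ H.filter (fun f => f ⊆ U) := fun f hf => mem_filter.2 (hQH f hf)
  have hQ0c : (Q0.card : ℝ) ≤ ε3 / 16 * m * D := by
    have h1 := pmCount_edge_sum hne hN.unif (by omega) hN.card
    have h2 : ∑ f ∈ H.filter (fun f => f ⊆ U), (pmCount (U \ f) H : ℝ) = m * pmCount U H := by exact_mod_cast h1
    have h3' : (Q0.card : ℝ) * (16 / ε3 * pmCount U H / D) ≤ m * pmCount U H := by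
      rw [← h2, ← nsmul_eq_mul]
      refine (card_nsmul_le_sum Q0 (fun f => (pmCount (U \ f) H : ℝ)) _ fun f hf => ?_).trans
        (Finset.sum_le_sum_of_subset_of_nonneg ?_ (fun _ _ _ => by positivity))
      · rw [div_le_iff₀ hDp]; exact (mem_filter.1 hf).2.2.le
      · intro f hf
        have := mem_filter.1 hf
        exact mem_filter.2 ⟨this.1, this.2.1⟩
    have h4 : (Q0.card : ℝ) * (16 / ε3 * pmCount U H / D) = (Q0.card * (16 / ε3) / D) * pmCount U H := by ring
    rw [h4] at h3'
    have h5 := le_of_mul_le_mul_right h3' hpos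
    rw [div_le_iff₀ hDp] at h5
    have : (Q0.card : ℝ) = ε3 / 16 * (Q0.card * (16 / ε3)) := by field_simp
    rw [this]
    nlinarith
  have hQc : (Q.card : ℝ) ≤ ε3 / 8 * m * D := by
    have hsub : Q ⊆ Q0 ∪ P := by
      intro f hf
      have := mem_filter.1 hf
      rcases this.2.2 with h | h
      · exact mem_union_left _ (mem_filter.2 ⟨this.1, this.2.1, h⟩)
      · exact mem_union_right _ h
    have h1 : (Q.card : ℝ) ≤ Q0.card + P.card := by exact_mod_cast (card_le_card hsub).trans (card_union_le _ _)
    have h2 : (P.card : ℝ) ≤ 2 * m := by exact_mod_cast hP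
    have h4 : 32 ≤ D * ε3 := by rwa [div_le_iff₀ h3] at hD2
    nlinarith
  have hfil : ∀ S ∈ pmSet U H, S.filter (fun f => 16 / ε3 * pmCount U H < (pmCount (U \ f) H : ℝ) * D ∨
        f ∈ P) = S ∩ Q := by
    intro S hS
    ext f
    simp only [mem_filter, mem_inter, hQ]
    exact ⟨fun h => ⟨h.1, pm_sub hS h.1, pm_edge_sub hS h.1, h.2⟩, fun h => ⟨h.1, h.2.2.2⟩⟩
  rw [sum_congr rfl (fun S hS => by rw [hfil S hS])]
  by_contra hcon
  push Not at hcon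
  set d := D * (1 + ε3 / 32 + ε3 / 4) with hd
  have hdd : d0 ≤ d := by rw [hd]; nlinarith
  have hdp : 0 < d := by linarith
  obtain ⟨L, hL, hFL⟩ := hF d hdd
  have hexp : Real.exp 1 ≤ 3 := by linarith [Real.exp_one_lt_d9]
  have hexp1 : 1 ≤ Real.exp 1 := Real.one_le_exp zero_le_one
  have hsum : ∑ f ∈ H.filter (fun f => f ⊆ U), (if f ∈ Q then Real.exp 1 else 1) ≤ m * d := by
    have h5 : ∀ f ∈ H.filter (fun f => f ⊆ U), (if f ∈ Q then Real.exp 1 else 1) ≤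
        1 + 2 * (if f ∈ Q then 1 else 0) := by
      intro f _
      split_ifs
      · linarith
      · norm_num
    refine (sum_le_sum h5).trans ?_
    rw [sum_add_distrib, ← mul_sum, sum_const, sum_boole]
    have : (H.filter (fun f => f ⊆ U)).filter (fun f => f ∈ Q) = Q := by
      ext f; rw [mem_filter]; exact ⟨fun h => h.2, fun h => ⟨hQsub h, h⟩⟩
    rw [this, nsmul_eq_mul, mul_one, hd]
    have := hN.edges
    nlinarith
  have hB := weighted_bregman (U := U) (H := H) (m := m) (C := C) hN.unif (by omega) hN.card hN.codeg
    (fun f => if f ∈ Q then Real.exp 1 else 1) (Real.exp 1) (fun f _ => by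
      split_ifs
      · exact Real.exp_pos _
      · exact one_pos) (fun f _ => by
      split_ifs
      · exact le_rfl
      · exact hexp1) d hsum (Real.exp_pos _).le hdp.le hL
  set a : ℝ := ε3 * m with ha
  have hlow : (pmCount U H : ℝ) * Real.exp a ≤
      ∑ S ∈ pmSet U H, ∏ f ∈ S, (if f ∈ Q then Real.exp 1 else 1) := by
    have h10 : ∀ S ∈ pmSet U H, Real.exp a * (1 - a + (S ∩ Q).card) ≤
        ∏ f ∈ S, (if f ∈ Q then Real.exp 1 else 1) := by
      intro S _
      rw [prod_weight]
      have : Real.exp (1 * ((S ∩ Q).card:ℝ)) = Real.exp a * Real.exp ((S ∩ Q).card - a) := by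
        rw [← Real.exp_add]; ring_nf
      rw [this]
      refine mul_le_mul_of_nonneg_left ?_ (Real.exp_pos _).le
      linarith [Real.add_one_le_exp (((S ∩ Q).card:ℝ) - a)]
    refine le_trans ?_ (sum_le_sum h10)
    rw [← mul_sum, sum_add_distrib, sum_const, nsmul_eq_mul, mul_comm]
    refine mul_le_mul_of_nonneg_left ?_ (Real.exp_pos _).le
    change (pmCount U H : ℝ) ≤ (pmCount U H : ℝ) * (1 - a) + _
    linarith
  have h11 : Real.exp (m * (Real.log D - (r - 1) - ε3/32)) * Real.exp a ≤
      Real.exp (m * (Real.log d - (r - 1) + ε3/8)) := by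
    refine (mul_le_mul_of_nonneg_right hN.large (Real.exp_pos _).le).trans (hlow.trans (hB.trans ?_))
    exact Real.exp_le_exp.2 (mul_le_mul_of_nonneg_left hFL hm.le)
  rw [← Real.exp_add, Real.exp_le_exp] at h11
  have hq : 0 < 1 + ε3 / 32 + ε3 / 4 := by positivity
  have hlogd : Real.log d ≤ Real.log D + (ε3 / 32 + ε3 / 4) := by
    rw [hd, Real.log_mul hDp.ne' hq.ne']
    linarith [Real.log_le_sub_one_of_pos hq]
  have h12 : (m:ℝ) * (Real.log D - (r - 1) - ε3/32 + ε3) ≤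
      m * (Real.log D + (ε3 / 32 + ε3 / 4) - (r - 1) + ε3/8) := by
    refine le_trans (le_of_eq ?_) (h11.trans (mul_le_mul_of_nonneg_left (by linarith) hm.le))
    rw [ha]; ring
  have h13 := le_of_mul_le_mul_left h12 hm
  linarith

end flat

section badv

noncomputable def degU (U : Finset ℕ) (H : Finset (Finset ℕ)) (y : ℕ) : ℕ :=
  (H.filter (fun f => f ⊆ U ∧ y ∈ f)).card

noncomputable def lightdeg (U : Finset ℕ) (H : Finset (Finset ℕ)) (D ε3 : ℝ) (y : ℕ) : ℕ :=
  (H.filter (fun f => (f ⊆ U ∧ (pmCount (U \ f) H : ℝ) * D < ε3 / 32 * pmCount U H) ∧ y ∈ f)).card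

def badV (U : Finset ℕ) (H P : Finset (Finset ℕ)) (D ε3 κ : ℝ) (f : Finset ℕ) (y : ℕ) : Prop :=
  (16 / ε3 * pmCount U H < (pmCount (U \ f) H : ℝ) * D ∨ f ∈ P) ∨
  κ * D < lightdeg U H D ε3 y ∨ D / ε3 < degU U H y

theorem sum_deg {r : ℕ} {H : Finset (Finset ℕ)} {U : Finset ℕ} (hr : ∀ f ∈ H, f.card = r)
    (p : Finset ℕ → Prop) [DecidablePred p] (hp : ∀ f, p f → f ⊆ U) :
    ∑ y ∈ U, (H.filter (fun f => p f ∧ y ∈ f)).card = r * (H.filter p).card := by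
  have h1 : ∀ y ∈ U, (H.filter (fun f => p f ∧ y ∈ f)).card = ∑ f ∈ H.filter p, if y ∈ f then 1 else 0 := by
    intro y _
    rw [← filter_filter, card_filter]
  rw [sum_congr rfl h1, sum_comm]
  have h2 : ∀ f ∈ H.filter p, (∑ y ∈ U, if y ∈ f then 1 else 0) = r := by
    intro f hf
    rw [mem_filter] at hf
    rw [← card_filter, filter_mem_eq_inter, inter_eq_right.2 (hp f hf.2), hr f hf.1]
  rw [sum_congr rfl h2, sum_const, smul_eq_mul, mul_comm]

open scoped Classical in
theorem bad_count (r : ℕ) (hr : 2 ≤ r) (C : ℕ) (ε3 : ℝ) (h3 : 0 < ε3) (h31 : ε3 ≤ 1)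
    (κ : ℝ) (hκ : 0 < κ) (hκ1 : κ ≤ 1) :
    ∃ D0 : ℝ, 0 < D0 ∧ ∀ (U : Finset ℕ) (H : Finset (Finset ℕ)) (m : ℕ) (D : ℝ), D0 ≤ D →
      Nice U H r C m D (ε3/32) → ∀ P : Finset (Finset ℕ), P.card ≤ 2 * m →
      (∑ S ∈ pmSet U H, ((U.filter (fun y => badV U H P D ε3 κ (edgeAt S y) y)).card : ℝ)) ≤
        4 * ε3 / κ * U.card * pmCount U H := by
  obtain ⟨D1, hD1, hl⟩ := flat_light r hr C ε3 h3 h31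
  obtain ⟨D2, hD2, hh⟩ := flat_heavy r hr C ε3 h3 h31
  refine ⟨max D1 D2, by positivity, fun U H m D hD hN P hP => ?_⟩
  have hl := hl U H m D ((le_max_left _ _).trans hD) hN
  have hh := hh U H m D ((le_max_right _ _).trans hD) hN P hP
  have hDp : 0 < D := lt_of_lt_of_le (lt_of_lt_of_le hD1 (le_max_left _ _)) hD
  set A := U.filter (fun y => κ * D < lightdeg U H D ε3 y) with hA
  set B := U.filter (fun y => D / ε3 < degU U H y) with hB
  have hAc : (A.card : ℝ) ≤ r * (ε3 * m) / κ := by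
    have h1 := sum_deg (U := U) hN.unif (fun f => f ⊆ U ∧ (pmCount (U \ f) H : ℝ) * D < ε3 / 32 * pmCount U H) (fun f h => h.1)
    have h2 : ∑ y ∈ U, (lightdeg U H D ε3 y : ℝ) ≤ r * (ε3 * m * D) := by
      have : ∑ y ∈ U, (lightdeg U H D ε3 y : ℝ) = r * ((H.filter (fun f => f ⊆ U ∧ (pmCount (U \ f) H : ℝ) * D < ε3 / 32 * pmCount U H)).card : ℝ) := by
        exact_mod_cast h1
      rw [this]; exact mul_le_mul_of_nonneg_left hl (by positivity)
    have h4 : (A.card : ℝ) * (κ * D) ≤ r * (ε3 * m * D) := by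
      rw [← nsmul_eq_mul]
      refine (card_nsmul_le_sum A (fun y => (lightdeg U H D ε3 y : ℝ)) _ fun y hy => (mem_filter.1 hy).2.le).trans
        ((Finset.sum_le_sum_of_subset_of_nonneg (filter_subset _ _) (fun _ _ _ => by positivity)).trans h2)
    rw [le_div_iff₀ hκ]
    have : (A.card : ℝ) * κ * D ≤ r * (ε3 * m) * D := by linarith
    exact le_of_mul_le_mul_right this hDp
  have hBc : (B.card : ℝ) ≤ 2 * r * (ε3 * m) := by
    have h1 := sum_deg (U := U) hN.unif (fun f => f ⊆ U) (fun f h => h)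
    have h2 : ∑ y ∈ U, (degU U H y : ℝ) ≤ r * ((1 + ε3/32) * m * D) := by
      have : ∑ y ∈ U, (degU U H y : ℝ) = r * ((H.filter (fun f => f ⊆ U)).card : ℝ) := by
        exact_mod_cast h1
      rw [this]; exact mul_le_mul_of_nonneg_left hN.edges (by positivity)
    have h4 : (B.card : ℝ) * (D / ε3) ≤ r * ((1 + ε3/32) * m * D) := by
      rw [← nsmul_eq_mul]
      refine (card_nsmul_le_sum B (fun y => (degU U H y : ℝ)) _ fun y hy => (mem_filter.1 hy).2.le).trans
        ((Finset.sum_le_sum_of_subset_of_nonneg (filter_subset _ _) (fun _ _ _ => by positivity)).trans h2)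
    have : (B.card : ℝ) * (D / ε3) = (B.card / ε3) * D := by ring
    rw [this] at h4
    have h5 : (B.card : ℝ) / ε3 ≤ r * ((1 + ε3/32) * m) := le_of_mul_le_mul_right (by linarith) hDp
    rw [div_le_iff₀ h3] at h5
    have h6 : (r:ℝ) * ((1 + ε3/32) * m) * ε3 ≤ 2 * r * (ε3 * m) := by
      have : 0 ≤ (r:ℝ) * m * ε3 := by positivity
      nlinarith
    linarith
  have hS : ∀ S ∈ pmSet U H, ((U.filter (fun y => badV U H P D ε3 κ (edgeAt S y) y)).card : ℝ) ≤
      r * ((S.filter (fun f => 16 / ε3 * pmCount U H < (pmCount (U \ f) H : ℝ) * D ∨ f ∈ P)).card : ℝ) + (A.card + B.card) := by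
    intro S hS
    set Q := S.filter (fun f => 16 / ε3 * pmCount U H < (pmCount (U \ f) H : ℝ) * D ∨ f ∈ P) with hQ
    have hsub : U.filter (fun y => badV U H P D ε3 κ (edgeAt S y) y) ⊆ Q.biUnion id ∪ (A ∪ B) := by
      intro y hy
      rw [mem_filter] at hy
      have he := edgeAt_mem hS hy.1
      rcases hy.2 with h | h | h
      · exact mem_union_left _ (mem_biUnion.2 ⟨_, mem_filter.2 ⟨he.1, h⟩, he.2⟩)
      · exact mem_union_right _ (mem_union_left _ (mem_filter.2 ⟨hy.1, h⟩))
      · exact mem_union_right _ (mem_union_right _ (mem_filter.2 ⟨hy.1, h⟩))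
    have h1 := (card_le_card hsub).trans ((card_union_le _ _).trans (add_le_add_right (card_union_le A B) _))
    have h2 : (Q.biUnion id).card ≤ Q.card * r := card_biUnion_le_card_mul _ _ _ fun f hf =>
      (hN.unif f (pm_sub hS (mem_filter.1 hf).1)).le
    have h3 := h1.trans (add_le_add_left h2 _)
    have : ((U.filter (fun y => badV U H P D ε3 κ (edgeAt S y) y)).card : ℝ) ≤ Q.card * r + (A.card + B.card) := by
      exact_mod_cast h3
    linarith
  refine (sum_le_sum hS).trans ?_
  rw [sum_add_distrib, ← mul_sum, sum_const, nsmul_eq_mul]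
  have h5 := mul_le_mul_of_nonneg_left hh (by positivity : (0:ℝ) ≤ r)
  have hcardU : (U.card : ℝ) = m * r := by exact_mod_cast hN.card
  have h6 : ((A.card:ℝ) + B.card) ≤ 3 * r * (ε3 * m) / κ := by
    have : 2 * r * (ε3 * m) ≤ 2 * r * (ε3 * m) / κ := by
      rw [le_div_iff₀ hκ]
      have : 0 ≤ 2 * (r:ℝ) * (ε3 * m) := by positivity
      nlinarith
    have e : 3 * r * (ε3 * m) / κ = r * (ε3 * m) / κ + 2 * r * (ε3 * m) / κ := by ring
    linarith
  have h7 := mul_le_mul_of_nonneg_left h6 (by positivity : (0:ℝ) ≤ pmCount U H)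
  have h8 : (r:ℝ) * (ε3 * m * pmCount U H) ≤ r * (ε3 * m * pmCount U H) / κ := by
    rw [le_div_iff₀ hκ]
    have : 0 ≤ (r:ℝ) * (ε3 * m * pmCount U H) := by positivity
    nlinarith
  change _ + (pmCount U H : ℝ) * _ ≤ _
  rw [hcardU]
  have e : 4 * ε3 / κ * (m * r) * pmCount U H = r * (ε3 * m * pmCount U H) / κ + pmCount U H * (3 * r * (ε3 * m) / κ) := by
    field_simp; ring
  linarith

end badv

section prob
variable {α : Type*} [DecidableEq α]

noncomputable def Ex (E : Finset α) (p : ℝ) (f : Finset α → ℝ) : ℝ :=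
  ∑ W ∈ E.powerset, p ^ W.card * (1 - p) ^ (E \ W).card * f W

open scoped Classical in
noncomputable def Pr (E : Finset α) (p : ℝ) (A : Finset α → Prop) : ℝ :=
  Ex E p (fun W => if A W then 1 else 0)

theorem Ex_mono {E : Finset α} {p : ℝ} (hp : 0 ≤ p) (hp1 : p ≤ 1) {f g : Finset α → ℝ}
    (h : ∀ W, W ⊆ E → f W ≤ g W) : Ex E p f ≤ Ex E p g := by
  refine sum_le_sum fun W hW => mul_le_mul_of_nonneg_left (h W (mem_powerset.1 hW)) ?_
  have : 0 ≤ 1 - p := by linarith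
  positivity

theorem Ex_congr {E : Finset α} {p : ℝ} {f g : Finset α → ℝ}
    (h : ∀ W, W ⊆ E → f W = g W) : Ex E p f = Ex E p g :=
  sum_congr rfl fun W hW => by rw [h W (mem_powerset.1 hW)]

theorem Ex_mul (E : Finset α) (p c : ℝ) (f : Finset α → ℝ) :
    Ex E p (fun W => c * f W) = c * Ex E p f := by
  unfold Ex; rw [mul_sum]; exact sum_congr rfl fun W _ => by ring

theorem Ex_sum {ι : Type*} (I : Finset ι) (E : Finset α) (p : ℝ) (f : ι → Finset α → ℝ) :
    Ex E p (fun W => ∑ i ∈ I, f i W) = ∑ i ∈ I, Ex E p (f i) := by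
  unfold Ex; rw [sum_comm]; exact sum_congr rfl fun W _ => by rw [mul_sum]

theorem Ex_add (E : Finset α) (p : ℝ) (f g : Finset α → ℝ) :
    Ex E p (fun W => f W + g W) = Ex E p f + Ex E p g := by
  unfold Ex; rw [← sum_add_distrib]; exact sum_congr rfl fun W _ => by ring

theorem Ex_prod (E : Finset α) (p : ℝ) (a b : α → ℝ) :
    Ex E p (fun W => ∏ e ∈ E, if e ∈ W then a e else b e) = ∏ e ∈ E, (p * a e + (1 - p) * b e) := by
  rw [Finset.prod_add]
  refine sum_congr rfl fun W hW => ?_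
  rw [mem_powerset] at hW
  beta_reduce
  rw [prod_mul_distrib, prod_mul_distrib, prod_const, prod_const, ← prod_sdiff hW]
  have h1 : ∏ e ∈ E \ W, (if e ∈ W then a e else b e) = ∏ e ∈ E \ W, b e :=
    prod_congr rfl fun e he => by rw [if_neg (mem_sdiff.1 he).2]
  have h2 : ∏ e ∈ W, (if e ∈ W then a e else b e) = ∏ e ∈ W, a e :=
    prod_congr rfl fun e he => by rw [if_pos he]
  rw [h1, h2]; ring

theorem Ex_const (E : Finset α) (p c : ℝ) : Ex E p (fun _ => c) = c := by
  have := Ex_prod E p (fun _ => 1) (fun _ => 1)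
  simp at this
  have h2 := Ex_mul E p c (fun _ => 1)
  rw [this] at h2
  simpa using h2

theorem Pr_nonneg {E : Finset α} {p : ℝ} (hp : 0 ≤ p) (hp1 : p ≤ 1) (A : Finset α → Prop) :
    0 ≤ Pr E p A := by
  classical
  have := Ex_mono (E := E) hp hp1 (f := fun _ => 0) (g := fun W => if A W then 1 else 0) (fun W _ => by positivity)
  rw [Ex_const] at this
  unfold Pr
  convert this

theorem Pr_le_Ex {E : Finset α} {p : ℝ} (hp : 0 ≤ p) (hp1 : p ≤ 1) {A : Finset α → Prop}
    {f : Finset α → ℝ} (hf : ∀ W, W ⊆ E → 0 ≤ f W) (h : ∀ W, W ⊆ E → A W → 1 ≤ f W) :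
    Pr E p A ≤ Ex E p f := by
  refine Ex_mono hp hp1 fun W hW => ?_
  split_ifs with h1
  · exact h W hW h1
  · exact hf W hW

theorem Pr_mono {E : Finset α} {p : ℝ} (hp : 0 ≤ p) (hp1 : p ≤ 1) {A B : Finset α → Prop}
    (h : ∀ W, W ⊆ E → A W → B W) : Pr E p A ≤ Pr E p B := by
  refine Pr_le_Ex hp hp1 (fun W _ => by positivity) fun W hW hA => ?_
  rw [if_pos (h W hW hA)]

theorem Pr_or {E : Finset α} {p : ℝ} (hp : 0 ≤ p) (hp1 : p ≤ 1) (A B : Finset α → Prop) :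
    Pr E p (fun W => A W ∨ B W) ≤ Pr E p A + Pr E p B := by
  unfold Pr
  rw [← Ex_add]
  refine Ex_mono hp hp1 fun W _ => ?_
  by_cases h1 : A W <;> by_cases h2 : B W <;> simp [h1, h2]

theorem Pr_exists {ι : Type*} (I : Finset ι) {E : Finset α} {p : ℝ} (hp : 0 ≤ p) (hp1 : p ≤ 1)
    (A : ι → Finset α → Prop) :
    Pr E p (fun W => ∃ i ∈ I, A i W) ≤ ∑ i ∈ I, Pr E p (A i) := by
  classical
  unfold Pr
  rw [← Ex_sum]
  refine Pr_le_Ex hp hp1 (fun W _ => sum_nonneg fun i _ => by positivity) fun W _ h => ?_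
  obtain ⟨i, hi, h⟩ := h
  refine le_trans ?_ (single_le_sum (f := fun i => if A i W then (1:ℝ) else 0) (fun _ _ => by positivity) hi)
  simp [h]

/-- Markov for a count of events. -/
theorem Pr_markov {ι : Type*} (I : Finset ι) {E : Finset α} {p : ℝ} (hp : 0 ≤ p) (hp1 : p ≤ 1)
    (A : ι → Finset α → Prop) (q : ℝ) (hA : ∀ i ∈ I, Pr E p (A i) ≤ q) (N : ℝ) (hN : 0 < N)
    (B : Finset α → Prop)
    (hB : ∀ W, W ⊆ E → B W → ∃ J : Finset ι, J ⊆ I ∧ N ≤ J.card ∧ ∀ i ∈ J, A i W) :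
    Pr E p B ≤ I.card * q / N := by
  classical
  have h1 : Pr E p B ≤ Ex E p (fun W => (1/N) * ∑ i ∈ I, if A i W then 1 else 0) := by
    refine Pr_le_Ex hp hp1 (fun W _ => mul_nonneg (by positivity) (sum_nonneg fun i _ => by positivity)) fun W hW h => ?_
    obtain ⟨J, hJ, hJN, hJA⟩ := hB W hW h
    have : (J.card : ℝ) ≤ ∑ i ∈ I, if A i W then (1:ℝ) else 0 := by
      rw [sum_boole]
      exact_mod_cast card_le_card fun i hi => mem_filter.2 ⟨hJ hi, hJA i hi⟩
    rw [one_div, ← div_eq_inv_mul, le_div_iff₀ hN]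
    linarith
  refine h1.trans ?_
  rw [Ex_mul, Ex_sum]
  have h2 : ∑ i ∈ I, Ex E p (fun W => if A i W then (1:ℝ) else 0) ≤ I.card * q := by
    rw [← nsmul_eq_mul]
    refine sum_le_card_nsmul _ _ _ fun i hi => ?_
    have := hA i hi
    unfold Pr at this
    convert this
  rw [one_div, ← div_eq_inv_mul]
  exact div_le_div_of_nonneg_right h2 hN.le

theorem Ex_split {E0 E1 : Finset α} (hd : Disjoint E0 E1) (p : ℝ) (f : Finset α → ℝ) :
    Ex (E0 ∪ E1) p f = Ex E0 p (fun W0 => Ex E1 p (fun W1 => f (W0 ∪ W1))) := by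
  unfold Ex
  simp_rw [mul_sum]
  rw [← sum_product', eq_comm]
  refine Finset.sum_bij' (fun q _ => q.1 ∪ q.2) (fun W _ => (W ∩ E0, W ∩ E1)) ?_ ?_ ?_ ?_ ?_
  · rintro ⟨a, b⟩ h
    simp only [mem_product, mem_powerset] at h ⊢
    exact union_subset_union h.1 h.2
  · intro W _
    simp
  · rintro ⟨a, b⟩ h
    simp only [mem_product, mem_powerset] at h
    have h1 : b ∩ E0 = ∅ := (disjoint_iff_inter_eq_empty.1 (hd.mono_right h.2).symm)
    have h2 : a ∩ E1 = ∅ := (disjoint_iff_inter_eq_empty.1 (hd.mono_left h.1))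
    simp only [union_inter_distrib_right, inter_eq_left.2 h.1, inter_eq_left.2 h.2, h1, h2, union_empty, empty_union]
  · intro W h
    rw [mem_powerset] at h
    rw [← inter_union_distrib_left, inter_eq_left.2 h]
  · rintro ⟨a, b⟩ h
    simp only [mem_product, mem_powerset] at h
    dsimp only
    have hab : Disjoint a b := hd.mono h.1 h.2
    have h3 : (E0 ∪ E1) \ (a ∪ b) = (E0 \ a) ∪ (E1 \ b) := by
      ext x
      simp only [mem_sdiff, mem_union]
      constructor
      · rintro ⟨h1 | h1, h2⟩
        · exact Or.inl ⟨h1, fun h => h2 (Or.inl h)⟩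
        · exact Or.inr ⟨h1, fun h => h2 (Or.inr h)⟩
      · rintro (⟨h1, h2⟩ | ⟨h1, h2⟩)
        · exact ⟨Or.inl h1, fun h' => h'.elim h2 fun h' => Finset.disjoint_left.1 hd h1 (h.2 h')⟩
        · exact ⟨Or.inr h1, fun h' => h'.elim (fun h' => Finset.disjoint_left.1 hd (h.1 h') h1) h2⟩
    have hd2 : Disjoint (E0 \ a) (E1 \ b) := hd.mono sdiff_subset sdiff_subset
    rw [h3, card_union_of_disjoint hab, card_union_of_disjoint hd2, pow_add, pow_add]
    ring

/-- conditioning bound -/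
theorem Pr_cond {E E1 : Finset α} (hE1 : E1 ⊆ E) {p : ℝ} (hp : 0 ≤ p) (hp1 : p ≤ 1)
    (A : Finset α → Prop) (q : ℝ)
    (h : ∀ W0, W0 ⊆ E \ E1 → Pr E1 p (fun W1 => A (W0 ∪ W1)) ≤ q) : Pr E p A ≤ q := by
  have hE : E = (E \ E1) ∪ E1 := (sdiff_union_of_subset hE1).symm
  unfold Pr
  rw [hE, Ex_split disjoint_sdiff_self_left]
  refine (Ex_mono (g := fun _ => q) hp hp1 fun W0 hW0 => ?_).trans (le_of_eq (Ex_const _ _ _))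
  have := h W0 hW0
  unfold Pr at this
  exact this

theorem lemX {E F A : Finset α} (hF : F ⊆ E) (hA : A ⊆ E) (hFA : Disjoint F A) {p : ℝ} (hp : 0 ≤ p)
    (hp1 : p ≤ 1) (θ : ℝ) (hθ : 0 ≤ θ) (a : ℝ) :
    Pr E p (fun W => F ⊆ W ∧ ((W ∩ A).card : ℝ) ≤ a) ≤
      p ^ F.card * Real.exp (θ * a - (1 - Real.exp (-θ)) * p * A.card) := by
  classical
  set u : α → ℝ := fun e => if e ∈ A then Real.exp (-θ) else 1 with hu
  set v : α → ℝ := fun e => if e ∈ F then 0 else 1 with hv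
  have hu0 : ∀ e, 0 ≤ u e := fun e => by simp only [hu]; split_ifs <;> positivity
  have hv0 : ∀ e, 0 ≤ v e := fun e => by simp only [hv]; split_ifs <;> positivity
  have h1 : Pr E p (fun W => F ⊆ W ∧ ((W ∩ A).card : ℝ) ≤ a) ≤
      Ex E p (fun W => Real.exp (θ * a) * ∏ e ∈ E, if e ∈ W then u e else v e) := by
    refine Pr_le_Ex hp hp1 (fun W _ => mul_nonneg (Real.exp_pos _).le (prod_nonneg fun e _ => ?_)) ?_
    · split_ifs
      · exact hu0 e
      · exact hv0 e
    · rintro W hW ⟨hFW, hWA⟩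
      have h2 : ∏ e ∈ E, (if e ∈ W then u e else v e) = Real.exp (-θ * (W ∩ A).card) := by
        rw [← prod_sdiff hW]
        have e1 : ∏ e ∈ E \ W, (if e ∈ W then u e else v e) = 1 := by
          refine prod_eq_one fun e he => ?_
          have he := (mem_sdiff.1 he).2
          rw [if_neg he]; simp only [hv]; rw [if_neg (fun h => he (hFW h))]
        have e2 : ∏ e ∈ W, (if e ∈ W then u e else v e) = ∏ e ∈ W, u e :=
          prod_congr rfl fun e he => by rw [if_pos he]
        rw [e1, e2, one_mul]
        simp only [hu]
        rw [prod_ite, prod_const_one, mul_one, prod_const, ← Real.exp_nat_mul, filter_mem_eq_inter, mul_comm]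
      rw [h2, ← Real.exp_add]
      refine Real.one_le_exp ?_
      nlinarith
  refine h1.trans ?_
  rw [Ex_mul, Ex_prod]
  have h3 : ∏ e ∈ E, (p * u e + (1 - p) * v e) ≤ p ^ F.card * Real.exp (-((1 - Real.exp (-θ)) * p)) ^ A.card := by
    have h4 : ∀ e ∈ E, p * u e + (1 - p) * v e ≤
        (if e ∈ F then p else 1) * (if e ∈ A then Real.exp (-((1 - Real.exp (-θ)) * p)) else 1) := by
      intro e _
      simp only [hu, hv]
      by_cases hf : e ∈ F
      · have ha : e ∉ A := Finset.disjoint_left.1 hFA hf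
        simp [hf, ha]
      · by_cases ha : e ∈ A
        · simp only [hf, ha, if_true, if_false]
          have := Real.add_one_le_exp (-((1 - Real.exp (-θ)) * p))
          linarith
        · simp [hf, ha]
    refine (prod_le_prod (fun e _ => add_nonneg (mul_nonneg hp (hu0 e)) (mul_nonneg (by linarith) (hv0 e))) h4).trans (le_of_eq ?_)
    rw [prod_mul_distrib, prod_ite, prod_ite, prod_const_one, prod_const_one, mul_one, mul_one, prod_const, prod_const,
      filter_mem_eq_inter, filter_mem_eq_inter, inter_eq_right.2 hF, inter_eq_right.2 hA]
  refine (mul_le_mul_of_nonneg_left h3 (Real.exp_pos _).le).trans (le_of_eq ?_)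
  rw [← Real.exp_nat_mul, mul_left_comm, ← Real.exp_add]
  congr 2
  ring

theorem Pr_subset_le {E F : Finset α} (hF : F ⊆ E) {p : ℝ} (hp : 0 ≤ p) (hp1 : p ≤ 1) :
    Pr E p (fun W => F ⊆ W) ≤ p ^ F.card := by
  have := lemX hF (empty_subset E) (disjoint_empty_right F) hp hp1 0 le_rfl 0
  simpa using this

theorem chernoff_upper (E : Finset α) {p : ℝ} (hp : 0 ≤ p) (hp1 : p ≤ 1) (θ : ℝ) (hθ : 0 ≤ θ) (a : ℝ) :
    Pr E p (fun W => a ≤ (W.card : ℝ)) ≤ Real.exp (-θ * a + (Real.exp θ - 1) * p * E.card) := by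
  have h1 : Pr E p (fun W => a ≤ (W.card : ℝ)) ≤
      Ex E p (fun W => Real.exp (-θ * a) * ∏ e ∈ E, if e ∈ W then Real.exp θ else 1) := by
    refine Pr_le_Ex hp hp1 (fun W _ => mul_nonneg (Real.exp_pos _).le (prod_nonneg fun e _ => by positivity)) ?_
    intro W hW h
    rw [prod_ite, prod_const_one, mul_one, prod_const, ← Real.exp_nat_mul, filter_mem_eq_inter,
      inter_eq_right.2 hW, ← Real.exp_add]
    refine Real.one_le_exp ?_
    nlinarith
  refine h1.trans ?_
  rw [Ex_mul, Ex_prod E p (fun _ => Real.exp θ) (fun _ => 1), prod_const, Real.exp_add]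
  refine mul_le_mul_of_nonneg_left ?_ (Real.exp_pos _).le
  have h5 : (Real.exp θ - 1) * p * E.card = E.card * ((Real.exp θ - 1) * p) := by ring
  rw [h5, Real.exp_nat_mul]
  refine pow_le_pow_left₀ (by nlinarith [Real.exp_pos θ]) ?_ _
  have := Real.add_one_le_exp ((Real.exp θ - 1) * p)
  linarith

end prob

section evB

theorem insert_inj_of {x y : ℕ} {T T' : Finset ℕ} (h : insert x T = insert y T') (hxy : x = y)
    (h1 : x ∉ T) (h2 : y ∉ T') : T = T' := by
  subst hxy
  rw [← erase_insert h1, h, erase_insert h2]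

theorem insert_ne_of {x y : ℕ} {T T' : Finset ℕ} (hxy : x ≠ y) (h1 : y ∉ T) : insert x T ≠ insert y T' := by
  intro h
  have : y ∈ insert x T := h ▸ mem_insert_self y T'
  rcases mem_insert.1 this with h3 | h3
  · exact hxy h3.symm
  · exact h1 h3

theorem evB_prob {k : ℕ} (x : ℕ) (y : Fin k → ℕ) (hy : Function.Injective y) (hxy : ∀ l, x ≠ y l)
    (L E1 : Finset (Finset ℕ)) (hLx : ∀ T ∈ L, x ∉ T) (hLy : ∀ T ∈ L, ∀ l, y l ∉ T)
    (hEx : ∀ T ∈ L, insert x T ∈ E1) (hEy : ∀ T ∈ L, ∀ l, insert (y l) T ∈ E1)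
    {p D κ θ η : ℝ} (hp : 0 ≤ p) (hp1 : p ≤ 1) (hD : 0 ≤ D) (hκ : 0 ≤ κ) (hκ1 : κ ≤ 1/2) (hθ : 0 ≤ θ)
    (hL1 : p * L.card ≤ D) (hL2 : (1 - κ) * D ≤ p * L.card)
    (T : (Fin k → Finset ℕ) → Fin k → Finset (Finset ℕ)) (Q : (Fin k → Finset ℕ) → Prop)
    (hT : ∀ T0 l, T T0 l ⊆ L) (hQ : ∀ T0, Q T0 → ∀ l, T0 l ∈ T T0 l) :
    Pr E1 p (fun W => ∃ T0 ∈ Fintype.piFinset (fun _ : Fin k => L), Q T0 ∧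
      (∀ l, insert (y l) (T0 l) ∈ W) ∧
      ((∃ l, (1 - κ) * L.card ≤ (T T0 l).card ∧
          (((T T0 l).filter (fun t => insert x t ∈ W)).card : ℝ) ≤ η * D) ∨
       (∀ l, ((T T0 l).card : ℝ) ≤ (1 - κ) * L.card ∧
          (((L \ T T0 l).filter (fun t => insert (y l) t ∈ W)).card : ℝ) ≤ κ / 4 * D))) ≤
    D ^ k * (k * Real.exp (θ * (η * D) - (1 - Real.exp (-θ)) * ((1 - 2 * κ) * D)) +
      Real.exp (-(k * κ * D / 16))) := by
  classical
  refine (Pr_exists _ hp hp1 _).trans ?_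
  have key : ∀ T0 ∈ Fintype.piFinset (fun _ : Fin k => L),
      Pr E1 p (fun W => Q T0 ∧
      (∀ l, insert (y l) (T0 l) ∈ W) ∧
      ((∃ l, (1 - κ) * L.card ≤ (T T0 l).card ∧
          (((T T0 l).filter (fun t => insert x t ∈ W)).card : ℝ) ≤ η * D) ∨
       (∀ l, ((T T0 l).card : ℝ) ≤ (1 - κ) * L.card ∧
          (((L \ T T0 l).filter (fun t => insert (y l) t ∈ W)).card : ℝ) ≤ κ / 4 * D))) ≤
      p ^ k * (k * Real.exp (θ * (η * D) - (1 - Real.exp (-θ)) * ((1 - 2 * κ) * D)) +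
      Real.exp (-(k * κ * D / 16))) := by
    intro T0 hT0
    rw [Fintype.mem_piFinset] at hT0
    by_cases hq : Q T0
    swap
    · refine (Pr_le_Ex hp hp1 (f := fun _ => 0) (fun _ _ => le_rfl) (fun W _ h => absurd h.1 hq)).trans ?_
      rw [Ex_const]; positivity
    have hq := hQ T0 hq
    set F : Finset (Finset ℕ) := univ.image (fun l => insert (y l) (T0 l)) with hF
    have hFc : F.card = k := by
      rw [hF, card_image_of_injective, card_univ, Fintype.card_fin]
      intro l l' h
      by_contra hne
      exact insert_ne_of (fun h' => hne (hy h')) (hLy _ (hT0 l) l') h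
    have hFE : F ⊆ E1 := by
      intro f hf
      obtain ⟨l, _, rfl⟩ := mem_image.1 hf
      exact hEy _ (hT0 l) l
    have hFW : ∀ W : Finset (Finset ℕ), (∀ l, insert (y l) (T0 l) ∈ W) → F ⊆ W := by
      intro W h f hf
      obtain ⟨l, _, rfl⟩ := mem_image.1 hf
      exact h l
    have hpos : 0 ≤ 1 - Real.exp (-θ) := by
      have : Real.exp (-θ) ≤ 1 := Real.exp_le_one_iff.2 (by linarith)
      linarith
    -- case a
    have ha : ∀ l : Fin k, Pr E1 p (fun W => F ⊆ W ∧ ((1 - κ) * L.card ≤ (T T0 l).card ∧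
          (((T T0 l).filter (fun t => insert x t ∈ W)).card : ℝ) ≤ η * D)) ≤
          p ^ k * Real.exp (θ * (η * D) - (1 - Real.exp (-θ)) * ((1 - 2 * κ) * D)) := by
      intro l
      by_cases hc : (1 - κ) * L.card ≤ (T T0 l).card
      swap
      · refine (Pr_le_Ex hp hp1 (f := fun _ => 0) (fun _ _ => le_rfl) (fun W _ h => absurd h.2.1 hc)).trans ?_
        rw [Ex_const]; positivity
      set A : Finset (Finset ℕ) := (T T0 l).image (insert x) with hA
      have hinj : Set.InjOn (insert x : Finset ℕ → Finset ℕ) (T T0 l) := by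
        intro t ht t' ht' h
        exact insert_inj_of h rfl (hLx t (hT _ _ ht)) (hLx t' (hT _ _ ht'))
      have hAc : A.card = (T T0 l).card := card_image_of_injOn hinj
      have hAE : A ⊆ E1 := by
        intro f hf
        obtain ⟨t, ht, rfl⟩ := mem_image.1 hf
        exact hEx t (hT _ _ ht)
      have hFA : Disjoint F A := by
        rw [Finset.disjoint_left]
        intro f hf hf'
        obtain ⟨t, ht, rfl⟩ := mem_image.1 hf'
        obtain ⟨l', _, h⟩ := mem_image.1 hf
        exact insert_ne_of (hxy l').symm (hLx _ (hT0 l')) h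
      have := lemX hFE hAE hFA hp hp1 θ hθ (η * D)
      rw [hFc] at this
      refine (Pr_mono hp hp1 ?_).trans (this.trans ?_)
      · rintro W _ ⟨h1, _, h2⟩
        refine ⟨h1, le_trans ?_ h2⟩
        have : W ∩ A = ((T T0 l).filter (fun t => insert x t ∈ W)).image (insert x) := by
          ext f
          simp only [hA, mem_inter, mem_image, mem_filter]
          constructor
          · rintro ⟨h, t, ht, rfl⟩; exact ⟨t, ⟨ht, h⟩, rfl⟩
          · rintro ⟨t, ⟨ht, h⟩, rfl⟩; exact ⟨h, t, ht, rfl⟩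
        rw [this]; exact_mod_cast card_image_le
      · refine mul_le_mul_of_nonneg_left (Real.exp_le_exp.2 ?_) (by positivity)
        have h1 : (1 - 2 * κ) * D ≤ p * A.card := by
          rw [hAc]
          have h2 := mul_le_mul_of_nonneg_left hc hp
          have h3 := mul_le_mul_of_nonneg_left hL2 (by linarith : 0 ≤ 1 - κ)
          nlinarith [mul_nonneg (mul_nonneg hκ hκ) hD]
        have := mul_le_mul_of_nonneg_left h1 hpos
        linarith
    -- case b
    have hb : Pr E1 p (fun W => F ⊆ W ∧ (∀ l, ((T T0 l).card : ℝ) ≤ (1 - κ) * L.card ∧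
          (((L \ T T0 l).filter (fun t => insert (y l) t ∈ W)).card : ℝ) ≤ κ / 4 * D)) ≤
          p ^ k * Real.exp (-(k * κ * D / 16)) := by
      by_cases hc : ∀ l, ((T T0 l).card : ℝ) ≤ (1 - κ) * L.card
      swap
      · refine (Pr_le_Ex hp hp1 (f := fun _ => 0) (fun _ _ => le_rfl)
          (fun W _ h => absurd (fun l => (h.2 l).1) hc)).trans ?_
        rw [Ex_const]; positivity
      set A : Finset (Finset ℕ) := univ.biUnion (fun l => (L \ T T0 l).image (insert (y l))) with hA
      have hinj : ∀ l, Set.InjOn (insert (y l) : Finset ℕ → Finset ℕ) (L \ T T0 l : Finset (Finset ℕ)) := by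
        intro l t ht t' ht' h
        rw [mem_coe, mem_sdiff] at ht ht'
        exact insert_inj_of h rfl (hLy t ht.1 l) (hLy t' ht'.1 l)
      have hAc : A.card = ∑ l, (L \ T T0 l).card := by
        rw [hA, card_biUnion]
        · exact sum_congr rfl fun l _ => card_image_of_injOn (hinj l)
        · intro l _ l' _ hne
          refine Finset.disjoint_left.2 ?_
          intro f hf hf'
          obtain ⟨t, ht, rfl⟩ := mem_image.1 hf
          obtain ⟨t', ht', h⟩ := mem_image.1 hf'
          exact insert_ne_of (fun h' => hne (hy h')) (hLy t (mem_sdiff.1 ht).1 l') h.symm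
      have hAE : A ⊆ E1 := by
        intro f hf
        obtain ⟨l, _, hf⟩ := mem_biUnion.1 hf
        obtain ⟨t, ht, rfl⟩ := mem_image.1 hf
        exact hEy t (mem_sdiff.1 ht).1 l
      have hFA : Disjoint F A := by
        rw [Finset.disjoint_left]
        intro f hf hf'
        obtain ⟨l, _, hf'⟩ := mem_biUnion.1 hf'
        obtain ⟨t, ht, rfl⟩ := mem_image.1 hf'
        rw [mem_sdiff] at ht
        obtain ⟨l', _, h⟩ := mem_image.1 hf
        by_cases hll : l' = l
        · subst hll
          have := insert_inj_of h rfl (hLy _ (hT0 l') l') (hLy t ht.1 l')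
          exact ht.2 (this ▸ hq l')
        · exact insert_ne_of (fun h' => hll (hy h')) (hLy _ (hT0 l') l) h
      have := lemX hFE hAE hFA hp hp1 1 zero_le_one (k * (κ / 4 * D))
      rw [hFc] at this
      refine (Pr_mono hp hp1 ?_).trans (this.trans ?_)
      · rintro W _ ⟨h1, h2⟩
        refine ⟨h1, ?_⟩
        have h3 : W ∩ A ⊆ univ.biUnion (fun l => ((L \ T T0 l).filter (fun t => insert (y l) t ∈ W)).image (insert (y l))) := by
          intro f hf
          rw [mem_inter] at hf
          obtain ⟨l, hl, hf'⟩ := mem_biUnion.1 hf.2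
          obtain ⟨t, ht, rfl⟩ := mem_image.1 hf'
          exact mem_biUnion.2 ⟨l, hl, mem_image.2 ⟨t, mem_filter.2 ⟨ht, hf.1⟩, rfl⟩⟩
        have h4 : ((W ∩ A).card : ℝ) ≤ ∑ l : Fin k, (((L \ T T0 l).filter (fun t => insert (y l) t ∈ W)).card : ℝ) := by
          have h5 := (card_le_card h3).trans (card_biUnion_le.trans (sum_le_sum fun l _ => card_image_le))
          exact_mod_cast h5
        refine h4.trans ((sum_le_sum fun l _ => (h2 l).2).trans ?_)
        simp
      · refine mul_le_mul_of_nonneg_left (Real.exp_le_exp.2 ?_) (by positivity)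
        have h1 : k * (κ * L.card) ≤ (A.card : ℝ) := by
          rw [hAc]; push_cast
          have : ∀ l ∈ (univ : Finset (Fin k)), κ * L.card ≤ ((L \ T T0 l).card : ℝ) := by
            intro l _
            rw [cast_card_sdiff (hT T0 l)]
            have := hc l
            linarith
          have h2 := card_nsmul_le_sum _ _ _ this
          simpa using h2
        have h2 : k * κ * (D / 2) ≤ p * A.card := by
          have h3 := mul_le_mul_of_nonneg_left h1 hp
          have h4 : D / 2 ≤ p * L.card := by nlinarith
          have h5 := mul_le_mul_of_nonneg_left h4 (by positivity : 0 ≤ k * κ)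
          linarith
        have h3 : Real.exp (-1) ≤ 0.37 := by
          have := Real.exp_neg_one_lt_d9; linarith
        have h6 : 0 ≤ k * κ * (D/2) := by positivity
        have h7 : 0.63 * (k * κ * (D/2)) ≤ (1 - Real.exp (-1)) * (p * A.card) :=
          mul_le_mul (by linarith) h2 h6 (by linarith)
        nlinarith
    refine (Pr_mono hp hp1 (B := fun W => (∃ l ∈ (univ : Finset (Fin k)), (F ⊆ W ∧ ((1 - κ) * L.card ≤ (T T0 l).card ∧
          (((T T0 l).filter (fun t => insert x t ∈ W)).card : ℝ) ≤ η * D))) ∨ (F ⊆ W ∧ (∀ l, ((T T0 l).card : ℝ) ≤ (1 - κ) * L.card ∧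
          (((L \ T T0 l).filter (fun t => insert (y l) t ∈ W)).card : ℝ) ≤ κ / 4 * D))) ?_).trans ?_
    · rintro W _ ⟨_, h1, ⟨l, h2⟩ | h2⟩
      · exact Or.inl ⟨l, mem_univ l, hFW W h1, h2⟩
      · exact Or.inr ⟨hFW W h1, h2⟩
    · refine (Pr_or hp hp1 _ _).trans ?_
      have h1 := (Pr_exists (univ : Finset (Fin k)) hp hp1 (fun l W => (F ⊆ W ∧ ((1 - κ) * L.card ≤ (T T0 l).card ∧
          (((T T0 l).filter (fun t => insert x t ∈ W)).card : ℝ) ≤ η * D)))).trans (sum_le_sum fun l _ => ha l)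
      rw [sum_const, card_univ, Fintype.card_fin, nsmul_eq_mul] at h1
      linarith
  refine (sum_le_sum key).trans ?_
  rw [sum_const, nsmul_eq_mul, Fintype.card_piFinset, prod_const, card_univ, Fintype.card_fin, ← mul_assoc]
  refine mul_le_mul_of_nonneg_right ?_ (by positivity)
  push_cast
  rw [← mul_pow]
  exact pow_le_pow_left₀ (by positivity) (by linarith) k

end evB

section evB2

def restT {k : ℕ} (F : Fin k → Finset ℕ) (l : Fin k) : Finset ℕ := (univ.erase l).biUnion F

theorem restT_sub {k : ℕ} {F : Fin k → Finset ℕ} {l j : Fin k} (h : j ≠ l) : F j ⊆ restT F l :=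
  subset_biUnion_of_mem F (mem_erase.2 ⟨h, mem_univ j⟩)

theorem mem_restT {k : ℕ} {F : Fin k → Finset ℕ} {l : Fin k} {v : ℕ} :
    v ∈ restT F l ↔ ∃ j, j ≠ l ∧ v ∈ F j := by
  simp [restT]

/-- the tuple of edges attached to a tuple of stars -/
def insT {k : ℕ} (y : Fin k → ℕ) (T0 : Fin k → Finset ℕ) : Fin k → Finset ℕ := fun j => insert (y j) (T0 j)

open scoped Classical in
noncomputable def TT {k : ℕ} (U0 : Finset ℕ) (G L : Finset (Finset ℕ)) (K : ℝ) (y : Fin k → ℕ)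
    (T0 : Fin k → Finset ℕ) (l : Fin k) : Finset (Finset ℕ) :=
  L.filter (fun t => insert (y l) t ⊆ U0 \ restT (insT y T0) l ∧
    (pmCount ((U0 \ restT (insT y T0) l) \ insert (y l) (T0 l)) G : ℝ) ≤
      K * pmCount ((U0 \ restT (insT y T0) l) \ insert (y l) t) G)

def QQ {k : ℕ} (U0 : Finset ℕ) (L : Finset (Finset ℕ)) (y : Fin k → ℕ)
    (T0 : Fin k → Finset ℕ) : Prop :=
  ∀ l, T0 l ∈ L ∧ insert (y l) (T0 l) ⊆ U0 \ restT (insT y T0) l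

def evB {k : ℕ} (U0 : Finset ℕ) (x : ℕ) (y : Fin k → ℕ) (L G : Finset (Finset ℕ)) (κ η D K : ℝ)
    (W : Finset (Finset ℕ)) : Prop :=
  ∃ T0 ∈ Fintype.piFinset (fun _ : Fin k => L), QQ U0 L y T0 ∧
      (∀ l, insert (y l) (T0 l) ∈ W) ∧
      ((∃ l, (1 - κ) * L.card ≤ (TT U0 G L K y T0 l).card ∧
          (((TT U0 G L K y T0 l).filter (fun t => insert x t ∈ W)).card : ℝ) ≤ η * D) ∨
       (∀ l, ((TT U0 G L K y T0 l).card : ℝ) ≤ (1 - κ) * L.card ∧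
          (((L \ TT U0 G L K y T0 l).filter (fun t => insert (y l) t ∈ W)).card : ℝ) ≤ κ / 4 * D))

def FS {k : ℕ} (y : Fin k → ℕ) (S : Finset (Finset ℕ)) : Fin k → Finset ℕ := fun j => edgeAt S (y j)

def goodS {k : ℕ} (U0 : Finset ℕ) (G P : Finset (Finset ℕ)) (D ε3 κ : ℝ) (y : Fin k → ℕ)
    (S : Finset (Finset ℕ)) : Prop :=
  ∀ l, y l ∈ U0 \ restT (FS y S) l ∧
    ¬ badV (U0 \ restT (FS y S) l) G P D ε3 κ (edgeAt S (y l)) (y l)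

/-- stars of a matching -/
def TS {k : ℕ} (y : Fin k → ℕ) (S : Finset (Finset ℕ)) : Fin k → Finset ℕ :=
  fun j => (edgeAt S (y j)).erase (y j)

variable {k : ℕ} {U0 : Finset ℕ} {G P W S L : Finset (Finset ℕ)} {D ε3 κ K η : ℝ} {y : Fin k → ℕ} {x r C : ℕ}

theorem insT_TS (hS : S ∈ pmSet U0 G) (hy : ∀ l, y l ∈ U0) : insT y (TS y S) = FS y S := by
  funext j
  simp only [insT, TS, FS]
  exact insert_erase (edgeAt_mem hS (hy j)).2

theorem good_sub (hS : S ∈ pmSet U0 G) (hg : goodS U0 G P D ε3 κ y S) (l : Fin k) :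
    FS y S l ⊆ U0 \ restT (FS y S) l := by
  have hy : ∀ l, y l ∈ U0 := fun l => (mem_sdiff.1 (hg l).1).1
  intro v hv
  refine mem_sdiff.2 ⟨pm_edge_sub hS (edgeAt_mem hS (hy l)).1 hv, fun h => ?_⟩
  obtain ⟨j, hj, hvj⟩ := mem_restT.1 h
  have h1 : FS y S l = FS y S j := pm_eq_of_mem hS (edgeAt_mem hS (hy l)).1 (edgeAt_mem hS (hy j)).1 hv hvj
  have h2 := (mem_sdiff.1 (hg l).1).2
  exact h2 (mem_restT.2 ⟨j, hj, h1 ▸ (edgeAt_mem hS (hy l)).2⟩)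

theorem good_TL (hr : ∀ f ∈ G, f.card = r) (hS : S ∈ pmSet U0 G) (hg : goodS U0 G P D ε3 κ y S)
    (l : Fin k) : TS y S l ∈ powersetCard (r-1) (U0 \ univ.image y) := by
  have hy : ∀ l, y l ∈ U0 := fun l => (mem_sdiff.1 (hg l).1).1
  have hm := edgeAt_mem hS (hy l)
  rw [mem_powersetCard]
  constructor
  · intro v hv
    rw [TS, mem_erase] at hv
    refine mem_sdiff.2 ⟨pm_edge_sub hS hm.1 hv.2, fun h => ?_⟩
    obtain ⟨j, _, rfl⟩ := mem_image.1 h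
    have hj : l ≠ j := fun h => hv.1 (by rw [h])
    exact (mem_sdiff.1 (hg j).1).2 (mem_restT.2 ⟨l, hj, hv.2⟩)
  · rw [TS, card_erase_of_mem hm.2, hr _ (pm_sub hS hm.1)]

theorem good_QQ (hr : ∀ f ∈ G, f.card = r) (hS : S ∈ pmSet U0 G) (hg : goodS U0 G P D ε3 κ y S) :
    QQ U0 (powersetCard (r-1) (U0 \ univ.image y)) y (TS y S) := by
  have hy : ∀ l, y l ∈ U0 := fun l => (mem_sdiff.1 (hg l).1).1
  intro l
  refine ⟨good_TL hr hS hg l, ?_⟩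
  have := good_sub hS hg l
  rw [insT_TS hS hy]
  have h2 := congrFun (insT_TS hS hy) l
  rw [insT] at h2
  rw [h2]; exact this

/-- few edges at y l lead outside the flat family -/
theorem good_few (hr : ∀ f ∈ G, f.card = r) (hS : S ∈ pmSet U0 G) (hg : goodS U0 G P D ε3 κ y S)
    (hcod : ∀ u ∈ U0, ∀ v ∈ U0, u ≠ v → (G.filter (fun f => u ∈ f ∧ v ∈ f)).card ≤ C)
    (hW : W ⊆ G) (h3 : 0 < ε3) (hD : 0 < D) (l : Fin k) :
    (((powersetCard (r-1) (U0 \ univ.image y) \ TT U0 G (powersetCard (r-1) (U0 \ univ.image y)) (512 / ε3 ^ 2) y (TS y S) l).filter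
      (fun t => insert (y l) t ∈ W)).card : ℝ) ≤ κ * D + k * (r * C) := by
  classical
  have hy : ∀ l, y l ∈ U0 := fun l => (mem_sdiff.1 (hg l).1).1
  set Ul := U0 \ restT (FS y S) l with hUl
  set LF := G.filter (fun f => (f ⊆ Ul ∧ (pmCount (Ul \ f) G : ℝ) * D < ε3 / 32 * pmCount Ul G) ∧ y l ∈ f) with hLF
  set CF : Finset (Finset ℕ) := (restT (FS y S) l).biUnion (fun u => G.filter (fun f => y l ∈ f ∧ u ∈ f)) with hCF
  have hnb := (hg l).2
  simp only [badV, not_or, not_lt] at hnb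
  have h1 : (LF.card : ℝ) ≤ κ * D := hnb.2.1
  have hrest : (restT (FS y S) l).card ≤ k * r := by
    refine card_biUnion_le.trans ?_
    refine (sum_le_card_nsmul _ _ r fun j _ => ?_).trans ?_
    · rw [FS, hr _ (pm_sub hS (edgeAt_mem hS (hy j)).1)]
    · rw [smul_eq_mul]
      exact Nat.mul_le_mul_right r ((card_le_univ _).trans (by simp))
  have h2 : CF.card ≤ k * r * C := by
    refine card_biUnion_le.trans ((sum_le_card_nsmul _ _ C fun u hu => ?_).trans ?_)
    · obtain ⟨j, hj, huj⟩ := mem_restT.1 hu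
      have huU : u ∈ U0 := pm_edge_sub hS (edgeAt_mem hS (hy j)).1 huj
      refine hcod (y l) (hy l) u huU fun h => ?_
      exact (mem_sdiff.1 (hg l).1).2 (h ▸ hu)
    · rw [smul_eq_mul]; exact Nat.mul_le_mul_right C hrest
  have h4 : ((powersetCard (r-1) (U0 \ univ.image y) \ TT U0 G (powersetCard (r-1) (U0 \ univ.image y)) (512 / ε3 ^ 2) y (TS y S) l).filter
      (fun t => insert (y l) t ∈ W)).card ≤ (LF ∪ CF).card := by
    refine card_le_card_of_injOn (insert (y l)) ?_ ?_
    · intro t ht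
      rw [mem_coe, mem_filter, mem_sdiff] at ht
      obtain ⟨⟨htL, htT⟩, htW⟩ := ht
      have htW := hW htW
      have htU : insert (y l) t ⊆ U0 := insert_subset (hy l) ((mem_powersetCard.1 htL).1.trans sdiff_subset)
      rw [mem_coe, mem_union]
      by_cases hs : insert (y l) t ⊆ Ul
      · left
        refine mem_filter.2 ⟨htW, ⟨hs, ?_⟩, mem_insert_self _ _⟩
        by_contra hlt
        rw [not_lt] at hlt
        refine htT (mem_filter.2 ⟨htL, ?_⟩)
        rw [insT_TS hS hy]
        refine ⟨hs, ?_⟩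
        have h5 := congrFun (insT_TS hS hy) l
        rw [insT] at h5
        rw [h5]
        have h6 := hnb.1.1
        change (pmCount (Ul \ edgeAt S (y l)) G : ℝ) ≤ 512 / ε3^2 * pmCount (Ul \ insert (y l) t) G
        have h7 : (pmCount (Ul \ edgeAt S (y l)) G : ℝ) * D ≤ (512 / ε3^2 * pmCount (Ul \ insert (y l) t) G) * D := by
          calc _ ≤ 16 / ε3 * pmCount Ul G := h6
            _ = 512 / ε3^2 * (ε3 / 32 * pmCount Ul G) := by field_simp; ring
            _ ≤ 512 / ε3^2 * (pmCount (Ul \ insert (y l) t) G * D) := mul_le_mul_of_nonneg_left hlt (by positivity)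
            _ = _ := by ring
        exact le_of_mul_le_mul_right h7 hD
      · right
        rw [not_subset] at hs
        obtain ⟨u, hu, hu2⟩ := hs
        have hu3 : u ∈ restT (FS y S) l := by
          by_contra h
          exact hu2 (mem_sdiff.2 ⟨htU hu, h⟩)
        exact mem_biUnion.2 ⟨u, hu3, mem_filter.2 ⟨htW, mem_insert_self _ _, hu⟩⟩
    · intro t ht t' ht' h
      have hn : ∀ t ∈ powersetCard (r-1) (U0 \ univ.image y), y l ∉ t := fun t ht h =>
        (mem_sdiff.1 ((mem_powersetCard.1 ht).1 h)).2 (mem_image_of_mem y (mem_univ l))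
      rw [mem_coe, mem_filter, mem_sdiff] at ht ht'
      exact insert_inj_of h rfl (hn t ht.1.1) (hn t' ht'.1.1)
  have h5 := h4.trans (card_union_le _ _)
  have h6 : (((powersetCard (r-1) (U0 \ univ.image y) \ TT U0 G (powersetCard (r-1) (U0 \ univ.image y)) (512 / ε3 ^ 2) y (TS y S) l).filter
      (fun t => insert (y l) t ∈ W)).card : ℝ) ≤ LF.card + CF.card := by exact_mod_cast h5
  have h7 : (CF.card : ℝ) ≤ k * r * C := by exact_mod_cast h2
  linarith

end evB2

section evB3
variable {k : ℕ} {U0 : Finset ℕ} {G P W S L : Finset (Finset ℕ)} {D ε3 κ K η : ℝ} {y : Fin k → ℕ} {x r C : ℕ}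

open scoped Classical in
theorem good_count_l (hne : ∅ ∉ G) (hx : x ∉ U0) (hW : W ⊆ G) (hL : ∀ t ∈ L, t ⊆ U0 \ univ.image y)
    (h3 : 0 < ε3) (hD : 0 < D) (hK : 0 ≤ K) (hη : 0 ≤ η) (l : Fin k) :
    (((pmSet U0 G).filter (fun S => goodS U0 G P D ε3 κ y S ∧
      η * D < (((TT U0 G L K y (TS y S) l).filter (fun t => insert x t ∈ W)).card : ℝ))).card : ℝ) * (η * D)
      ≤ K * (D / ε3) * pmCount (insert x (U0.erase (y l))) G := by
  set GS := (pmSet U0 G).filter (fun S => goodS U0 G P D ε3 κ y S ∧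
      η * D < (((TT U0 G L K y (TS y S) l).filter (fun t => insert x t ∈ W)).card : ℝ)) with hGS
  set R := insert x (U0.erase (y l)) with hR
  set FF := GS.image (FS y) with hFF
  -- the stars
  let TF : (Fin k → Finset ℕ) → Finset (Finset ℕ) := fun F =>
    (TT U0 G L K y (fun j => (F j).erase (y j)) l).filter (fun t => insert x t ∈ W)
  have hprop : ∀ F ∈ FF, ∃ S ∈ pmSet U0 G, goodS U0 G P D ε3 κ y S ∧ FS y S = F ∧
      (η * D < ((TF F).card : ℝ)) := by
    intro F hF
    obtain ⟨S, hS, rfl⟩ := mem_image.1 hF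
    rw [hGS, mem_filter] at hS
    exact ⟨S, hS.1, hS.2.1, rfl, hS.2.2⟩
  -- compat sets
  let CS : (Fin k → Finset ℕ) → Finset ℕ → Finset (Finset ℕ) := fun F t =>
    insert (insert x t) ((univ.erase l).image F)
  have h1 : (GS.card : ℝ) * (η * D) ≤ ∑ F ∈ FF, (pmCount (U0 \ univ.biUnion F) G : ℝ) * (η * D) := by
    rw [← sum_mul]
    refine mul_le_mul_of_nonneg_right ?_ ?_
    · rw [card_eq_sum_card_image (FS y) GS]
      push_cast
      refine sum_le_sum fun F hF => ?_
      have : (GS.filter (fun S => FS y S = F)).card ≤ ((pmSet U0 G).filter (fun S => univ.image F ⊆ S)).card := by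
        refine card_le_card fun S hS => ?_
        rw [mem_filter] at hS
        obtain ⟨hS, rfl⟩ := hS
        rw [hGS, mem_filter] at hS
        refine mem_filter.2 ⟨hS.1, ?_⟩
        intro f hf
        obtain ⟨j, _, rfl⟩ := mem_image.1 hf
        exact (edgeAt_mem hS.1 (mem_sdiff.1 (hS.2.1 j).1).1).1
      have h2 := this.trans (card_containing_le hne _)
      rw [image_biUnion] at h2
      exact_mod_cast h2
    · positivity
  have h2 : ∀ F ∈ FF, (pmCount (U0 \ univ.biUnion F) G : ℝ) * (η * D) ≤
      ∑ t ∈ TF F, K * (((pmSet R G).filter (fun S => CS F t ⊆ S)).card : ℝ) := by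
    intro F hF
    obtain ⟨S, hS, hg, rfl, hc⟩ := hprop F hF
    have hy : ∀ l, y l ∈ U0 := fun l => (mem_sdiff.1 (hg l).1).1
    have h3 : (pmCount (U0 \ univ.biUnion (FS y S)) G : ℝ) * (η * D) ≤ (TF (FS y S)).card • (pmCount (U0 \ univ.biUnion (FS y S)) G : ℝ) := by
      rw [nsmul_eq_mul, mul_comm]
      exact mul_le_mul_of_nonneg_right hc.le (by positivity)
    refine h3.trans (card_nsmul_le_sum _ _ _ fun t ht => ?_)
    obtain ⟨ht, htW⟩ := mem_filter.1 ht
    obtain ⟨htL, hts, htK⟩ := mem_filter.1 ht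
    change insert (y l) t ⊆ U0 \ restT (insT y (TS y S)) l at hts
    change (pmCount ((U0 \ restT (insT y (TS y S)) l) \ insert (y l) (TS y S l)) G : ℝ) ≤
      K * pmCount ((U0 \ restT (insT y (TS y S)) l) \ insert (y l) t) G at htK
    have h5 : insert (y l) (TS y S l) = FS y S l := congrFun (insT_TS hS hy) l
    rw [h5] at htK
    rw [insT_TS hS hy] at hts htK
    have e1 : (U0 \ restT (FS y S) l) \ FS y S l = U0 \ univ.biUnion (FS y S) := by
      ext v
      simp only [mem_sdiff, mem_restT, mem_biUnion, mem_univ, true_and, not_exists, not_and]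
      constructor
      · rintro ⟨⟨h1, h2⟩, h3⟩
        refine ⟨h1, fun j => ?_⟩
        by_cases hj : j = l
        · rw [hj]; exact h3
        · exact h2 j hj
      · rintro ⟨h1, h2⟩
        exact ⟨⟨h1, fun j _ => h2 j⟩, h2 l⟩
    rw [e1] at htK
    refine htK.trans (mul_le_mul_of_nonneg_left ?_ hK)
    have htU := hL t htL
    have hxt : x ∉ t := fun h => hx (mem_sdiff.1 (htU h)).1
    have hbi : (CS (FS y S) t).biUnion id = insert x t ∪ restT (FS y S) l := by
      simp only [CS]
      rw [biUnion_insert, image_biUnion]; rfl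
    have hdx : ∀ j, j ≠ l → insert x t ∩ FS y S j = ∅ := by
      intro j hj
      rw [← disjoint_iff_inter_eq_empty, Finset.disjoint_left]
      intro v hv hvj
      rcases mem_insert.1 hv with rfl | hv
      · exact hx (pm_edge_sub hS (edgeAt_mem hS (hy j)).1 hvj)
      · exact (mem_sdiff.1 (hts (mem_insert_of_mem hv))).2 (mem_restT.2 ⟨j, hj, hvj⟩)
    have hcc := card_containing (U := R) (H := G) hne (F := CS (FS y S) t) (by
        intro f hf
        rcases mem_insert.1 hf with rfl | hf
        · exact hW htW
        · obtain ⟨j, _, rfl⟩ := mem_image.1 hf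
          exact pm_sub hS (edgeAt_mem hS (hy j)).1) (by
        intro A hA B hB hAB
        rcases mem_insert.1 hA with rfl | hA <;> rcases mem_insert.1 hB with rfl | hB
        · exact absurd rfl hAB
        · obtain ⟨j, hj, rfl⟩ := mem_image.1 hB
          exact hdx j (mem_erase.1 hj).1
        · obtain ⟨j, hj, rfl⟩ := mem_image.1 hA
          rw [inter_comm]; exact hdx j (mem_erase.1 hj).1
        · obtain ⟨j, hj, rfl⟩ := mem_image.1 hA
          obtain ⟨i, hi, rfl⟩ := mem_image.1 hB
          exact (mem_pmSet.1 hS).2.1 _ (edgeAt_mem hS (hy j)).1 _ (edgeAt_mem hS (hy i)).1 hAB) (by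
        rw [hbi, hR]
        refine union_subset (insert_subset_insert _ fun v hv => ?_) fun v hv => ?_
        · have := mem_sdiff.1 (htU hv)
          exact mem_erase.2 ⟨fun h => this.2 (h ▸ mem_image_of_mem y (mem_univ l)), this.1⟩
        · obtain ⟨j, hj, hvj⟩ := mem_restT.1 hv
          refine mem_insert_of_mem (mem_erase.2 ⟨fun h => ?_, pm_edge_sub hS (edgeAt_mem hS (hy j)).1 hvj⟩)
          exact (mem_sdiff.1 (hg l).1).2 (h ▸ hv))
    rw [hcc, hbi]
    have e2 : (U0 \ restT (FS y S) l) \ insert (y l) t = R \ (insert x t ∪ restT (FS y S) l) := by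
      ext v
      simp only [hR, mem_sdiff, mem_insert, mem_erase, mem_union, not_or]
      constructor
      · rintro ⟨⟨h1, h2⟩, h3, h4⟩
        exact ⟨Or.inr ⟨h3, h1⟩, ⟨fun h => hx (h ▸ h1), h4⟩, h2⟩
      · rintro ⟨h1 | h1, ⟨h2, h3⟩, h4⟩
        · exact absurd h1 h2
        · exact ⟨⟨h1.2, h4⟩, h1.1, h3⟩
    rw [e2]
  have h4 : ∑ F ∈ FF, ∑ t ∈ TF F, K * (((pmSet R G).filter (fun S => CS F t ⊆ S)).card : ℝ) ≤
      K * (D / ε3) * pmCount R G := by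
    have e1 : ∑ F ∈ FF, ∑ t ∈ TF F, K * (((pmSet R G).filter (fun S => CS F t ⊆ S)).card : ℝ) =
        K * ∑ S ∈ pmSet R G, (((FF.sigma TF).filter (fun q => CS q.1 q.2 ⊆ S)).card : ℝ) := by
      simp_rw [← mul_sum]
      congr 1
      rw [sum_sigma' FF TF (fun F t => (((pmSet R G).filter (fun S => CS F t ⊆ S)).card : ℝ))]
      exact_mod_cast Finset.sum_card_bipartiteAbove_eq_sum_card_bipartiteBelow (s := FF.sigma TF) (t := pmSet R G)
        (fun q S => CS q.1 q.2 ⊆ S)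
    rw [e1, mul_assoc, mul_comm (D/ε3)]
    refine mul_le_mul_of_nonneg_left ?_ hK
    rw [← nsmul_eq_mul]
    refine sum_le_card_nsmul _ _ _ fun S'' hS'' => ?_
    rcases ((FF.sigma TF).filter (fun q => CS q.1 q.2 ⊆ S'')).eq_empty_or_nonempty with h0 | ⟨q0, hq0⟩
    · rw [h0]; simp; positivity
    rw [mem_filter, mem_sigma] at hq0
    obtain ⟨S0, hS0, hg0, hF0, -⟩ := hprop q0.1 hq0.1.1
    have hnb := (hg0 l).2
    simp only [badV, not_or, not_lt] at hnb
    refine le_trans ?_ hnb.2.2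
    rw [degU]
    have hcomp : ∀ q ∈ (FF.sigma TF).filter (fun q => CS q.1 q.2 ⊆ S''), (∀ j, j ≠ l → q.1 j = edgeAt S'' (y j)) ∧
        insert x q.2 = edgeAt S'' x ∧ x ∉ q.2 := by
      intro q hq
      rw [mem_filter, mem_sigma] at hq
      obtain ⟨S1, hS1, hg1, hF1, -⟩ := hprop q.1 hq.1.1
      have hy1 : ∀ l, y l ∈ U0 := fun l => (mem_sdiff.1 (hg1 l).1).1
      refine ⟨fun j hj => ?_, ?_, ?_⟩
      · refine (edgeAt_eq hS'' (hq.2 (mem_insert_of_mem (mem_image_of_mem _ (mem_erase.2 ⟨hj, mem_univ j⟩)))) ?_).symm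
        rw [← hF1]; exact (edgeAt_mem hS1 (hy1 j)).2
      · exact (edgeAt_eq hS'' (hq.2 (mem_insert_self _ _)) (mem_insert_self _ _)).symm
      · obtain ⟨ht, htW⟩ := mem_filter.1 hq.1.2
        intro h
        exact hx (mem_sdiff.1 (hL _ (mem_filter.1 ht).1 h)).1
    have : ((FF.sigma TF).filter (fun q => CS q.1 q.2 ⊆ S'')).card ≤
        (G.filter (fun f => f ⊆ U0 \ restT (FS y S0) l ∧ y l ∈ f)).card := by
      refine card_le_card_of_injOn (fun q => q.1 l) ?_ ?_
      · intro q hq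
        rw [mem_coe] at hq
        have hcq := hcomp q hq
        have hc0 := hcomp q0 (mem_filter.2 ⟨mem_sigma.2 hq0.1, hq0.2⟩)
        rw [mem_filter, mem_sigma] at hq
        obtain ⟨S1, hS1, hg1, hF1, -⟩ := hprop q.1 hq.1.1
        have hy1 : ∀ l, y l ∈ U0 := fun l => (mem_sdiff.1 (hg1 l).1).1
        have hrest : restT (FS y S0) l = restT (FS y S1) l := by
          rw [hF0, hF1]
          ext v
          rw [mem_restT, mem_restT]
          refine exists_congr fun j => and_congr_right fun hj => ?_
          rw [hcq.1 j hj, hc0.1 j hj]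
        rw [mem_coe, mem_filter, hrest]
        beta_reduce
        rw [← hF1]
        exact ⟨pm_sub hS1 (edgeAt_mem hS1 (hy1 l)).1, good_sub hS1 hg1 l, (edgeAt_mem hS1 (hy1 l)).2⟩
      · rintro ⟨F, t⟩ hq ⟨F', t'⟩ hq' h
        rw [mem_coe] at hq hq'
        have h1 := hcomp _ hq
        have h2 := hcomp _ hq'
        dsimp only at h h1 h2
        have e1 : F = F' := by
          funext j
          by_cases hj : j = l
          · rw [hj]; exact h
          · rw [h1.1 j hj, h2.1 j hj]
        have e2 : t = t' := insert_inj_of (h1.2.1.trans h2.2.1.symm) rfl h1.2.2 h2.2.2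
        subst e1 e2; rfl
    exact_mod_cast this
  exact h1.trans ((sum_le_sum h2).trans h4)

open scoped Classical in
theorem good_count (hr : ∀ f ∈ G, f.card = r) (hr2 : 2 ≤ r) (hx : x ∉ U0) (hG : G = W ∪ P)
    (hcod : ∀ u ∈ U0, ∀ v ∈ U0, u ≠ v → (G.filter (fun f => u ∈ f ∧ v ∈ f)).card ≤ C)
    (h3 : 0 < ε3) (hD : 0 < D) (hη : 0 < η) (hκ : κ / 8 * D + k * (r * C) ≤ κ / 4 * D)
    (hB : ¬ evB U0 x y (powersetCard (r-1) (U0 \ univ.image y)) G κ η D (512 / ε3 ^ 2) W) :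
    (((pmSet U0 G).filter (goodS U0 G P D ε3 (κ/8) y)).card : ℝ) ≤
      512 / ε3 ^ 3 / η * ∑ l, (pmCount (insert x (U0.erase (y l))) G : ℝ) := by
  have hne : ∅ ∉ G := fun h => by
    have := hr _ h
    simp at this; omega
  have hW : W ⊆ G := hG ▸ subset_union_left
  set L := powersetCard (r-1) (U0 \ univ.image y) with hLd
  have h1 := fun l => good_count_l (P := P) (κ := κ/8) (L := L) (K := 512 / ε3 ^ 2) (y := y) hne hx hW
    (fun t ht => (mem_powersetCard.1 ht).1) h3 hD (by positivity) hη.le l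
  have h2 : (pmSet U0 G).filter (goodS U0 G P D ε3 (κ/8) y) ⊆ univ.biUnion (fun l =>
      (pmSet U0 G).filter (fun S => goodS U0 G P D ε3 (κ/8) y S ∧
      η * D < (((TT U0 G L (512 / ε3 ^ 2) y (TS y S) l).filter (fun t => insert x t ∈ W)).card : ℝ))) := by
    intro S hS
    rw [mem_filter] at hS
    obtain ⟨hS, hg⟩ := hS
    have hy : ∀ l, y l ∈ U0 := fun l => (mem_sdiff.1 (hg l).1).1
    by_contra hcon
    simp only [mem_biUnion, mem_univ, true_and, mem_filter, hS, hg, not_exists, not_lt] at hcon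
    refine hB ⟨TS y S, Fintype.mem_piFinset.2 fun l => good_TL hr hS hg l, good_QQ hr hS hg, fun l => ?_, ?_⟩
    · have h5 : insert (y l) (TS y S l) = edgeAt S (y l) := congrFun (insT_TS hS hy) l
      rw [h5]
      have hm : edgeAt S (y l) ∈ G := pm_sub hS (edgeAt_mem hS (hy l)).1
      have hnb := (hg l).2
      simp only [badV, not_or] at hnb
      rw [hG, mem_union] at hm
      exact hm.resolve_right hnb.1.2
    · by_cases hc : ∃ l, (1 - κ) * (L.card : ℝ) ≤ (TT U0 G L (512 / ε3 ^ 2) y (TS y S) l).card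
      · obtain ⟨l, hl⟩ := hc
        exact Or.inl ⟨l, hl, hcon l⟩
      · right
        intro l
        refine ⟨?_, ?_⟩
        · by_contra h
          exact hc ⟨l, (not_le.1 h).le⟩
        · exact (good_few hr hS hg hcod hW h3 hD l).trans hκ
  have h4 : (((pmSet U0 G).filter (goodS U0 G P D ε3 (κ/8) y)).card : ℝ) ≤ ∑ l, (((pmSet U0 G).filter (fun S => goodS U0 G P D ε3 (κ/8) y S ∧
      η * D < (((TT U0 G L (512 / ε3 ^ 2) y (TS y S) l).filter (fun t => insert x t ∈ W)).card : ℝ))).card : ℝ) := by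
    exact_mod_cast (card_le_card h2).trans card_biUnion_le
  refine h4.trans ?_
  rw [mul_sum]
  refine sum_le_sum fun l _ => ?_
  have h5 := h1 l
  rw [← le_div_iff₀ (by positivity)] at h5
  refine h5.trans (le_of_eq ?_)
  field_simp

end evB3

section evB4
variable {k : ℕ} {U0 : Finset ℕ} {G P W S L : Finset (Finset ℕ)} {D ε3 κ K η : ℝ} {y : Fin k → ℕ} {x r C : ℕ}

def goodL {k : ℕ} (U0 : Finset ℕ) (G P : Finset (Finset ℕ)) (D ε3 κ : ℝ) (y : Fin k → ℕ) (l : Fin k)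
    (S : Finset (Finset ℕ)) (v : ℕ) : Prop := v ∈ U0 \ restT (FS y S) l ∧
    ¬ badV (U0 \ restT (FS y S) l) G P D ε3 κ (edgeAt S v) v

theorem edgeAt_sdiff (hne : ∅ ∉ G) (hS : S ∈ pmSet U0 G) {F : Finset (Finset ℕ)} (hF : F ⊆ S) {v : ℕ}
    (hv : v ∈ U0 \ F.biUnion id) : edgeAt (S \ F) v = edgeAt S v := by
  have h1 := pm_sdiff hne hS hF
  have h2 := edgeAt_mem h1 hv
  exact (edgeAt_eq hS (mem_sdiff.1 h2.1).1 h2.2).symm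

open scoped Classical in
theorem bad_l (hr : ∀ f ∈ G, f.card = r) (hr2 : 2 ≤ r) (hy : ∀ j, y j ∈ U0) (l : Fin k) (a thr : ℝ) (ha : 0 ≤ a)
    (hthr : 0 ≤ thr)
    (hN : ∀ F ⊆ G, F.card ≤ k → (∀ A ∈ F, ∀ B ∈ F, A ≠ B → A ∩ B = ∅) → F.biUnion id ⊆ U0 →
      (∑ S ∈ pmSet (U0 \ F.biUnion id) G, (((U0 \ F.biUnion id).filter (fun v =>
        badV (U0 \ F.biUnion id) G P D ε3 κ (edgeAt S v) v)).card : ℝ)) ≤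
          a * U0.card * pmCount (U0 \ F.biUnion id) G ∨ (pmCount (U0 \ F.biUnion id) G : ℝ) ≤ thr) :
    ∑ S ∈ pmSet U0 G, ((U0.filter (fun v => ¬ goodL U0 G P D ε3 κ y l S v)).card : ℝ) ≤
      (k * r + a * U0.card) * pmCount U0 G + U0.card * ((G.card : ℝ) ^ k * thr) := by
  have hne : ∅ ∉ G := fun h => by
    have := hr _ h
    simp at this; omega
  let FF : Finset (Finset ℕ) → Finset (Finset ℕ) := fun S => (univ.erase l).image (FS y S)
  have hFFb : ∀ S, (FF S).biUnion id = restT (FS y S) l := by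
    intro S
    simp only [FF]
    rw [image_biUnion]; rfl
  have hFFS : ∀ S ∈ pmSet U0 G, FF S ⊆ S := by
    intro S hS f hf
    obtain ⟨j, _, rfl⟩ := mem_image.1 hf
    exact (edgeAt_mem hS (hy j)).1
  have hFFc : ∀ S, (FF S).card ≤ k := fun S =>
    card_image_le.trans ((card_le_univ _).trans (by simp))
  let b : Finset ℕ → Finset (Finset ℕ) → ℝ := fun U S =>
    ((U.filter (fun v => badV U G P D ε3 κ (edgeAt S v) v)).card : ℝ)
  have h1 : ∀ S ∈ pmSet U0 G, ((U0.filter (fun v => ¬ goodL U0 G P D ε3 κ y l S v)).card : ℝ) ≤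
      k * r + b (U0 \ (FF S).biUnion id) (S \ FF S) := by
    intro S hS
    have hrest : (restT (FS y S) l).card ≤ k * r := by
      refine card_biUnion_le.trans ?_
      refine (sum_le_card_nsmul _ _ r fun j _ => ?_).trans ?_
      · rw [FS, hr _ (pm_sub hS (edgeAt_mem hS (hy j)).1)]
      · rw [smul_eq_mul]
        exact Nat.mul_le_mul_right r ((card_le_univ _).trans (by simp))
    have hsub : U0.filter (fun v => ¬ goodL U0 G P D ε3 κ y l S v) ⊆ restT (FS y S) l ∪
        (U0 \ (FF S).biUnion id).filter (fun v => badV (U0 \ (FF S).biUnion id) G P D ε3 κ (edgeAt (S \ FF S) v) v) := by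
      intro v hv
      rw [mem_filter] at hv
      rw [mem_union]
      by_cases h : v ∈ restT (FS y S) l
      · exact Or.inl h
      · right
        have hvm : v ∈ U0 \ restT (FS y S) l := mem_sdiff.2 ⟨hv.1, h⟩
        have hvm' : v ∈ U0 \ (FF S).biUnion id := by rw [hFFb]; exact hvm
        refine mem_filter.2 ⟨hvm', ?_⟩
        rw [edgeAt_sdiff hne hS (hFFS S hS) hvm', hFFb]
        by_contra hb
        exact hv.2 ⟨hvm, hb⟩
    have h2 := (card_le_card hsub).trans (card_union_le _ _)
    have h3 : ((U0.filter (fun v => ¬ goodL U0 G P D ε3 κ y l S v)).card : ℝ) ≤ (restT (FS y S) l).card + b (U0 \ (FF S).biUnion id) (S \ FF S) := by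
      simp only [b]; exact_mod_cast h2
    have h4 : ((restT (FS y S) l).card : ℝ) ≤ k * r := by exact_mod_cast hrest
    linarith
  refine (sum_le_sum h1).trans ?_
  rw [sum_add_distrib, sum_const, nsmul_eq_mul]
  set I := (pmSet U0 G).image FF with hI
  have hIp : ∀ F ∈ I, F ⊆ G ∧ F.card ≤ k ∧ (∀ A ∈ F, ∀ B ∈ F, A ≠ B → A ∩ B = ∅) ∧ F.biUnion id ⊆ U0 := by
    intro F hF
    obtain ⟨S, hS, rfl⟩ := mem_image.1 hF
    refine ⟨(hFFS S hS).trans (pm_sub hS), hFFc S, fun A hA B hB => (mem_pmSet.1 hS).2.1 A (hFFS S hS hA) B (hFFS S hS hB), ?_⟩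
    intro v hv
    obtain ⟨f, hf, hvf⟩ := mem_biUnion.1 hv
    exact pm_edge_sub hS (hFFS S hS hf) hvf
  have hfib : ∀ F ∈ I, ∀ S ∈ pmSet U0 G, F ⊆ S → FF S = F := by
    intro F hF S hS hFS
    obtain ⟨S', hS', rfl⟩ := mem_image.1 hF
    simp only [FF]
    refine image_congr fun j hj => ?_
    exact edgeAt_eq hS (hFS (mem_image_of_mem _ hj)) (edgeAt_mem hS' (hy j)).2
  have hcount : ∀ F ∈ I, ((pmSet U0 G).filter (fun S => FF S = F)).card = pmCount (U0 \ F.biUnion id) G := by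
    intro F hF
    have hp := hIp F hF
    rw [← card_containing hne hp.1 hp.2.2.1 hp.2.2.2]
    congr 1
    refine filter_congr fun S hS => ?_
    constructor
    · intro h; rw [← h]; exact hFFS S hS
    · intro h; exact hfib F hF S hS h
  have hsum : ∑ F ∈ I, (pmCount (U0 \ F.biUnion id) G : ℝ) = pmCount U0 G := by
    have : pmCount U0 G = ∑ F ∈ I, pmCount (U0 \ F.biUnion id) G := by
      rw [pmCount, card_eq_sum_card_image FF]
      exact sum_congr rfl hcount
    exact_mod_cast this.symm
  have hIc : (I.card : ℝ) ≤ (G.card : ℝ) ^ k := by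
    have h1 : I ⊆ (Fintype.piFinset (fun _ : Fin k => G)).image (fun F => (univ.erase l).image F) := by
      intro F hF
      obtain ⟨S, hS, rfl⟩ := mem_image.1 hF
      exact mem_image.2 ⟨FS y S, Fintype.mem_piFinset.2 fun j => pm_sub hS (edgeAt_mem hS (hy j)).1, rfl⟩
    have h2 := (card_le_card h1).trans card_image_le
    rw [Fintype.card_piFinset, prod_const, card_univ, Fintype.card_fin] at h2
    exact_mod_cast h2
  have h5 : ∑ S ∈ pmSet U0 G, b (U0 \ (FF S).biUnion id) (S \ FF S) =
      ∑ F ∈ I, ∑ S ∈ (pmSet U0 G).filter (fun S => FF S = F), b (U0 \ F.biUnion id) (S \ F) := by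
    rw [← sum_fiberwise_of_maps_to (g := FF) (t := I) (fun S hS => mem_image_of_mem _ hS)]
    refine sum_congr rfl fun F _ => sum_congr rfl fun S hS => ?_
    rw [(mem_filter.1 hS).2]
  have h6 : ∀ F ∈ I, ∑ S ∈ (pmSet U0 G).filter (fun S => FF S = F), b (U0 \ F.biUnion id) (S \ F) ≤
      a * U0.card * pmCount (U0 \ F.biUnion id) G + U0.card * thr := by
    intro F hF
    have hp := hIp F hF
    have h7 : ∑ S ∈ (pmSet U0 G).filter (fun S => FF S = F), b (U0 \ F.biUnion id) (S \ F) ≤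
        ∑ S ∈ pmSet (U0 \ F.biUnion id) G, b (U0 \ F.biUnion id) S := by
      have hinj : Set.InjOn (fun S => S \ F) ((pmSet U0 G).filter (fun S => FF S = F) : Finset _) := by
        intro S hS S' hS' h
        rw [mem_coe, mem_filter] at hS hS'
        have e1 : F ⊆ S := hS.2 ▸ hFFS S hS.1
        have e2 : F ⊆ S' := hS'.2 ▸ hFFS S' hS'.1
        rw [← sdiff_union_of_subset e1, ← sdiff_union_of_subset e2]
        dsimp only at h
        rw [h]
      rw [← sum_image (f := fun S => b (U0 \ F.biUnion id) S) hinj]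
      refine sum_le_sum_of_subset_of_nonneg ?_ (fun _ _ _ => by simp only [b]; positivity)
      intro S hS
      obtain ⟨S', hS', rfl⟩ := mem_image.1 hS
      rw [mem_filter] at hS'
      exact pm_sdiff hne hS'.1 (hS'.2 ▸ hFFS S' hS'.1)
    refine h7.trans ?_
    rcases hN F hp.1 hp.2.1 hp.2.2.1 hp.2.2.2 with h8 | h8
    · have : 0 ≤ (U0.card : ℝ) * thr := by positivity
      simp only [b]; linarith
    · have h9 : ∑ S ∈ pmSet (U0 \ F.biUnion id) G, b (U0 \ F.biUnion id) S ≤ pmCount (U0 \ F.biUnion id) G * U0.card := by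
        rw [← nsmul_eq_mul]
        refine sum_le_card_nsmul _ _ _ fun S _ => ?_
        simp only [b]
        exact_mod_cast card_le_card ((filter_subset _ _).trans sdiff_subset)
      have h10 : (pmCount (U0 \ F.biUnion id) G : ℝ) * U0.card ≤ thr * U0.card :=
        mul_le_mul_of_nonneg_right h8 (by positivity)
      have h11 : 0 ≤ a * U0.card * (pmCount (U0 \ F.biUnion id) G : ℝ) := by positivity
      linarith
  rw [h5]
  have h7 := sum_le_sum h6
  rw [sum_add_distrib, ← mul_sum, hsum, sum_const, nsmul_eq_mul] at h7
  have h8 : (I.card : ℝ) * (U0.card * thr) ≤ (G.card : ℝ)^k * (U0.card * thr) :=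
    mul_le_mul_of_nonneg_right hIc (by positivity)
  have h9 : ((pmSet U0 G).card : ℝ) = pmCount U0 G := rfl
  rw [h9]
  linarith

theorem update_sum {ι : Type*} [Fintype ι] [DecidableEq ι] (U : Finset ℕ) (l : ι) (f : (ι → ℕ) → ℝ) :
    ∑ z ∈ Fintype.piFinset (fun _ : ι => U), ∑ v ∈ U, f (Function.update z l v) =
      U.card * ∑ z ∈ Fintype.piFinset (fun _ : ι => U), f z := by
  have h1 : (U.card : ℝ) * ∑ z ∈ Fintype.piFinset (fun _ : ι => U), f z =
      ∑ z ∈ Fintype.piFinset (fun _ : ι => U), ∑ v ∈ U, f z := by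
    simp [mul_sum]
  have hu : ∀ z ∈ Fintype.piFinset (fun _ : ι => U), ∀ v ∈ U, Function.update z l v ∈ Fintype.piFinset (fun _ : ι => U) := by
    intro z hz v hv
    rw [Fintype.mem_piFinset] at hz ⊢
    intro j
    by_cases hj : j = l
    · rw [hj, Function.update_self]; exact hv
    · rw [Function.update_of_ne hj]; exact hz j
  rw [h1, ← sum_product', ← sum_product']
  refine sum_bij' (fun q _ => (Function.update q.1 l q.2, q.1 l)) (fun q _ => (Function.update q.1 l q.2, q.1 l)) ?_ ?_ ?_ ?_ ?_
  · rintro ⟨z, v⟩ h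
    rw [mem_product] at h ⊢
    exact ⟨hu z h.1 v h.2, (Fintype.mem_piFinset.1 h.1) l⟩
  · rintro ⟨z, v⟩ h
    rw [mem_product] at h ⊢
    exact ⟨hu z h.1 v h.2, (Fintype.mem_piFinset.1 h.1) l⟩
  · rintro ⟨z, v⟩ h; simp
  · rintro ⟨z, v⟩ h; simp
  · rintro ⟨z, v⟩ h; simp

theorem restT_update (y : Fin k → ℕ) (l : Fin k) (v : ℕ) (S : Finset (Finset ℕ)) :
    restT (FS (Function.update y l v) S) l = restT (FS y S) l := by
  refine biUnion_congr rfl fun j hj => ?_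
  simp only [FS]
  rw [Function.update_of_ne (mem_erase.1 hj).1]

open scoped Classical in
theorem bad_pairs (X : ℝ)
    (hX : ∀ y ∈ Fintype.piFinset (fun _ : Fin k => U0), ∀ l,
      ∑ S ∈ pmSet U0 G, ((U0.filter (fun v => ¬ goodL U0 G P D ε3 κ y l S v)).card : ℝ) ≤ X * U0.card)
    (hU : 0 < U0.card) :
    ∑ y ∈ Fintype.piFinset (fun _ : Fin k => U0),
      (((pmSet U0 G).filter (fun S => ¬ goodS U0 G P D ε3 κ y S)).card : ℝ) ≤ k * ((U0.card : ℝ) ^ k * X) := by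
  let f : Fin k → (Fin k → ℕ) → ℝ := fun l y => ∑ S ∈ pmSet U0 G, if goodL U0 G P D ε3 κ y l S (y l) then 0 else 1
  have h1 : ∀ l, ∑ y ∈ Fintype.piFinset (fun _ : Fin k => U0), f l y ≤ (U0.card : ℝ) ^ k * X := by
    intro l
    have h2 := update_sum U0 l (f l)
    have h3 : ∀ y ∈ Fintype.piFinset (fun _ : Fin k => U0), ∑ v ∈ U0, f l (Function.update y l v) ≤ X * U0.card := by
      intro y hy
      refine le_trans (le_of_eq ?_) (hX y hy l)
      simp only [f]
      rw [sum_comm]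
      refine sum_congr rfl fun S _ => ?_
      rw [card_filter]
      push_cast
      refine sum_congr rfl fun v _ => ?_
      have : goodL U0 G P D ε3 κ (Function.update y l v) l S (Function.update y l v l) ↔ goodL U0 G P D ε3 κ y l S v := by
        unfold goodL
        rw [restT_update, Function.update_self]
      by_cases h : goodL U0 G P D ε3 κ y l S v
      · rw [if_pos (this.2 h), if_neg (not_not.2 h)]
      · rw [if_neg (fun h' => h (this.1 h')), if_pos h]
    have h4 := sum_le_card_nsmul _ _ _ h3
    rw [h2, nsmul_eq_mul, Fintype.card_piFinset, prod_const, card_univ, Fintype.card_fin] at h4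
    push_cast at h4
    have hU' : (0:ℝ) < U0.card := by exact_mod_cast hU
    have h5 : (U0.card : ℝ) * ∑ y ∈ Fintype.piFinset (fun _ : Fin k => U0), f l y ≤ U0.card * ((U0.card : ℝ) ^ k * X) := by
      linarith
    exact le_of_mul_le_mul_left h5 hU'
  have h2 : ∀ y ∈ Fintype.piFinset (fun _ : Fin k => U0),
      (((pmSet U0 G).filter (fun S => ¬ goodS U0 G P D ε3 κ y S)).card : ℝ) ≤ ∑ l, f l y := by
    intro y _
    simp only [f]
    rw [sum_comm, card_filter]
    push_cast
    refine sum_le_sum fun S _ => ?_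
    split_ifs with h
    · exact sum_nonneg fun _ _ => by positivity
    · unfold goodS at h
      rw [not_forall] at h
      obtain ⟨l, hl⟩ := h
      refine le_trans ?_ (single_le_sum (f := fun l => if goodL U0 G P D ε3 κ y l S (y l) then (0:ℝ) else 1) (fun _ _ => by positivity) (mem_univ l))
      have hl' : ¬ goodL U0 G P D ε3 κ y l S (y l) := hl
      simp only [hl', if_false]; exact le_rfl
  refine (sum_le_sum h2).trans ?_
  rw [sum_comm]
  refine (sum_le_sum fun l _ => h1 l).trans ?_
  rw [sum_const, card_univ, Fintype.card_fin, nsmul_eq_mul]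

open scoped Classical in
/-- many tuples satisfy `evB` -/
theorem many_evB (hr : ∀ f ∈ G, f.card = r) (hr2 : 2 ≤ r) (hx : x ∉ U0) (hG : G = W ∪ P)
    (hcod : ∀ u ∈ U0, ∀ v ∈ U0, u ≠ v → (G.filter (fun f => u ∈ f ∧ v ∈ f)).card ≤ C)
    (h3 : 0 < ε3) (hD : 0 < D) (hη : 0 < η) (hκ : κ / 8 * D + k * (r * C) ≤ κ / 4 * D)
    (hΦ : 0 < pmCount U0 G) (ε' β c : ℝ) (hβ : 0 ≤ β)
    (hX : ∀ y ∈ Fintype.piFinset (fun _ : Fin k => U0), ∀ l,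
      ∑ S ∈ pmSet U0 G, ((U0.filter (fun v => ¬ goodL U0 G P D ε3 (κ/8) y l S v)).card : ℝ) ≤ (ε' * pmCount U0 G) * U0.card)
    (hU : 0 < U0.card) (hε' : 2 * k * ε' ≤ β ^ k / 2) (hc : 512 / ε3 ^ 3 / η * (k * c) ≤ 1 / 2)
    (hB : β * U0.card ≤ (U0.filter (fun v => (pmCount (insert x (U0.erase v)) G : ℝ) < c * pmCount U0 G)).card) :
    β ^ k / 2 * (U0.card : ℝ) ^ k ≤ ((Fintype.piFinset (fun _ : Fin k => U0)).filter (fun y =>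
      evB U0 x y (powersetCard (r-1) (U0 \ univ.image y)) G κ η D (512 / ε3 ^ 2) W)).card := by
  set B := U0.filter (fun v => (pmCount (insert x (U0.erase v)) G : ℝ) < c * pmCount U0 G) with hBd
  set A := Fintype.piFinset (fun _ : Fin k => B) with hA
  have hAU : A ⊆ Fintype.piFinset (fun _ : Fin k => U0) := Fintype.piFinset_subset _ _ fun _ => filter_subset _ _
  set ev : (Fin k → ℕ) → Prop := fun y => evB U0 x y (powersetCard (r-1) (U0 \ univ.image y)) G κ η D (512 / ε3 ^ 2) W with hev
  have hΦ' : (0:ℝ) < pmCount U0 G := by exact_mod_cast hΦ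
  have h1 := bad_pairs (ε' * pmCount U0 G) hX hU
  have h2 : ∀ y ∈ A.filter (fun y => ¬ ev y), (pmCount U0 G : ℝ) / 2 ≤
      (((pmSet U0 G).filter (fun S => ¬ goodS U0 G P D ε3 (κ/8) y S)).card : ℝ) := by
    intro y hy
    rw [mem_filter] at hy
    have h4 := good_count hr hr2 hx hG hcod h3 hD hη hκ hy.2
    have h5 : ∑ l, (pmCount (insert x (U0.erase (y l))) G : ℝ) ≤ k * (c * pmCount U0 G) := by
      refine (sum_le_card_nsmul _ _ (c * pmCount U0 G) fun l _ => ?_).trans (le_of_eq (by simp))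
      have := (Fintype.mem_piFinset.1 hy.1) l
      rw [hBd, mem_filter] at this
      exact this.2.le
    have h6 : 512 / ε3 ^ 3 / η * ∑ l, (pmCount (insert x (U0.erase (y l))) G : ℝ) ≤ 512 / ε3 ^ 3 / η * (k * (c * pmCount U0 G)) :=
      mul_le_mul_of_nonneg_left h5 (by positivity)
    have h7 : 512 / ε3 ^ 3 / η * (k * (c * pmCount U0 G)) ≤ 1/2 * pmCount U0 G := by
      have := mul_le_mul_of_nonneg_right hc hΦ'.le
      linarith
    have h8 := card_filter_add_card_filter_not (s := pmSet U0 G) (goodS U0 G P D ε3 (κ/8) y)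
    have h9 : (((pmSet U0 G).filter (goodS U0 G P D ε3 (κ/8) y)).card : ℝ) + ((pmSet U0 G).filter (fun S => ¬ goodS U0 G P D ε3 (κ/8) y S)).card = pmCount U0 G := by
      exact_mod_cast h8
    linarith
  have h4 := (card_nsmul_le_sum _ _ _ h2).trans (sum_le_sum_of_subset_of_nonneg ((filter_subset _ _).trans hAU) (fun _ _ _ => by positivity))
  have h5 := h4.trans h1
  rw [nsmul_eq_mul] at h5
  have h6 : ((A.filter (fun y => ¬ ev y)).card : ℝ) ≤ β^k / 2 * (U0.card : ℝ) ^ k := by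
    have h7 : ((A.filter (fun y => ¬ ev y)).card : ℝ) ≤ 2 * k * ε' * (U0.card : ℝ) ^ k := by
      have : ((A.filter (fun y => ¬ ev y)).card : ℝ) * pmCount U0 G ≤ (2 * k * ε' * (U0.card : ℝ) ^ k) * pmCount U0 G := by
        linarith
      exact le_of_mul_le_mul_right this hΦ'
    exact h7.trans (mul_le_mul_of_nonneg_right hε' (by positivity))
  have h7 : β^k * (U0.card : ℝ)^k ≤ A.card := by
    rw [hA, Fintype.card_piFinset, prod_const, card_univ, Fintype.card_fin, ← mul_pow]
    push_cast
    exact pow_le_pow_left₀ (by positivity) hB k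
  have h8 := card_filter_add_card_filter_not (s := A) ev
  have h9 : ((A.filter ev).card : ℝ) + (A.filter (fun y => ¬ ev y)).card = A.card := by exact_mod_cast h8
  have h10 : ((A.filter ev).card : ℝ) ≤ ((Fintype.piFinset (fun _ : Fin k => U0)).filter ev).card := by
    exact_mod_cast card_le_card (filter_subset_filter _ hAU)
  linarith

end evB4

section swapfin

def Wok (C : ℕ) (a : ℝ) (W : Finset (Finset ℕ)) : Prop :=
  (∀ u v : ℕ, u ≠ v → (W.filter (fun f => u ∈ f ∧ v ∈ f)).card ≤ C) ∧ (W.card : ℝ) ≤ a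

def Mat (P : Finset (Finset ℕ)) : Prop := ∀ A ∈ P, ∀ B ∈ P, A ≠ B → A ∩ B = ∅

theorem TT_congr {k : ℕ} {U0 : Finset ℕ} {G G' L : Finset (Finset ℕ)} {K : ℝ} {y : Fin k → ℕ}
    (h : ∀ U, U ⊆ U0 \ univ.image y → pmCount U G = pmCount U G') (T0 : Fin k → Finset ℕ) (l : Fin k) :
    TT U0 G L K y T0 l = TT U0 G' L K y T0 l := by
  unfold TT
  have hs : ∀ t, (U0 \ restT (insT y T0) l) \ insert (y l) t ⊆ U0 \ univ.image y := by
    intro t v hv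
    rw [mem_sdiff, mem_sdiff] at hv
    refine mem_sdiff.2 ⟨hv.1.1, fun h => ?_⟩
    obtain ⟨j, _, rfl⟩ := mem_image.1 h
    by_cases hj : j = l
    · subst hj; exact hv.2 (mem_insert_self _ _)
    · exact hv.1.2 (mem_restT.2 ⟨j, hj, mem_insert_self _ _⟩)
  refine filter_congr fun t _ => ?_
  rw [h _ (hs _), h _ (hs _)]

theorem evB_pr {n r k : ℕ} {Z : Finset ℕ} {x : ℕ} (hr : 1 ≤ r) (hZ : Z ⊆ range n) (hZc : Z.card = r) (hx : x ∈ Z)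
    (y : Fin k → ℕ) (hyU : ∀ l, y l ∈ range n \ Z) (P : Finset (Finset ℕ))
    {p D κ θ η K : ℝ} (hp : 0 ≤ p) (hp1 : p ≤ 1) (hD : 0 ≤ D) (hκ : 0 ≤ κ) (hκ1 : κ ≤ 1/2) (hθ : 0 ≤ θ)
    (hK : 1 ≤ K)
    (hL1 : p * ((n - r - k).choose (r-1) : ℕ) ≤ D) (hL2 : (1 - κ) * D ≤ p * ((n - r - k).choose (r-1) : ℕ)) :
    Pr (Kn n r) p (fun W => evB (range n \ Z) x y (powersetCard (r-1) ((range n \ Z) \ univ.image y)) (W ∪ P) κ η D K W) ≤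
    D ^ k * (k * Real.exp (θ * (η * D) - (1 - Real.exp (-θ)) * ((1 - 2 * κ) * D)) +
      Real.exp (-(k * κ * D / 16))) := by
  classical
  set U0 := range n \ Z with hU0
  set L := powersetCard (r-1) (U0 \ univ.image y) with hL
  by_cases hy : Function.Injective y
  swap
  · refine (Pr_le_Ex hp hp1 (f := fun _ => 0) (fun _ _ => le_rfl) (fun W _ h => ?_)).trans ?_
    · exfalso
      obtain ⟨T0, _, hQ, _⟩ := h
      refine hy fun i j hij => ?_
      by_contra hne
      have h1 := (hQ i).2 (mem_insert_self _ _)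
      refine (mem_sdiff.1 h1).2 (mem_restT.2 ⟨j, fun h => hne h.symm, ?_⟩)
      rw [insT, hij]; exact mem_insert_self _ _
    · rw [Ex_const]; positivity
  have hxU : x ∉ U0 := fun h => (mem_sdiff.1 h).2 hx
  have hxy : ∀ l, x ≠ y l := fun l h => hxU (h ▸ hyU l)
  have hLc : L.card = (n - r - k).choose (r-1) := by
    rw [hL, card_powersetCard, card_sdiff_of_subset, card_sdiff_of_subset hZ, card_image_of_injective _ hy,
      card_range, hZc, card_univ, Fintype.card_fin]
    intro v hv
    obtain ⟨j, _, rfl⟩ := mem_image.1 hv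
    exact hyU j
  have hLx : ∀ t ∈ L, x ∉ t := fun t ht h => hxU (mem_sdiff.1 ((mem_powersetCard.1 ht).1 h)).1
  have hLy : ∀ t ∈ L, ∀ l, y l ∉ t := fun t ht l h =>
    (mem_sdiff.1 ((mem_powersetCard.1 ht).1 h)).2 (mem_image_of_mem y (mem_univ l))
  set E1 := (Kn n r).filter (fun f => x ∈ f ∨ ∃ l, y l ∈ f) with hE1
  have hmemK : ∀ t ∈ L, ∀ v ∈ range n, v ∉ t → insert v t ∈ Kn n r := by
    intro t ht v hv hvt
    have := mem_powersetCard.1 ht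
    refine mem_powersetCard.2 ⟨insert_subset hv (this.1.trans (sdiff_subset.trans sdiff_subset)), ?_⟩
    rw [card_insert_of_notMem hvt, this.2]; omega
  have hEx : ∀ t ∈ L, insert x t ∈ E1 := fun t ht =>
    mem_filter.2 ⟨hmemK t ht x (hZ hx) (hLx t ht), Or.inl (mem_insert_self _ _)⟩
  have hEy : ∀ t ∈ L, ∀ l, insert (y l) t ∈ E1 := fun t ht l =>
    mem_filter.2 ⟨hmemK t ht (y l) (mem_sdiff.1 (hyU l)).1 (hLy t ht l), Or.inr ⟨l, mem_insert_self _ _⟩⟩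
  refine Pr_cond (E1 := E1) (filter_subset _ _) hp hp1 _ _ fun W0 hW0 => ?_
  have hTQ : ∀ T0, QQ U0 L y T0 → ∀ l, T0 l ∈ TT U0 (W0 ∪ P) L K y T0 l := by
    intro T0 h l
    refine mem_filter.2 ⟨(h l).1, (h l).2, ?_⟩
    nlinarith [Nat.cast_nonneg (α := ℝ) (pmCount ((U0 \ restT (insT y T0) l) \ insert (y l) (T0 l)) (W0 ∪ P))]
  have main := evB_prob x y hy hxy L E1 hLx hLy hEx hEy hp hp1 hD hκ hκ1 hθ (η := η)
    (by rw [hLc]; exact hL1) (by rw [hLc]; exact hL2) (TT U0 (W0 ∪ P) L K y) (QQ U0 L y)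
    (fun T0 l => filter_subset _ _) hTQ
  refine (Pr_mono hp hp1 ?_).trans main
  intro W1 hW1 h
  have hout : ∀ f ∈ E1, (f ∈ W0 ∪ W1 ↔ f ∈ W1) := by
    intro f hf
    rw [mem_union]
    refine ⟨fun h => h.resolve_left fun h' => ?_, Or.inr⟩
    exact (mem_sdiff.1 (hW0 h')).2 hf
  have hcong : ∀ U, U ⊆ U0 \ univ.image y → pmCount U (W0 ∪ W1 ∪ P) = pmCount U (W0 ∪ P) := by
    intro U hU
    refine pmCount_congr fun f hf => ?_
    have : f ∉ W1 := by
      intro h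
      have h1 := (mem_filter.1 (hW1 h)).2
      rcases h1 with h1 | ⟨l, h1⟩
      · exact hxU (mem_sdiff.1 (hU (hf h1))).1
      · exact (mem_sdiff.1 (hU (hf h1))).2 (mem_image_of_mem y (mem_univ l))
    simp only [mem_union, this, or_false]
  obtain ⟨T0, hT0, hQ, hin, hor⟩ := h
  have hT0' := Fintype.mem_piFinset.1 hT0
  refine ⟨T0, hT0, hQ, fun l => (hout _ (hEy _ (hT0' l) l)).1 (hin l), ?_⟩
  simp only [TT_congr hcong] at hor
  rcases hor with ⟨l, h1, h2⟩ | h1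
  · left
    refine ⟨l, h1, le_of_eq_of_le ?_ h2⟩
    congr 2
    refine filter_congr fun t ht => (hout _ (hEx t (mem_filter.1 ht).1)).symm
  · right
    intro l
    refine ⟨(h1 l).1, le_of_eq_of_le ?_ (h1 l).2⟩
    congr 2
    refine filter_congr fun t ht => (hout _ (hEy t (mem_sdiff.1 ht).1 l)).symm

theorem mat_card {n m r : ℕ} (hr : 1 ≤ r) (hn : n = m * r) {P : Finset (Finset ℕ)} (hP : P ⊆ Kn n r) (hM : Mat P) : P.card ≤ m := by
  have h1 : (P.biUnion id).card = P.card * r := by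
    rw [card_biUnion (t := id) (fun A hA B hB h => disjoint_iff_inter_eq_empty.2 (hM A hA B hB h))]
    exact (sum_congr rfl (g := fun _ => r) (fun f hf => (mem_powersetCard.1 (hP hf)).2)).trans (by simp)
  have h2 : (P.biUnion id).card ≤ n := by
    rw [← card_range n]
    exact card_le_card (biUnion_subset.2 fun f hf => (mem_powersetCard.1 (hP hf)).1)
  rw [h1, hn] at h2
  exact Nat.le_of_mul_le_mul_right h2 hr

theorem cod_union {C : ℕ} {a : ℝ} {W P : Finset (Finset ℕ)} (hW : Wok C a W) (hM : Mat P) (u v : ℕ) (huv : u ≠ v) :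
    ((W ∪ P).filter (fun f => u ∈ f ∧ v ∈ f)).card ≤ C + 1 := by
  rw [filter_union]
  refine (card_union_le _ _).trans (Nat.add_le_add (hW.1 u v huv) ?_)
  refine card_le_one.2 fun A hA B hB => ?_
  rw [mem_filter] at hA hB
  by_contra hne
  have := hM A hA.1 B hB.1 hne
  have h2 : u ∈ A ∩ B := mem_inter.2 ⟨hA.2.1, hB.2.1⟩
  rw [this] at h2; simp at h2

open scoped Classical in
theorem swap_fin {n r k m C : ℕ} (hr : 2 ≤ r) (hn : n = m * r) {D ε3 κ θ η δ0 ε' β c p : ℝ} (h3 : 0 < ε3)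
    (hD : 0 < D) (hκ : 0 < κ) (hκ1 : κ ≤ 1/2) (hθ : 0 ≤ θ) (hη : 0 < η) (h31 : ε3 ≤ 1) (hβ : 0 < β) (hε'0 : 0 < ε')
    (hbad : ∀ (U : Finset ℕ) (H : Finset (Finset ℕ)) (m' : ℕ),
      Nice U H r (C+1) m' D (ε3/32) → ∀ P : Finset (Finset ℕ), P.card ≤ 2 * m' →
      (∑ S ∈ pmSet U H, ((U.filter (fun y => badV U H P D ε3 (κ/8) (edgeAt S y) y)).card : ℝ)) ≤
        4 * ε3 / (κ/8) * U.card * pmCount U H)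
    (hedge : (1 + δ0) * m * D + m ≤ (1 + ε3/32) * ((m:ℝ) - 1 - k) * D)
    (hlog : 0 ≤ Real.log D - (r-1) - ε3/32)
    (hneg : ((n:ℝ)^r)^k * Real.exp (m * (Real.log D - (r-1) - ε3/32)) ≤ ε'/4 * Real.exp (m * (Real.log D - (r-1)) - δ0 * n))
    (hkr : (k:ℝ) * r ≤ ε'/4 * ((n:ℝ) - r)) (ha : 4 * ε3 / (κ/8) ≤ ε'/2)
    (hκD : κ / 8 * D + k * (r * (C + 1)) ≤ κ / 4 * D) (hk2 : 2 * (k + 1) ≤ m)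
    (hε' : 2 * k * ε' ≤ β ^ k / 2) (hc : 512 / ε3 ^ 3 / η * (k * c) ≤ 1 / 2)
    (hp : 0 ≤ p) (hp1 : p ≤ 1)
    (hL1 : p * ((n - r - k).choose (r-1) : ℕ) ≤ D) (hL2 : (1 - κ) * D ≤ p * ((n - r - k).choose (r-1) : ℕ))
    {P : Finset (Finset ℕ)} (hP : P ⊆ Kn n r) (hM : Mat P) {Z : Finset ℕ} {x : ℕ} (hZ : Z ⊆ range n) (hZc : Z.card = r) (hx : x ∈ Z) :
    Pr (Kn n r) p (fun W => Wok C ((1 + δ0) * m * D) W ∧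
      Real.exp (m * (Real.log D - (r-1)) - δ0 * n) ≤ pmCount (range n \ Z) (W ∪ P) ∧
      β * n ≤ (((range n \ Z).filter (fun v => (pmCount (insert x ((range n \ Z).erase v)) (W ∪ P) : ℝ) <
        c * pmCount (range n \ Z) (W ∪ P))).card : ℝ)) ≤
    2 / β ^ k * (D ^ k * (k * Real.exp (θ * (η * D) - (1 - Real.exp (-θ)) * ((1 - 2 * κ) * D)) +
      Real.exp (-(k * κ * D / 16)))) := by
  set U0 := range n \ Z with hU0
  set q := D ^ k * (k * Real.exp (θ * (η * D) - (1 - Real.exp (-θ)) * ((1 - 2 * κ) * D)) +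
      Real.exp (-(k * κ * D / 16))) with hq
  have hxU : x ∉ U0 := fun h => (mem_sdiff.1 h).2 hx
  have hmr : (m - 1) * r = n - r := by rw [hn, Nat.sub_mul, one_mul]
  have hUc : U0.card = (m - 1) * r := by
    rw [hU0, card_sdiff_of_subset hZ, card_range, hZc, hmr]
  have hUpos : 0 < U0.card := by
    rw [hUc]; exact Nat.mul_pos (by omega) (by omega)
  have hUn : U0.card ≤ n := by rw [hUc, hmr]; omega
  have hUr : (U0.card : ℝ) = n - r := by
    rw [hUc, hmr, Nat.cast_sub]
    rw [hn]; exact Nat.le_mul_of_pos_left r (by omega)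
  have hmark := Pr_markov (Fintype.piFinset (fun _ : Fin k => U0)) (E := Kn n r) hp hp1
    (fun y W => evB U0 x y (powersetCard (r-1) (U0 \ univ.image y)) (W ∪ P) κ η D (512 / ε3 ^ 2) W) q
    (fun y hy => evB_pr (by omega) hZ hZc hx y (Fintype.mem_piFinset.1 hy) P hp hp1 hD.le hκ.le hκ1 hθ
      (by rw [le_div_iff₀ (by positivity)]; nlinarith) hL1 hL2)
    (β ^ k / 2 * (U0.card : ℝ) ^ k) (by positivity)
    (fun W => Wok C ((1 + δ0) * m * D) W ∧
      Real.exp (m * (Real.log D - (r-1)) - δ0 * n) ≤ pmCount U0 (W ∪ P) ∧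
      β * n ≤ ((U0.filter (fun v => (pmCount (insert x (U0.erase v)) (W ∪ P) : ℝ) <
        c * pmCount U0 (W ∪ P))).card : ℝ)) ?_
  · refine hmark.trans (le_of_eq ?_)
    rw [Fintype.card_piFinset, prod_const, card_univ, Fintype.card_fin]
    push_cast
    field_simp
  rintro W hWK ⟨hW, hΦ, hB⟩
  set G := W ∪ P with hG
  have hGK : G ⊆ Kn n r := union_subset hWK hP
  have hGr : ∀ f ∈ G, f.card = r := fun f hf => (mem_powersetCard.1 (hGK hf)).2
  have hcod : ∀ u ∈ U0, ∀ v ∈ U0, u ≠ v → (G.filter (fun f => u ∈ f ∧ v ∈ f)).card ≤ C + 1 :=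
    fun u _ v _ h => cod_union hW hM u v h
  have hΦpos : 0 < pmCount U0 G := by
    have := lt_of_lt_of_le (Real.exp_pos _) hΦ
    exact_mod_cast this
  have hGc : (G.card : ℝ) ≤ (1 + δ0) * m * D + m := by
    have h1 : (G.card : ℝ) ≤ W.card + P.card := by exact_mod_cast card_union_le _ _
    have h2 : (P.card : ℝ) ≤ m := by exact_mod_cast mat_card (by omega) hn hP hM
    linarith [hW.2]
  have hGn : (G.card : ℝ) ≤ (n:ℝ)^r := by
    have h1 := card_le_card hGK
    rw [Kn, card_powersetCard, card_range] at h1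
    exact_mod_cast h1.trans (Nat.choose_le_pow n r)
  set thr := Real.exp (m * (Real.log D - (r-1) - ε3/32)) with hthr
  have hX : ∀ y ∈ Fintype.piFinset (fun _ : Fin k => U0), ∀ l,
      ∑ S ∈ pmSet U0 G, ((U0.filter (fun v => ¬ goodL U0 G P D ε3 (κ/8) y l S v)).card : ℝ) ≤ (ε' * pmCount U0 G) * U0.card := by
    intro y hy l
    have h1 := bad_l (P := P) (D := D) (ε3 := ε3) (κ := κ/8) hGr hr (Fintype.mem_piFinset.1 hy) l (4 * ε3 / (κ/8)) thr (by positivity) (Real.exp_pos _).le ?_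
    · refine h1.trans ?_
      have h2 : (G.card : ℝ)^k * thr ≤ ε'/4 * pmCount U0 G := by
        have e1 : (G.card : ℝ)^k * thr ≤ ((n:ℝ)^r)^k * thr :=
          mul_le_mul_of_nonneg_right (pow_le_pow_left₀ (by positivity) hGn k) (Real.exp_pos _).le
        have e2 : ε'/4 * Real.exp (m * (Real.log D - (r-1)) - δ0 * n) ≤ ε'/4 * pmCount U0 G :=
          mul_le_mul_of_nonneg_left hΦ (by positivity)
        linarith
      rw [← hUr] at hkr
      have h4 : 4 * ε3 / (κ/8) * U0.card ≤ ε'/2 * U0.card := mul_le_mul_of_nonneg_right ha (by positivity)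
      have h5 : (k * r + 4 * ε3 / (κ/8) * U0.card) * pmCount U0 G ≤ (ε'/4 * U0.card + ε'/2 * U0.card) * pmCount U0 G :=
        mul_le_mul_of_nonneg_right (by linarith) (by positivity)
      have h6 : (U0.card : ℝ) * ((G.card : ℝ)^k * thr) ≤ U0.card * (ε'/4 * pmCount U0 G) :=
        mul_le_mul_of_nonneg_left h2 (by positivity)
      linarith
    · intro F hFG hFk hFd hFU
      by_cases hlarge : (pmCount (U0 \ F.biUnion id) G : ℝ) ≤ thr
      · exact Or.inr hlarge
      left
      rw [not_le] at hlarge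
      have hFc : (F.biUnion id).card = F.card * r := by
        rw [card_biUnion (t := id) (fun A hA B hB h => disjoint_iff_inter_eq_empty.2 (hFd A hA B hB h))]
        exact (sum_congr rfl (g := fun _ => r) (fun f hf => hGr f (hFG hf))).trans (by simp)
      have hm' : ((m - 1 - F.card : ℕ) : ℝ) = m - 1 - F.card := by
        rw [Nat.cast_sub (by omega), Nat.cast_sub (by omega)]; simp
      have hFk' : (F.card : ℝ) ≤ k := by exact_mod_cast hFk
      have hN : Nice (U0 \ F.biUnion id) G r (C+1) (m - 1 - F.card) D (ε3/32) := by
        refine ⟨by omega, ?_, hGr, ?_, ?_, ?_⟩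
        · rw [card_sdiff_of_subset hFU, hFc, hUc, ← Nat.sub_mul]
        · intro u hu v hv huv
          refine (card_le_card ?_).trans (hcod u (mem_sdiff.1 hu).1 v (mem_sdiff.1 hv).1 huv)
          intro f hf
          rw [mem_filter] at hf ⊢
          exact ⟨hf.1, hf.2.2⟩
        · have h1 : ((G.filter (fun f => f ⊆ U0 \ F.biUnion id)).card : ℝ) ≤ G.card := by
            exact_mod_cast card_le_card (filter_subset _ _)
          refine h1.trans (hGc.trans (hedge.trans ?_))
          rw [hm']
          refine mul_le_mul_of_nonneg_right (mul_le_mul_of_nonneg_left (by linarith) (by positivity)) hD.le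
        · refine le_trans (Real.exp_le_exp.2 ?_) hlarge.le
          refine mul_le_mul_of_nonneg_right ?_ hlog
          rw [hm']
          linarith [Nat.cast_nonneg (α := ℝ) F.card]
      have hPc := mat_card (by omega) hn hP hM
      refine (hbad _ G _ hN P (by omega)).trans ?_
      refine mul_le_mul_of_nonneg_right (mul_le_mul_of_nonneg_left ?_ (by positivity)) (by positivity)
      exact_mod_cast card_le_card sdiff_subset
  refine ⟨(Fintype.piFinset (fun _ : Fin k => U0)).filter (fun y =>
      evB U0 x y (powersetCard (r-1) (U0 \ univ.image y)) G κ η D (512 / ε3 ^ 2) W), filter_subset _ _, ?_, fun y hy => (mem_filter.1 hy).2⟩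
  refine many_evB hGr hr hxU hG hcod h3 hD hη (by push_cast; exact hκD) hΦpos ε' β c hβ.le hX hUpos hε' hc ?_
  refine le_trans ?_ hB
  exact mul_le_mul_of_nonneg_left (by exact_mod_cast hUn) hβ.le

end swapfin


noncomputable def DD (ε : ℝ) (n : ℕ) : ℝ := (1 + ε) * Real.log n
noncomputable def pp (r : ℕ) (ε : ℝ) (n : ℕ) : ℝ := DD ε n / (((n-1).choose (r-1) : ℕ) : ℝ)

open Filter Topology in
theorem log_tendsto : Tendsto (fun n : ℕ => Real.log n) atTop atTop :=
  Real.tendsto_log_atTop.comp tendsto_natCast_atTop_atTop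

open Filter Topology in
theorem DD_tendsto {ε : ℝ} (hε : 0 < ε) : Tendsto (DD ε) atTop atTop :=
  Tendsto.const_mul_atTop (by linarith) log_tendsto

open Filter Topology in
theorem ev_pow_exp (A γ : ℝ) (hγ : 0 < γ) (k : ℕ) (τ : ℝ) (hτ : 0 < τ) :
    ∀ᶠ n : ℕ in atTop, A * ((n:ℝ)^k * Real.exp (-(γ * n))) ≤ τ := by
  have h1 : Tendsto (fun x : ℝ => x^k * Real.exp (-x)) atTop (𝓝 0) := Real.tendsto_pow_mul_exp_neg_atTop_nhds_zero k
  have h2 : Tendsto (fun n : ℕ => γ * (n:ℝ)) atTop atTop := Tendsto.const_mul_atTop hγ tendsto_natCast_atTop_atTop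
  have h3 := (h1.comp h2).const_mul (A / γ^k)
  rw [mul_zero] at h3
  filter_upwards [h3.eventually_lt_const hτ] with n hn
  simp only [Function.comp] at hn
  have : A * ((n:ℝ)^k * Real.exp (-(γ * n))) = A / γ^k * ((γ * n)^k * Real.exp (-(γ * n))) := by
    rw [mul_pow]; field_simp
  rw [this]; exact hn.le

open Filter Topology in
theorem ev_log_exp (A γ : ℝ) (hγ : 0 < γ) (k : ℕ) (τ : ℝ) (hτ : 0 < τ) :
    ∀ᶠ n : ℕ in atTop, A * ((Real.log n)^k * Real.exp (-((1 + γ) * Real.log n))) ≤ τ / n := by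
  have h1 : Tendsto (fun x : ℝ => x^k * Real.exp (-x)) atTop (𝓝 0) := Real.tendsto_pow_mul_exp_neg_atTop_nhds_zero k
  have h2 : Tendsto (fun n : ℕ => γ * Real.log n) atTop atTop := Tendsto.const_mul_atTop hγ log_tendsto
  have h3 := (h1.comp h2).const_mul (A / γ^k)
  rw [mul_zero] at h3
  filter_upwards [h3.eventually_lt_const hτ, eventually_gt_atTop 0] with n hn hn0
  simp only [Function.comp] at hn
  have hn0' : (0:ℝ) < n := by exact_mod_cast hn0
  have : A * ((Real.log n)^k * Real.exp (-((1+γ) * Real.log n))) =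
      (A / γ^k * ((γ * Real.log n)^k * Real.exp (-(γ * Real.log n)))) / n := by
    rw [mul_pow, show -((1+γ) * Real.log n) = -(γ * Real.log n) + -Real.log n by ring, Real.exp_add,
      Real.exp_neg (Real.log n), Real.exp_log hn0']
    field_simp
  rw [this]
  exact div_le_div_of_nonneg_right hn.le hn0'.le

open Filter in
theorem ev_nat_ge (A : ℝ) : ∀ᶠ n : ℕ in atTop, A ≤ n := tendsto_natCast_atTop_atTop.eventually_ge_atTop A

open Filter in
theorem ev_choose (a j : ℕ) (κ : ℝ) (hκ : 0 < κ) :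
    ∀ᶠ n : ℕ in atTop, (1 - κ) * ((n-1).choose j : ℕ) ≤ (((n - a).choose j : ℕ) : ℝ) := by
  filter_upwards [ev_nat_ge (j * (a + j) / κ), ev_nat_ge (a + j + 1)] with n h1 h2
  have hn : a + j + 1 ≤ n := by exact_mod_cast h2
  have hn0 : (0:ℝ) < n := by exact_mod_cast (by omega : 0 < n)
  have hj : (0:ℝ) < (j.factorial : ℕ) := by exact_mod_cast j.factorial_pos
  have e1 : (((n-a).choose j : ℕ):ℝ) * (j.factorial:ℕ) = ((n-a).descFactorial j : ℕ) := by
    rw [Nat.descFactorial_eq_factorial_mul_choose]; push_cast; ring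
  have e2 : (((n-1).choose j : ℕ):ℝ) * (j.factorial:ℕ) = ((n-1).descFactorial j : ℕ) := by
    rw [Nat.descFactorial_eq_factorial_mul_choose]; push_cast; ring
  have l1 : ((n:ℝ) - (a + j)) ^ j ≤ ((n-a).descFactorial j : ℕ) := by
    have := Nat.pow_sub_le_descFactorial (n-a) j
    have h3 : ((n - a + 1 - j : ℕ) : ℝ) = n - a + 1 - j := by
      rw [Nat.cast_sub (by omega)]; push_cast [Nat.cast_sub (show a ≤ n by omega)]; ring
    calc ((n:ℝ) - (a + j)) ^ j ≤ ((n - a + 1 - j : ℕ) : ℝ)^j := by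
          refine pow_le_pow_left₀ ?_ ?_ _
          · linarith
          · rw [h3]; linarith
      _ ≤ _ := by exact_mod_cast this
  have l2 : (((n-1).descFactorial j : ℕ):ℝ) ≤ (n:ℝ)^j := by
    calc (((n-1).descFactorial j : ℕ):ℝ) ≤ ((n-1:ℕ):ℝ)^j := by exact_mod_cast Nat.descFactorial_le_pow _ _
      _ ≤ _ := by gcongr; omega
  have l3 : (1 - κ) * (n:ℝ)^j ≤ ((n:ℝ) - (a + j)) ^ j := by
    have hb := one_add_mul_le_pow (a := -((a+j:ℝ)/n)) (by
      have : ((a+j:ℝ)/n) ≤ 1 := by rw [div_le_one hn0]; linarith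
      linarith) j
    have h4 : (j:ℝ) * ((a+j)/n) ≤ κ := by
      rw [div_le_iff₀ hκ] at h1
      rw [← mul_div_assoc, div_le_iff₀ hn0]; linarith
    have h5 : ((n:ℝ) - (a + j)) ^ j = (1 + -((a+j:ℝ)/n))^j * (n:ℝ)^j := by
      rw [← mul_pow]; congr 1; field_simp; ring
    rw [h5]
    refine mul_le_mul_of_nonneg_right (le_trans ?_ hb) (by positivity)
    linarith
  by_cases hk1 : κ ≤ 1
  · refine le_of_mul_le_mul_right ?_ hj
    rw [e1, mul_assoc, e2]
    exact (mul_le_mul_of_nonneg_left l2 (by linarith)).trans (l3.trans l1)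
  · have : (1 - κ) * ((n-1).choose j : ℕ) ≤ 0 := mul_nonpos_of_nonpos_of_nonneg (by linarith) (by positivity)
    exact this.trans (by positivity)

open Filter in
/-- lower bound for the normalizing binomial coefficient -/
theorem ev_choose_pow (r : ℕ) : ∀ᶠ n : ℕ in atTop,
    (n:ℝ)^(r-1) / (2^(r-1) * ((r-1).factorial : ℕ)) ≤ (((n-1).choose (r-1) : ℕ):ℝ) := by
  filter_upwards [eventually_ge_atTop (2*r+2)] with n hn
  have h1 := Nat.pow_sub_le_descFactorial (n-1) (r-1)
  rw [Nat.descFactorial_eq_factorial_mul_choose] at h1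
  have h2 : ((n:ℝ)/2)^(r-1) ≤ ((n - 1 + 1 - (r-1) : ℕ) : ℝ)^(r-1) := by
    refine pow_le_pow_left₀ (by positivity) ?_ _
    rw [div_le_iff₀ (by norm_num)]
    exact_mod_cast (by omega : n ≤ (n - 1 + 1 - (r-1)) * 2)
  have h3 : ((n - 1 + 1 - (r-1) : ℕ) : ℝ)^(r-1) ≤ ((r-1).factorial : ℕ) * ((n-1).choose (r-1) : ℕ) := by exact_mod_cast h1
  rw [div_pow, div_le_iff₀ (by positivity)] at h2
  rw [div_le_iff₀ (by positivity)]
  calc (n:ℝ)^(r-1) ≤ _ := h2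
    _ ≤ (((r-1).factorial : ℕ) * ((n-1).choose (r-1) : ℕ)) * 2^(r-1) := mul_le_mul_of_nonneg_right h3 (by positivity)
    _ = _ := by ring

open Filter in
theorem ev_pp (r : ℕ) (ε : ℝ) (hε : 0 < ε) : ∀ᶠ n : ℕ in atTop,
    pp r ε n ≤ (1 + ε) * (2^(r-1) * ((r-1).factorial : ℕ)) * (Real.log n / (n:ℝ)^(r-1)) := by
  filter_upwards [ev_choose_pow r, eventually_ge_atTop 1] with n h1 hn
  have hn0 : (0:ℝ) < n := by exact_mod_cast hn
  have hl : 0 ≤ Real.log n := Real.log_natCast_nonneg n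
  unfold pp DD
  calc (1 + ε) * Real.log n / _ ≤ (1 + ε) * Real.log n / ((n:ℝ)^(r-1) / (2^(r-1) * ((r-1).factorial : ℕ))) := by
        refine div_le_div_of_nonneg_left (by positivity) (by positivity) h1
    _ = _ := by field_simp

open Filter Topology in
theorem ev_log_div (A τ : ℝ) (hτ : 0 < τ) : ∀ᶠ n : ℕ in atTop, A * (Real.log n / n) ≤ τ := by
  filter_upwards [ev_log_exp A (1/2) (by norm_num) 1 τ hτ, ev_log_exp A (1) (by norm_num) 1 τ hτ, (Real.isLittleO_log_id_atTop.tendsto_div_nhds_zero.comp tendsto_natCast_atTop_atTop |>.const_mul A).eventually_lt_const (u := τ) (by simpa using hτ)] with n _ _ h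
  simpa using h.le

open Filter in
theorem ev_pp_range (r : ℕ) (hr : 2 ≤ r) (ε : ℝ) (hε : 0 < ε) : ∀ᶠ n : ℕ in atTop,
    0 ≤ pp r ε n ∧ pp r ε n ≤ 1 := by
  filter_upwards [ev_pp r ε hε, ev_log_div ((1 + ε) * (2^(r-1) * ((r-1).factorial : ℕ))) 1 one_pos, eventually_ge_atTop 1] with n h1 h2 hn
  have hn0 : (1:ℝ) ≤ n := by exact_mod_cast hn
  have hl : 0 ≤ Real.log n := Real.log_natCast_nonneg n
  refine ⟨by unfold pp DD; positivity, h1.trans (le_trans ?_ h2)⟩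
  refine mul_le_mul_of_nonneg_left ?_ (by positivity)
  refine div_le_div_of_nonneg_left hl (by positivity) ?_
  exact le_self_pow₀ hn0 (by omega)

/-- numerical constants -/
theorem consts (ε : ℝ) (hε : 0 < ε) : ∃ θ κ η : ℝ, 0 ≤ θ ∧ 0 < κ ∧ κ ≤ 1/2 ∧ 0 < η ∧
    ∀ n : ℕ, θ * (η * DD ε n) - (1 - Real.exp (-θ)) * ((1 - 2*κ) * DD ε n) ≤ -((1 + ε/2) * Real.log n) := by
  set g : ℝ := (ε/2)/(1+ε) with hg
  have hg0 : 0 < g := by positivity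
  have hg1 : g < 1 := by rw [hg, div_lt_one (by positivity)]; linarith
  have hge : (1 - g) * (1 + ε) = 1 + ε/2 := by rw [hg]; field_simp; ring
  have hθ : 0 < Real.log (4/g) := Real.log_pos (by rw [lt_div_iff₀ hg0]; linarith)
  have he : Real.exp (-Real.log (4/g)) = g/4 := by
    rw [Real.exp_neg, Real.exp_log (by positivity), inv_div]
  refine ⟨Real.log (4/g), g/8, g/(4*Real.log (4/g)), hθ.le, by positivity, by linarith, by positivity, fun n => ?_⟩
  rw [he]
  have hl : 0 ≤ Real.log n := Real.log_natCast_nonneg n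
  have h1 : Real.log (4/g) * (g / (4 * Real.log (4/g)) * DD ε n) = g/4 * DD ε n := by field_simp
  rw [h1, ← hge]
  unfold DD
  have h2 : 0 ≤ (1 + ε) * Real.log n := by positivity
  have h3 : g/4 - (1 - g/4)*(1 - 2*(g/8)) ≤ -(1-g) := by nlinarith
  have := mul_le_mul_of_nonneg_right h3 h2
  linarith


noncomputable def thr (r : ℕ) (ε δ : ℝ) (n : ℕ) : ℝ :=
  Real.exp ((n/r : ℕ) * (Real.log (DD ε n) - (r-1)) - δ * n)

def Wgood (r : ℕ) (ε : ℝ) (C : ℕ) (δ : ℝ) (n : ℕ) (W : Finset (Finset ℕ)) : Prop :=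
  Wok C ((1 + δ) * (n/r : ℕ) * DD ε n) W

theorem thr_anti {r : ℕ} {ε δ δ' : ℝ} {n : ℕ} (h : δ ≤ δ') : thr r ε δ' n ≤ thr r ε δ n := by
  unfold thr
  refine Real.exp_le_exp.2 ?_
  have : δ * n ≤ δ' * n := mul_le_mul_of_nonneg_right h (by positivity)
  linarith

theorem Wgood_mono {r : ℕ} {ε : ℝ} (hε : 0 < ε) {C : ℕ} {δ δ' : ℝ} {n : ℕ} {W : Finset (Finset ℕ)} (h : δ ≤ δ')
    (hW : Wgood r ε C δ n W) : Wgood r ε C δ' n W := by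
  refine ⟨hW.1, hW.2.trans ?_⟩
  have hl : 0 ≤ DD ε n := mul_nonneg (by linarith) (Real.log_natCast_nonneg n)
  gcongr

theorem DD_nonneg {ε : ℝ} (hε : 0 < ε) (n : ℕ) : 0 ≤ DD ε n := mul_nonneg (by linarith) (Real.log_natCast_nonneg n)

set_option maxHeartbeats 1000000 in
open Filter in
open scoped Classical in
theorem swap_asym (r : ℕ) (hr : 2 ≤ r) (ε : ℝ) (hε : 0 < ε) (β : ℝ) (hβ : 0 < β) (C : ℕ) :
    ∃ c : ℝ, 0 < c ∧ c ≤ 1 ∧ ∃ δ0 : ℝ, 0 < δ0 ∧ ∀ τ : ℝ, 0 < τ → ∀ᶠ n : ℕ in atTop, r ∣ n →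
      ∀ P : Finset (Finset ℕ), P ⊆ Kn n r → Mat P → ∀ Z : Finset ℕ, Z ⊆ range n → Z.card = r → ∀ x ∈ Z,
      Pr (Kn n r) (pp r ε n) (fun W => Wgood r ε C δ0 n W ∧
        thr r ε δ0 n ≤ pmCount (range n \ Z) (W ∪ P) ∧
        β * n ≤ (((range n \ Z).filter (fun v => (pmCount (insert x ((range n \ Z).erase v)) (W ∪ P) : ℝ) <
          c * pmCount (range n \ Z) (W ∪ P))).card : ℝ)) ≤ τ / n := by
  obtain ⟨θ, κ, η, hθ, hκ, hκ1, hη, hθη⟩ := consts ε hε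
  obtain ⟨k, hk⟩ := exists_nat_ge (32/κ + 1)
  have hk1 : (1:ℝ) ≤ k := by have : 0 < 32/κ := by positivity
                             linarith
  have hk0 : 1 ≤ k := by exact_mod_cast hk1
  have hkκ : 2 ≤ k * κ / 16 := by
    have : 32/κ ≤ k := by linarith
    rw [div_le_iff₀ hκ] at this; linarith
  set ε' : ℝ := β^k/(4*k) with hε'
  have hε'0 : 0 < ε' := by positivity
  set ε3 : ℝ := min 1 (ε'*κ/64) with hε3
  have h30 : 0 < ε3 := lt_min one_pos (by positivity)
  have h31 : ε3 ≤ 1 := min_le_left _ _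
  have h32 : ε3 ≤ ε'*κ/64 := min_le_right _ _
  obtain ⟨D0, hD0, hbad⟩ := bad_count r hr (C+1) ε3 h30 h31 (κ/8) (by positivity) (by linarith)
  set c : ℝ := min 1 (η*ε3^3/(1024*k)) with hc
  have hc0 : 0 < c := lt_min one_pos (by positivity)
  have hr0 : (0:ℝ) < r := by exact_mod_cast (by omega : 0 < r)
  set δ0 : ℝ := min (ε3/128) (ε3/(64*r)) with hδ0
  have hd0 : 0 < δ0 := lt_min (by positivity) (by positivity)
  have hd1 : δ0 ≤ ε3/128 := min_le_left _ _
  have hd2 : δ0 ≤ ε3/(64*r) := min_le_right _ _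
  refine ⟨c, hc0, min_le_left _ _, δ0, hd0, fun τ hτ => ?_⟩
  have hDt := DD_tendsto hε
  filter_upwards [hDt.eventually_ge_atTop D0, hDt.eventually_ge_atTop (128/ε3),
    hDt.eventually_ge_atTop (Real.exp r), ev_nat_ge (r * (128 * (k+1) / ε3)),
    ev_pow_exp 1 (ε3/(64*r)) (by positivity) (r*k) (ε'/4) (by positivity),
    ev_nat_ge (r + k*r/(ε'/4)), hDt.eventually_ge_atTop (k * (r*(C+1)) / (κ/8)),
    ev_pp_range r hr ε hε, ev_choose (r+k) (r-1) κ hκ, ev_nat_ge (2*(k+1)*r),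
    ev_log_exp (2/β^k * ((1+ε)^k * (k+1))) (ε/2) (by positivity) k τ hτ]
    with n f1 f2 f3 f4 f5 f6 f7 f8 f9 f10 f11 hrn P hP hM Z hZ hZc x hx
  have hl : 0 ≤ Real.log n := Real.log_natCast_nonneg n
  have hn : n = n/r * r := (Nat.div_mul_cancel hrn).symm
  have hnm : (n:ℝ) = (n/r : ℕ) * r := by exact_mod_cast hn
  have hm' : ((n/r : ℕ) : ℝ) = n / r := by rw [eq_div_iff hr0.ne', ← hnm]
  have hDpos : 0 < DD ε n := lt_of_lt_of_le (Real.exp_pos _) f3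
  have hN : (0:ℝ) < (((n-1).choose (r-1) : ℕ):ℝ) := by
    have : n ≠ 0 := by
      rintro rfl
      simp [DD] at hDpos
    have hrn' : r ≤ n := Nat.le_of_dvd (by omega) hrn
    exact_mod_cast Nat.choose_pos (by omega)
  have hpN : pp r ε n * (((n-1).choose (r-1) : ℕ):ℝ) = DD ε n := by
    unfold pp; field_simp
  set m := n/r with hm
  have f4' : 128 * (k+1) / ε3 ≤ m := by
    rw [hm', le_div_iff₀ hr0]; linarith
  have hlogD : (r:ℝ) ≤ Real.log (DD ε n) := by
    rw [Real.le_log_iff_exp_le hDpos]; exact f3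
  have hsw := swap_fin (n := n) (r := r) (k := k) (m := m) (C := C) hr hn (D := DD ε n) (ε3 := ε3) (κ := κ) (θ := θ)
    (η := η) (δ0 := δ0) (ε' := ε') (β := β) (c := c) (p := pp r ε n) h30 hDpos hκ hκ1 hθ hη h31 hβ hε'0
    (fun U H m' hN => hbad U H m' (DD ε n) f1 hN) ?_ ?_ ?_ ?_ ?_ ?_ ?_ ?_ ?_ f8.1 f8.2 ?_ ?_ hP hM hZ hZc hx
  · refine le_trans hsw (le_trans ?_ f11)
    have g1 : Real.exp (θ * (η * DD ε n) - (1 - Real.exp (-θ)) * ((1 - 2 * κ) * DD ε n)) ≤ Real.exp (-((1 + ε/2) * Real.log n)) :=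
      Real.exp_le_exp.2 (hθη n)
    have g2 : Real.exp (-(k * κ * DD ε n / 16)) ≤ Real.exp (-((1 + ε/2) * Real.log n)) := by
      refine Real.exp_le_exp.2 (neg_le_neg ?_)
      calc (1 + ε/2) * Real.log n ≤ 2 * ((1+ε) * Real.log n) := by nlinarith
        _ ≤ (k * κ / 16) * DD ε n := mul_le_mul_of_nonneg_right hkκ hDpos.le
        _ = _ := by ring
    calc _ ≤ 2/β^k * (DD ε n ^ k * (k * Real.exp (-((1 + ε/2) * Real.log n)) + Real.exp (-((1 + ε/2) * Real.log n)))) := by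
          gcongr
      _ = _ := by unfold DD; rw [mul_pow]; ring
  · -- edges
    rw [div_le_iff₀ h30] at f2 f4'
    have hm0 : (0:ℝ) ≤ m := by positivity
    have e1 : (m:ℝ) ≤ ε3/128 * m * DD ε n := by
      have e0 : (1:ℝ) ≤ DD ε n * ε3 / 128 := by linarith
      have e00 := mul_le_mul_of_nonneg_left e0 hm0
      linarith
    have e2 : δ0 * m * DD ε n ≤ ε3/128 * m * DD ε n := by gcongr
    have e3 : (1 + ε3/64) * m ≤ (1 + ε3/32) * ((m:ℝ) - 1 - k) := by
      have : (1 + ε3/32) * (1 + k) ≤ 2 * (1 + (k:ℝ)) := mul_le_mul_of_nonneg_right (by linarith) (by positivity)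
      linarith
    have := mul_le_mul_of_nonneg_right e3 hDpos.le
    linarith
  · linarith
  · have e1 : Real.exp (m * (Real.log (DD ε n) - (r-1) - ε3/32)) = Real.exp (-(ε3/(64*r)*n)) *
        Real.exp (m * (Real.log (DD ε n) - (r-1)) - ε3/(64*r) * n) := by
      rw [← Real.exp_add]; congr 1
      rw [hnm]; field_simp; ring
    have e2 : Real.exp (m * (Real.log (DD ε n) - (r-1)) - ε3/(64*r) * n) ≤ Real.exp (m * (Real.log (DD ε n) - (r-1)) - δ0 * n) := by
      refine Real.exp_le_exp.2 ?_
      have : δ0 * n ≤ ε3/(64*r) * n := by gcongr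
      linarith
    rw [one_mul] at f5
    rw [e1, ← pow_mul, ← mul_assoc]
    exact mul_le_mul f5 e2 (Real.exp_pos _).le (by positivity)
  · have e1 : k*r/(ε'/4) ≤ (n:ℝ) - r := by linarith
    rw [div_le_iff₀ (by positivity)] at e1
    linarith
  · rw [div_le_iff₀ (by positivity)]
    linarith
  · rw [div_le_iff₀ (by positivity)] at f7
    linarith
  · have : 2*(k+1)*r ≤ m * r := by rw [← hn]; exact_mod_cast f10
    exact Nat.le_of_mul_le_mul_right this (by omega)
  · rw [hε']; apply le_of_eq; field_simp; ring
  · have : c ≤ η*ε3^3/(1024*k) := min_le_right _ _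
    calc _ ≤ 512 / ε3 ^ 3 / η * (k * (η*ε3^3/(1024*k))) := by gcongr
      _ = 1/2 := by field_simp; norm_num
  · rw [← hpN]
    refine mul_le_mul_of_nonneg_left ?_ f8.1
    exact_mod_cast Nat.choose_le_choose _ (by omega)
  · rw [Nat.sub_sub]
    calc (1-κ) * DD ε n = pp r ε n * ((1-κ) * ((n-1).choose (r-1) : ℕ)) := by rw [← hpN]; ring
      _ ≤ _ := mul_le_mul_of_nonneg_left f9 f8.1


theorem Pr_false {α : Type*} [DecidableEq α] {E : Finset α} {p : ℝ} (hp : 0 ≤ p) (hp1 : p ≤ 1) {A : Finset α → Prop}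
    (h : ∀ W, W ⊆ E → ¬ A W) : Pr E p A ≤ 0 := by
  have := Pr_le_Ex (E := E) hp hp1 (A := A) (f := fun _ => 0) (fun _ _ => le_rfl) (fun W hW hA => absurd hA (h W hW))
  rwa [Ex_const] at this

theorem thr_split (r : ℕ) (ε δ δ' : ℝ) (n : ℕ) : thr r ε (δ + δ') n = Real.exp (-(δ' * n)) * thr r ε δ n := by
  unfold thr; rw [← Real.exp_add]; congr 1; ring

theorem thr_pos (r : ℕ) (ε δ : ℝ) (n : ℕ) : 0 < thr r ε δ n := Real.exp_pos _

theorem chain_set {n v x : ℕ} {Z X T : Finset ℕ} (hZ : Z ⊆ range n) (hX : X ⊆ Z) (hx : x ∈ X)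
    (hT : T ⊆ range n \ Z) (hv : v ∈ T) :
    insert x ((range n \ (Z \ X.erase x ∪ T.erase v)).erase v) = range n \ (Z \ X ∪ T) := by
  ext u
  have h1 := @hZ u
  have h2 := @hX u
  have h3 := @hT u
  have h4 := hZ (hX hx)
  have h5 : x ∉ T := fun h => (mem_sdiff.1 (hT h)).2 (hX hx)
  simp only [mem_insert, mem_erase, mem_sdiff, mem_union] at *
  by_cases hux : u = x
  · subst hux; simp [h4, h5, hx]
  · by_cases huv : u = v
    · subst huv; simp [hux, hv]
    · simp [hux, huv]

open scoped Classical in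
/-- deterministic part of the chain step -/
theorem chain_count {n i : ℕ} {Z X : Finset ℕ} {x : ℕ} (hZ : Z ⊆ range n) (hX : X ⊆ Z) (hx : x ∈ X)
    (G : Finset (Finset ℕ)) {b c1 c2 : ℝ} (hb : 0 < b) (hn : 0 < n) (hc2 : 0 < c2)
    (h1 : ¬ b * n^i ≤ (((powersetCard i (range n \ Z)).filter (fun T => (pmCount (range n \ (Z \ X.erase x ∪ T)) G : ℝ) <
      c1 * pmCount (range n \ Z) G)).card : ℝ))
    (h2 : 4 * b * n^(i+1) ≤ (((powersetCard (i+1) (range n \ Z)).filter (fun T => (pmCount (range n \ (Z \ X ∪ T)) G : ℝ) <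
      c1 * c2 * pmCount (range n \ Z) G)).card : ℝ)) :
    b * n^i ≤ (((powersetCard i (range n \ Z)).filter (fun T =>
      c1 * pmCount (range n \ Z) G ≤ (pmCount (range n \ (Z \ X.erase x ∪ T)) G : ℝ) ∧
      b * n ≤ (((range n \ (Z \ X.erase x ∪ T)).filter (fun v =>
        (pmCount (insert x ((range n \ (Z \ X.erase x ∪ T)).erase v)) G : ℝ) <
        c2 * pmCount (range n \ (Z \ X.erase x ∪ T)) G)).card : ℝ))).card : ℝ) := by
  by_contra h3
  set PC := powersetCard i (range n \ Z) with hPC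
  set B := PC.filter (fun T => (pmCount (range n \ (Z \ X.erase x ∪ T)) G : ℝ) < c1 * pmCount (range n \ Z) G) with hB
  set bv : Finset ℕ → Finset ℕ := fun T => (range n \ (Z \ X.erase x ∪ T)).filter (fun v =>
        (pmCount (insert x ((range n \ (Z \ X.erase x ∪ T)).erase v)) G : ℝ) <
        c2 * pmCount (range n \ (Z \ X.erase x ∪ T)) G) with hbv
  set J := PC.filter (fun T => c1 * pmCount (range n \ Z) G ≤ (pmCount (range n \ (Z \ X.erase x ∪ T)) G : ℝ) ∧
      b * n ≤ ((bv T).card : ℝ)) with hJ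
  rw [not_le] at h1 h3
  have hn' : (0:ℝ) < n := by exact_mod_cast hn
  set L := PC.filter (fun T => ((bv T).card : ℝ) < b * n) with hL
  have hsub : (powersetCard (i+1) (range n \ Z)).filter (fun T => (pmCount (range n \ (Z \ X ∪ T)) G : ℝ) <
      c1 * c2 * pmCount (range n \ Z) G) ⊆
      ((B ∪ J) ×ˢ range n).image (fun q => insert q.2 q.1) ∪ L.biUnion (fun T => (bv T).image (fun v => insert v T)) := by
    intro T hT
    rw [mem_filter, mem_powersetCard] at hT
    obtain ⟨⟨hT1, hT2⟩, hT3⟩ := hT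
    obtain ⟨v, hv⟩ := card_pos.1 (by omega : 0 < T.card)
    have hv1 := mem_sdiff.1 (hT1 hv)
    have hTe : T.erase v ∈ PC := by
      rw [hPC, mem_powersetCard]
      refine ⟨(erase_subset _ _).trans hT1, ?_⟩
      rw [card_erase_of_mem hv, hT2]; rfl
    rw [mem_union]
    by_cases hBJ : T.erase v ∈ B ∪ J
    · left
      exact mem_image.2 ⟨(T.erase v, v), mem_product.2 ⟨hBJ, hv1.1⟩, insert_erase hv⟩
    · right
      rw [mem_union, not_or, hB, hJ, mem_filter, mem_filter] at hBJ
      have hb1 : c1 * pmCount (range n \ Z) G ≤ (pmCount (range n \ (Z \ X.erase x ∪ T.erase v)) G : ℝ) := by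
        by_contra h
        exact hBJ.1 ⟨hTe, not_le.1 h⟩
      have hb2 : ((bv (T.erase v)).card : ℝ) < b * n := by
        by_contra h
        exact hBJ.2 ⟨hTe, hb1, not_lt.1 h⟩
      refine mem_biUnion.2 ⟨T.erase v, mem_filter.2 ⟨hTe, hb2⟩, mem_image.2 ⟨v, ?_, insert_erase hv⟩⟩
      refine mem_filter.2 ⟨?_, ?_⟩
      · rw [mem_sdiff, mem_union, mem_sdiff]
        refine ⟨hv1.1, ?_⟩
        rintro (h | h)
        · exact hv1.2 h.1
        · exact (mem_erase.1 h).1 rfl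
      · rw [chain_set hZ hX hx hT1 hv]
        refine hT3.trans_le ?_
        rw [mul_comm c1, mul_assoc]
        exact mul_le_mul_of_nonneg_left hb1 hc2.le
  have hcard := card_le_card hsub
  have hPCc : (PC.card : ℝ) ≤ n^i := by
    rw [hPC, card_powersetCard]
    have e1 : (range n \ Z).card ≤ n := by
      simpa using card_le_card (sdiff_subset : range n \ Z ⊆ range n)
    exact_mod_cast (Nat.choose_le_pow _ _).trans (Nat.pow_le_pow_left e1 i)
  have c1' : ((((B ∪ J) ×ˢ range n).image (fun q : Finset ℕ × ℕ => insert q.2 q.1)).card : ℝ) ≤ (B.card + J.card) * n := by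
    have := (card_image_le (s := (B ∪ J) ×ˢ range n) (f := fun q : Finset ℕ × ℕ => insert q.2 q.1))
    rw [card_product, card_range] at this
    have h4 := this.trans (Nat.mul_le_mul_right n (card_union_le B J))
    exact_mod_cast h4
  have c2' : ((L.biUnion (fun T => (bv T).image (fun v => insert v T))).card : ℝ) ≤ n^i * (b * n) := by
    have e1 : ((L.biUnion (fun T => (bv T).image (fun v => insert v T))).card : ℝ) ≤ ∑ T ∈ L, ((bv T).card : ℝ) := by
      have := (card_biUnion_le (s := L) (t := fun T => (bv T).image (fun v => insert v T))).trans
        (sum_le_sum fun T _ => card_image_le)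
      exact_mod_cast this
    refine e1.trans ?_
    have e2 : ∑ T ∈ L, ((bv T).card : ℝ) ≤ L.card • (b * n) := sum_le_card_nsmul _ _ _ fun T hT => (mem_filter.1 hT).2.le
    rw [nsmul_eq_mul] at e2
    refine e2.trans (mul_le_mul_of_nonneg_right ?_ (by positivity))
    exact le_trans (by exact_mod_cast card_le_card (filter_subset _ _)) hPCc
  have c3 := (Nat.cast_le (α := ℝ)).2 (hcard.trans (card_union_le _ _))
  rw [Nat.cast_add] at c3
  have c4 : ((B.card : ℝ) + J.card) * n ≤ (2 * b * n^i) * n := mul_le_mul_of_nonneg_right (by linarith) hn'.le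
  have c5 : 0 < b * n^(i+1) := by positivity
  rw [pow_succ] at h2 c5
  linarith

open Filter in
open scoped Classical in
theorem chain_asym (r : ℕ) (hr : 2 ≤ r) (ε : ℝ) (hε : 0 < ε) (C : ℕ) (i : ℕ) : ∀ β : ℝ, 0 < β →
    ∃ c : ℝ, 0 < c ∧ c ≤ 1 ∧ ∃ δ0 : ℝ, 0 < δ0 ∧ ∀ τ : ℝ, 0 < τ → ∀ᶠ n : ℕ in atTop, r ∣ n →
      ∀ P : Finset (Finset ℕ), P ⊆ Kn n r → Mat P → ∀ Z : Finset ℕ, Z ⊆ range n → Z.card = r → ∀ X, X ⊆ Z → X.card = i →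
      Pr (Kn n r) (pp r ε n) (fun W => Wgood r ε C δ0 n W ∧
        thr r ε δ0 n ≤ pmCount (range n \ Z) (W ∪ P) ∧
        β * n^i ≤ (((powersetCard i (range n \ Z)).filter (fun T => (pmCount (range n \ (Z \ X ∪ T)) (W ∪ P) : ℝ) <
          c * pmCount (range n \ Z) (W ∪ P))).card : ℝ)) ≤ τ / n := by
  induction i with
  | zero =>
    intro β hβ
    refine ⟨1, one_pos, le_rfl, 1, one_pos, fun τ hτ => ?_⟩
    filter_upwards [ev_pp_range r hr ε hε] with n hp hrn P hP hM Z hZ hZr X hX hX0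
    refine (Pr_false hp.1 hp.2 ?_).trans (by positivity)
    rintro W hW ⟨_, _, h3⟩
    rw [card_eq_zero] at hX0
    subst hX0
    rw [powersetCard_zero, filter_singleton] at h3
    simp at h3
    linarith
  | succ i ih =>
    intro β hβ
    obtain ⟨c1, hc1, hc11, δ1, hδ1, h1⟩ := ih (β/4) (by positivity)
    obtain ⟨c2, hc2, hc21, δ2, hδ2, h2⟩ := swap_asym r hr ε hε (β/4) (by positivity) C
    set δ : ℝ := min δ1 δ2 / 2 with hδ
    have hδ0 : 0 < δ := by have := lt_min hδ1 hδ2; positivity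
    have hd1 : δ ≤ δ1 := by have := min_le_left δ1 δ2; linarith
    have hd2 : δ + δ ≤ δ2 := by have := min_le_right δ1 δ2; linarith
    refine ⟨c1*c2, by positivity, mul_le_one₀ hc11 hc2.le hc21, δ, hδ0, fun τ hτ => ?_⟩
    filter_upwards [ev_pp_range r hr ε hε, h1 (τ/2) (by positivity), h2 (τ*β/8) (by positivity),
      ev_pow_exp 1 δ hδ0 0 c1 hc1, eventually_gt_atTop 0] with n hp g1 g2 g3 hn hrn P hP hM Z hZ hZr X hX hXi
    obtain ⟨x, hx⟩ := card_pos.1 (by omega : 0 < X.card)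
    have hn' : (0:ℝ) < n := by exact_mod_cast hn
    have hXe : (X.erase x).card = i := by rw [card_erase_of_mem hx, hXi]; rfl
    have hXeZ : X.erase x ⊆ Z := (erase_subset _ _).trans hX
    have k1 := g1 hrn P hP hM Z hZ hZr (X.erase x) hXeZ hXe
    set A : Finset ℕ → Finset (Finset ℕ) → Prop := fun T W => Wgood r ε C δ2 n W ∧
        thr r ε δ2 n ≤ pmCount (range n \ (Z \ X.erase x ∪ T)) (W ∪ P) ∧
        (β/4) * n ≤ (((range n \ (Z \ X.erase x ∪ T)).filter (fun v =>
          (pmCount (insert x ((range n \ (Z \ X.erase x ∪ T)).erase v)) (W ∪ P) : ℝ) <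
          c2 * pmCount (range n \ (Z \ X.erase x ∪ T)) (W ∪ P))).card : ℝ) with hA
    set PC := powersetCard i (range n \ Z) with hPC
    have k2 : ∀ T ∈ PC, Pr (Kn n r) (pp r ε n) (A T) ≤ (τ*β/8)/n := by
      intro T hT
      rw [hPC, mem_powersetCard] at hT
      refine g2 hrn P hP hM _ ?_ ?_ x ?_
      · exact union_subset (sdiff_subset.trans hZ) (hT.1.trans sdiff_subset)
      · rw [card_union_of_disjoint, card_sdiff_of_subset hXeZ, hXe, hT.2, hZr]
        · have := card_le_card hX; omega
        · exact disjoint_of_subset_left sdiff_subset (disjoint_of_subset_right hT.1 disjoint_sdiff)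
      · refine mem_union_left _ (mem_sdiff.2 ⟨hX hx, ?_⟩)
        simp
    set Bev : Finset (Finset ℕ) → Prop := fun W => ∃ J : Finset (Finset ℕ), J ⊆ PC ∧ (β/4) * n^i ≤ (J.card : ℝ) ∧ ∀ T ∈ J, A T W
      with hBev
    have k3 := Pr_markov PC (E := Kn n r) hp.1 hp.2 A _ k2 ((β/4) * n^i) (by positivity) Bev (fun W _ h => h)
    have hPCc : (PC.card : ℝ) ≤ n^i := by
      rw [hPC, card_powersetCard]
      have e1 : (range n \ Z).card ≤ n := by
        simpa using card_le_card (sdiff_subset : range n \ Z ⊆ range n)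
      exact_mod_cast (Nat.choose_le_pow _ _).trans (Nat.pow_le_pow_left e1 i)
    have k4 : (PC.card : ℝ) * ((τ*β/8)/n) / ((β/4) * n^i) ≤ (τ/2)/n := by
      rw [div_le_iff₀ (by positivity)]
      calc (PC.card : ℝ) * ((τ*β/8)/n) ≤ n^i * ((τ*β/8)/n) := mul_le_mul_of_nonneg_right hPCc (by positivity)
        _ = _ := by ring
    have k5 : τ / n = (τ/2)/n + (τ/2)/n := by ring
    rw [k5]
    refine le_trans ?_ (add_le_add k1 (k3.trans k4))
    refine le_trans (Pr_mono hp.1 hp.2 ?_) (Pr_or hp.1 hp.2 _ _)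
    rintro W hW ⟨w1, w2, w3⟩
    by_cases hcase : (β/4) * n^i ≤ (((powersetCard i (range n \ Z)).filter (fun T => (pmCount (range n \ (Z \ X.erase x ∪ T)) (W ∪ P) : ℝ) <
          c1 * pmCount (range n \ Z) (W ∪ P))).card : ℝ)
    · left
      exact ⟨Wgood_mono hε hd1 w1, (thr_anti hd1).trans w2, hcase⟩
    · right
      have k6 := chain_count hZ hX hx (W ∪ P) (b := β/4) (c1 := c1) (c2 := c2) (by positivity) hn hc2 hcase (by
        rw [show 4 * (β/4) = β by ring]; exact w3)
      refine ⟨_, filter_subset _ _, k6, fun T hT => ?_⟩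
      obtain ⟨_, t2, t3⟩ := mem_filter.1 hT
      refine ⟨Wgood_mono hε (by linarith) w1, ?_, t3⟩
      refine le_trans ?_ t2
      refine (thr_anti hd2).trans ?_
      rw [thr_split]
      simp at g3
      exact mul_le_mul g3 w2 (thr_pos _ _ _ _).le hc1.le


open Filter in
open scoped Classical in
theorem step_asym (r : ℕ) (hr : 2 ≤ r) (ε : ℝ) (hε : 0 < ε) (C : ℕ) :
    ∃ δ0 : ℝ, 0 < δ0 ∧ ∀ K : ℝ, ∀ τ : ℝ, 0 < τ → ∀ᶠ n : ℕ in atTop, r ∣ n →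
      ∀ P : Finset (Finset ℕ), P ⊆ Kn n r → Mat P → ∀ e ∈ Kn n r,
      Pr (Kn n r) (pp r ε n) (fun W => Wgood r ε C δ0 n W ∧
        thr r ε δ0 n ≤ pmCount (range n \ e) (W ∪ P) ∧
        (pmCount (range n) (W ∪ P) : ℝ) < K * pmCount (range n \ e) (W ∪ P)) ≤ τ / n := by
  obtain ⟨θ, κ, η, hθ, hκ, hκ1, hη, hθη⟩ := consts ε hε
  set β : ℝ := κ / (2^(r-1) * ((r-1).factorial : ℕ)) with hβ
  have hβ0 : 0 < β := by positivity
  obtain ⟨c, hc, hc1, δ0, hδ0, hch⟩ := chain_asym r hr ε hε C (r-1) β hβ0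
  refine ⟨δ0, hδ0, fun K τ hτ => ?_⟩
  filter_upwards [ev_pp_range r hr ε hε, hch (τ/2) (by positivity), ev_choose r (r-1) κ hκ, ev_choose_pow r,
    (DD_tendsto hε).eventually_ge_atTop (K / (η * c)), ev_log_exp 1 (ε/2) (by positivity) 0 (τ/2) (by positivity),
    eventually_ge_atTop r]
    with n hp g1 g2 g3 g4 g5 hrn' hrn P hP hM e he
  rw [Kn, mem_powersetCard] at he
  obtain ⟨x, hx⟩ := card_pos.1 (by omega : 0 < e.card)
  have hN : (0:ℝ) < (((n-1).choose (r-1) : ℕ):ℝ) := by exact_mod_cast Nat.choose_pos (by omega)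
  have hpN : pp r ε n * (((n-1).choose (r-1) : ℕ):ℝ) = DD ε n := by
    unfold pp; field_simp
  have k1 := g1 hrn P hP hM e he.1 he.2 (e.erase x) (erase_subset _ _) (by rw [card_erase_of_mem hx, he.2])
  have hex : e \ e.erase x = {x} := by
    rw [sdiff_erase hx]; simp
  simp only [hex] at k1
  set PC := powersetCard (r-1) (range n \ e) with hPC
  set gT : Finset (Finset ℕ) → Finset (Finset ℕ) := fun W => PC.filter (fun T =>
    c * pmCount (range n \ e) (W ∪ P) ≤ (pmCount (range n \ ({x} ∪ T)) (W ∪ P) : ℝ)) with hgT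
  set A : Finset (Finset ℕ) → Finset (Finset ℕ) := fun W => (gT W).image (fun T => insert x T) with hA
  have hxT : ∀ T ∈ PC, x ∉ T := fun T hT h => (mem_sdiff.1 ((mem_powersetCard.1 hT).1 h)).2 hx
  have hAc : ∀ W, (A W).card = (gT W).card := by
    intro W
    refine card_image_of_injOn ?_
    intro T hT T' hT' h
    have e1 := hxT T (filter_subset _ _ hT)
    have e2 := hxT T' (filter_subset _ _ hT')
    simp only at h
    rw [← erase_insert e1, h, erase_insert e2]
  set E1 := (Kn n r).filter (fun f => x ∈ f) with hE1
  have hAE : ∀ W, A W ⊆ E1 := by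
    intro W f hf
    obtain ⟨T, hT, rfl⟩ := mem_image.1 hf
    have hT' := mem_powersetCard.1 (filter_subset _ _ hT)
    rw [hE1, mem_filter, Kn, mem_powersetCard]
    refine ⟨⟨insert_subset (he.1 hx) (hT'.1.trans sdiff_subset), ?_⟩, mem_insert_self _ _⟩
    rw [card_insert_of_notMem (hxT T (filter_subset _ _ hT)), hT'.2]; omega
  have hcong : ∀ (W0 W1 : Finset (Finset ℕ)) (U : Finset ℕ), x ∉ U → W1 ⊆ E1 →
      pmCount U (W0 ∪ W1 ∪ P) = pmCount U (W0 ∪ P) := by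
    intro W0 W1 U hU hW1
    refine pmCount_congr fun f hf => ?_
    have : f ∉ W1 := fun h => hU (hf (mem_filter.1 (hW1 h)).2)
    simp [this]
  have hA1 : ∀ W0 W1 : Finset (Finset ℕ), W1 ⊆ E1 → A (W0 ∪ W1) = A W0 := by
    intro W0 W1 hW1
    have e0 : gT (W0 ∪ W1) = gT W0 := by
      refine filter_congr fun T hT => ?_
      rw [hcong W0 W1 _ (fun h => (mem_sdiff.1 h).2 hx) hW1,
        hcong W0 W1 _ (fun h => (mem_sdiff.1 h).2 (by simp)) hW1]
    simp only [hA, e0]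
  have k2 : Pr (Kn n r) (pp r ε n) (fun W => (1 - 2*κ) * ((n-1).choose (r-1) : ℕ) ≤ ((A W).card : ℝ) ∧
      (((W ∩ A W).card : ℕ) : ℝ) ≤ η * DD ε n) ≤ (τ/2)/n := by
    refine Pr_cond (filter_subset _ _ : E1 ⊆ Kn n r) hp.1 hp.2 _ _ fun W0 hW0 => ?_
    by_cases hbig : (1 - 2*κ) * ((n-1).choose (r-1) : ℕ) ≤ ((A W0).card : ℝ)
    · have k3 := lemX (empty_subset E1) (hAE W0) (disjoint_empty_left _) hp.1 hp.2 θ hθ (η * DD ε n)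
      refine (Pr_mono hp.1 hp.2 ?_).trans (k3.trans ?_)
      · rintro W1 hW1 ⟨_, h2⟩
        rw [hA1 W0 W1 hW1] at h2
        refine ⟨empty_subset _, le_trans ?_ h2⟩
        exact_mod_cast card_le_card (inter_subset_inter_right subset_union_right)
      · rw [card_empty, pow_zero, one_mul]
        refine le_trans ?_ g5
        rw [pow_zero, one_mul, one_mul]
        refine Real.exp_le_exp.2 (le_trans ?_ (hθη n))
        have e1 : Real.exp (-θ) ≤ 1 := Real.exp_le_one_iff.2 (by linarith)
        have e2 : (1 - 2*κ) * DD ε n ≤ pp r ε n * (A W0).card := by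
          rw [← hpN]
          have := mul_le_mul_of_nonneg_left hbig hp.1
          linarith
        have := mul_le_mul_of_nonneg_left e2 (by linarith : 0 ≤ 1 - Real.exp (-θ))
        linarith
    · refine (Pr_false hp.1 hp.2 ?_).trans (by positivity)
      rintro W1 hW1 ⟨h1, _⟩
      rw [hA1 W0 W1 hW1] at h1
      exact hbig h1
  rw [show τ / n = (τ/2)/n + (τ/2)/n by ring]
  refine le_trans ?_ (add_le_add k1 k2)
  refine le_trans (Pr_mono hp.1 hp.2 ?_) (Pr_or hp.1 hp.2 _ _)
  rintro W hW ⟨w1, w2, w3⟩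
  by_contra hcon
  rw [not_or] at hcon
  obtain ⟨hn1, hn2⟩ := hcon
  have hb : ((PC.filter (fun T => (pmCount (range n \ ({x} ∪ T)) (W ∪ P) : ℝ) <
          c * pmCount (range n \ e) (W ∪ P))).card : ℝ) < β * n^(r-1) := by
    by_contra h
    exact hn1 ⟨w1, w2, not_lt.1 h⟩
  have hsum : (gT W).card + (PC.filter (fun T => (pmCount (range n \ ({x} ∪ T)) (W ∪ P) : ℝ) <
          c * pmCount (range n \ e) (W ∪ P))).card = PC.card := by
    have := card_filter_add_card_filter_not (s := PC) (fun T => c * pmCount (range n \ e) (W ∪ P) ≤ (pmCount (range n \ ({x} ∪ T)) (W ∪ P) : ℝ))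
    simpa only [not_le] using this
  have hPCc : PC.card = (n - r).choose (r-1) := by
    rw [hPC, card_powersetCard, card_sdiff_of_subset he.1, card_range, he.2]
  have hsum' : ((gT W).card : ℝ) + ((PC.filter (fun T => (pmCount (range n \ ({x} ∪ T)) (W ∪ P) : ℝ) <
          c * pmCount (range n \ e) (W ∪ P))).card : ℝ) = ((n - r).choose (r-1) : ℕ) := by
    rw [← hPCc]; exact_mod_cast hsum
  have hβn : β * n^(r-1) ≤ κ * ((n-1).choose (r-1) : ℕ) := by
    calc β * n^(r-1) = κ * ((n:ℝ)^(r-1) / (2^(r-1) * ((r-1).factorial : ℕ))) := by rw [hβ]; ring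
      _ ≤ _ := mul_le_mul_of_nonneg_left g3 hκ.le
  have hAbig : (1 - 2*κ) * ((n-1).choose (r-1) : ℕ) ≤ ((A W).card : ℝ) := by
    rw [hAc]; linarith
  have hWA : η * DD ε n < (((W ∩ A W).card : ℕ) : ℝ) := by
    by_contra h
    exact hn2 ⟨hAbig, not_lt.1 h⟩
  have hne : ∅ ∉ W ∪ P := by
    intro h
    have := (mem_powersetCard.1 ((union_subset hW hP) h)).2
    rw [card_empty] at this; omega
  have hv := pmCount_vertex hne (he.1 hx : x ∈ range n)
  have hlow : ((W ∩ A W).card : ℝ) * (c * pmCount (range n \ e) (W ∪ P)) ≤ pmCount (range n) (W ∪ P) := by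
    rw [hv, Nat.cast_sum, ← nsmul_eq_mul]
    refine le_trans (card_nsmul_le_sum (W ∩ A W) (fun f => (pmCount (range n \ f) (W ∪ P) : ℝ)) _ ?_) ?_
    · intro f hf
      obtain ⟨T, hT, rfl⟩ := mem_image.1 (mem_inter.1 hf).2
      exact (mem_filter.1 hT).2
    · refine sum_le_sum_of_subset_of_nonneg ?_ (fun _ _ _ => by positivity)
      intro f hf
      have h1 := mem_inter.1 hf
      have h2 := mem_filter.1 (hAE W h1.2)
      exact mem_filter.2 ⟨mem_union_left _ h1.1, h2.2, (mem_powersetCard.1 h2.1).1⟩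
  rw [div_le_iff₀ (by positivity)] at g4
  have h5 : (η * DD ε n) * (c * pmCount (range n \ e) (W ∪ P)) ≤ ((W ∩ A W).card : ℝ) * (c * pmCount (range n \ e) (W ∪ P)) :=
    mul_le_mul_of_nonneg_right hWA.le (by positivity)
  have h6 : K * pmCount (range n \ e) (W ∪ P) ≤ DD ε n * (η * c) * pmCount (range n \ e) (W ∪ P) :=
    mul_le_mul_of_nonneg_right g4 (by positivity)
  linarith

open scoped Classical in
theorem path_fin {r n : ℕ} {ε δ0 l τ p : ℝ} {C : ℕ} (hr : 1 ≤ r) (hl : 0 < l) (hl1 : l < 1) (hp : 0 ≤ p) (hp1 : p ≤ 1)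
    (hstep : ∀ P : Finset (Finset ℕ), P ⊆ Kn n r → Mat P → ∀ e ∈ Kn n r,
      Pr (Kn n r) p (fun W => Wgood r ε C δ0 n W ∧
        thr r ε δ0 n ≤ pmCount (range n \ e) (W ∪ P) ∧
        (pmCount (range n) (W ∪ P) : ℝ) < 1/l * pmCount (range n \ e) (W ∪ P)) ≤ τ)
    (Q : Finset (Finset ℕ)) : Q ⊆ Kn n r → Mat Q → ∀ a : ℝ, thr r ε δ0 n ≤ l * ((1-l)^Q.card * a) →
    Pr (Kn n r) p (fun W => Wgood r ε C δ0 n W ∧ a ≤ pmCount (range n) (W ∪ Q) ∧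
      (pmCount (range n) W : ℝ) < (1-l)^Q.card * pmCount (range n) (W ∪ Q)) ≤ Q.card * τ := by
  induction Q using Finset.induction_on with
  | empty =>
    intro _ _ a _
    refine (Pr_false hp hp1 ?_).trans (by simp)
    rintro W hW ⟨_, _, h⟩
    simp at h
  | insert e Q heQ ih =>
    intro hQ hM a ha
    have hQK : Q ⊆ Kn n r := (subset_insert _ _).trans hQ
    have hMQ : Mat Q := fun A hA B hB h => hM A (mem_insert_of_mem hA) B (mem_insert_of_mem hB) h
    have heK : e ∈ Kn n r := hQ (mem_insert_self _ _)
    rw [card_insert_of_notMem heQ] at ha ⊢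
    have h1 := hstep Q hQK hMQ e heK
    have h2 := ih hQK hMQ ((1-l)*a) (by rw [pow_succ, mul_assoc] at ha; exact ha)
    have e1 : ((Q.card + 1 : ℕ) : ℝ) * τ = τ + Q.card * τ := by push_cast; ring
    rw [e1]
    refine le_trans ?_ (add_le_add h1 h2)
    refine le_trans (Pr_mono hp hp1 ?_) (Pr_or hp hp1 _ _)
    rintro W hW ⟨w1, w2, w3⟩
    rw [union_insert] at w2 w3
    have hne : ∅ ∉ W ∪ Q := by
      intro h
      have := (mem_powersetCard.1 ((union_subset hW hQK) h)).2
      rw [card_empty] at this; omega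
    have hen : e.Nonempty := card_pos.1 (by rw [(mem_powersetCard.1 heK).2]; omega)
    have hins : (pmCount (range n) (insert e (W ∪ Q)) : ℝ) ≤ pmCount (range n) (W ∪ Q) + pmCount (range n \ e) (W ∪ Q) := by
      exact_mod_cast pmCount_insert_le hne hen
    set x : ℝ := (pmCount (range n) (insert e (W ∪ Q)) : ℝ) with hx
    set y : ℝ := (pmCount (range n) (W ∪ Q) : ℝ) with hy
    set z : ℝ := (pmCount (range n \ e) (W ∪ Q) : ℝ) with hz
    by_contra hcon
    rw [not_or] at hcon
    obtain ⟨n1, n2⟩ := hcon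
    have hx0 : 0 ≤ x := by positivity
    have hpw : (1-l)^(Q.card+1) ≤ 1 := pow_le_one₀ (by linarith) (by linarith)
    have hpw0 : 0 ≤ (1-l)^(Q.card+1) := pow_nonneg (by linarith) _
    have hkey : (1-l) * x ≤ y := by
      by_cases hz1 : thr r ε δ0 n ≤ z
      · have : 1/l * z ≤ y := by
          by_contra h
          exact n1 ⟨w1, hz1, not_le.1 h⟩
        rw [div_mul_eq_mul_div, one_mul, div_le_iff₀ hl] at this
        have hy0 : 0 ≤ y := by positivity
        nlinarith
      · rw [not_le] at hz1
        have e2 : (1-l)^(Q.card+1) * a ≤ x := by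
          calc (1-l)^(Q.card+1) * a ≤ (1-l)^(Q.card+1) * x := mul_le_mul_of_nonneg_left w2 hpw0
            _ ≤ 1 * x := mul_le_mul_of_nonneg_right hpw hx0
            _ = x := one_mul x
        have e3 : l * ((1-l)^(Q.card+1) * a) ≤ l * x := mul_le_mul_of_nonneg_left e2 hl.le
        linarith
    refine n2 ⟨w1, (mul_le_mul_of_nonneg_left w2 (by linarith)).trans hkey, w3.trans_le ?_⟩
    rw [pow_succ, mul_assoc]
    exact mul_le_mul_of_nonneg_left hkey (pow_nonneg (by linarith) _)

open Filter in
open scoped Classical in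
theorem path_asym (r : ℕ) (hr : 2 ≤ r) (ε : ℝ) (hε : 0 < ε) (C : ℕ) :
    ∃ δ0 : ℝ, 0 < δ0 ∧ ∀ δ1 : ℝ, 0 < δ1 → δ1 ≤ δ0 → ∀ τ : ℝ, 0 < τ → ∀ᶠ n : ℕ in atTop, r ∣ n →
      ∀ S ∈ pmSet (range n) (Kn n r),
      Pr (Kn n r) (pp r ε n) (fun W => Wgood r ε C δ1 n W ∧
        thr r ε δ1 n ≤ pmCount (range n) (W ∪ S) ∧
        (pmCount (range n) W : ℝ) < thr r ε (δ1 + δ1) n) ≤ τ := by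
  obtain ⟨δ0, hδ0, hst⟩ := step_asym r hr ε hε C
  refine ⟨δ0/4, by positivity, fun δ1 hδ1 hδ1' τ hτ => ?_⟩
  set l : ℝ := 1 - Real.exp (-δ1) with hl
  have hl0 : 0 < l := by
    have : Real.exp (-δ1) < 1 := Real.exp_lt_one_iff.2 (by linarith)
    linarith
  have hl1 : l < 1 := by have := Real.exp_pos (-δ1); linarith
  filter_upwards [ev_pp_range r hr ε hε, hst (1/l) τ hτ, ev_pow_exp 1 δ1 hδ1 0 l hl0, eventually_gt_atTop 0]
    with n hp g1 g2 hn hrn S hS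
  obtain ⟨hS1, hS2, hS3⟩ := mem_pmSet.1 hS
  have hn' : (0:ℝ) < n := by exact_mod_cast hn
  have hSc : S.card ≤ n := by
    refine le_trans (mat_card (by omega) (Nat.div_mul_cancel hrn).symm hS1 hS2) (Nat.div_le_self _ _)
  have hpow : Real.exp (-(δ1 * n)) ≤ (1-l)^S.card := by
    rw [hl, sub_sub_cancel, ← Real.exp_nat_mul]
    refine Real.exp_le_exp.2 ?_
    have : (S.card : ℝ) ≤ n := by exact_mod_cast hSc
    nlinarith
  have hth : thr r ε (δ1+δ1) n ≤ (1-l)^S.card * thr r ε δ1 n := by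
    rw [thr_split]
    exact mul_le_mul_of_nonneg_right hpow (thr_pos _ _ _ _).le
  have h1 := path_fin (C := C) (ε := ε) (δ0 := δ0) (by omega : 1 ≤ r) hl0 hl1 hp.1 hp.2 (g1 hrn) S hS1 hS2 (thr r ε δ1 n) (by
    refine le_trans (thr_anti (show δ1 + δ1 + δ1 ≤ δ0 by linarith)) ?_
    rw [thr_split]
    simp at g2
    exact mul_le_mul g2 hth (thr_pos _ _ _ _).le hl0.le)
  refine le_trans (Pr_mono hp.1 hp.2 ?_) (h1.trans ?_)
  · rintro W hW ⟨w1, w2, w3⟩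
    refine ⟨Wgood_mono hε (by linarith) w1, w2, w3.trans_le (hth.trans ?_)⟩
    exact mul_le_mul_of_nonneg_left w2 (pow_nonneg (by linarith) _)
  · have : (S.card : ℝ) ≤ n := by exact_mod_cast hSc
    calc (S.card : ℝ) * (τ/n) ≤ n * (τ/n) := mul_le_mul_of_nonneg_right this (by positivity)
      _ = τ := by field_simp


open scoped Classical in
theorem Ex_plant {α : Type*} [DecidableEq α] {E S : Finset α} (hS : S ⊆ E) (p : ℝ) (g : Finset α → ℝ) :
    Ex E p (fun W => if S ⊆ W then g W else 0) = p ^ S.card * Ex E p (fun W => g (W ∪ S)) := by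
  have hE : E = (E \ S) ∪ S := (sdiff_union_of_subset hS).symm
  rw [hE, Ex_split disjoint_sdiff_self_left, Ex_split disjoint_sdiff_self_left, ← Ex_mul]
  refine Ex_congr fun W0 hW0 => ?_
  have h1 : Ex S p (fun W1 => g (W0 ∪ W1 ∪ S)) = g (W0 ∪ S) := by
    rw [Ex_congr (g := fun _ => g (W0 ∪ S)), Ex_const]
    intro W1 hW1
    rw [union_assoc, union_eq_right.2 hW1]
  rw [h1]
  unfold Ex
  rw [sum_eq_single S]
  · simp
  · intro W1 hW1 hne
    beta_reduce
    rw [if_neg, mul_zero]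
    intro h
    apply hne
    refine subset_antisymm (mem_powerset.1 hW1) fun f hf => ?_
    rcases mem_union.1 (h hf) with h2 | h2
    · exact absurd hf (mem_sdiff.1 (hW0 h2)).2
    · exact h2
  · intro h
    exact absurd (mem_powerset_self S) h

theorem pmSet_filter {U : Finset ℕ} {E W : Finset (Finset ℕ)} (hW : W ⊆ E) :
    pmSet U W = (pmSet U E).filter (fun S => S ⊆ W) := by
  ext S
  rw [mem_filter, mem_pmSet, mem_pmSet]
  constructor
  · rintro ⟨h1, h2⟩
    exact ⟨⟨h1.trans hW, h2⟩, h1⟩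
  · rintro ⟨⟨h1, h2⟩, h3⟩
    exact ⟨h3, h2⟩

open scoped Classical in
theorem planted_exists {n r m : ℕ} (hr : 1 ≤ r) (hn : n = m * r) {p a b : ℝ} (hp : 0 ≤ p) (hp1 : p ≤ 1) (ha : 0 ≤ a) (hb : 0 < b)
    (hN : b ≤ pmCount (range n) (Kn n r) * p^m) :
    ∃ S ∈ pmSet (range n) (Kn n r), Pr (Kn n r) p (fun W => (pmCount (range n) (W ∪ S) : ℝ) < a) ≤ a / b := by
  by_contra hcon
  push Not at hcon
  have hSm : ∀ S ∈ pmSet (range n) (Kn n r), S.card = m := by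
    intro S hS
    have h1 := pm_card (r := r) (fun f hf => (mem_powersetCard.1 hf).2) hS
    rw [card_range, hn] at h1
    exact Nat.eq_of_mul_eq_mul_right (by omega) h1
  have h1 : ∑ S ∈ pmSet (range n) (Kn n r), p^m * Pr (Kn n r) p (fun W => (pmCount (range n) (W ∪ S) : ℝ) < a) ≤ a := by
    have e1 : ∀ S ∈ pmSet (range n) (Kn n r), p^m * Pr (Kn n r) p (fun W => (pmCount (range n) (W ∪ S) : ℝ) < a) =
        Ex (Kn n r) p (fun W => if S ⊆ W then (if (pmCount (range n) W : ℝ) < a then 1 else 0) else 0) := by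
      intro S hS
      rw [Ex_plant (mem_pmSet.1 hS).1 p (fun W => if (pmCount (range n) W : ℝ) < a then (1:ℝ) else 0), hSm S hS]
      rfl
    rw [sum_congr rfl e1, ← Ex_sum]
    refine le_trans (Ex_mono (g := fun _ => a) hp hp1 ?_) (le_of_eq (Ex_const _ _ _))
    intro W hW
    rw [← sum_filter, ← pmSet_filter hW, sum_const, nsmul_eq_mul]
    change (pmCount (range n) W : ℝ) * _ ≤ a
    split_ifs with h
    · linarith
    · linarith
  have hNpos : 0 < (pmCount (range n) (Kn n r) : ℝ) * p^m := hb.trans_le hN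
  have hne : (pmSet (range n) (Kn n r)).Nonempty := by
    rw [← card_pos]
    by_contra h
    have h0 : pmCount (range n) (Kn n r) = 0 := by unfold pmCount; omega
    rw [h0] at hNpos; simp at hNpos
  have hpm : 0 < p^m := by
    by_contra h
    have h0 : p^m = 0 := le_antisymm (not_lt.1 h) (by positivity)
    rw [h0] at hNpos; simp at hNpos
  have h2 : ∑ S ∈ pmSet (range n) (Kn n r), p^m * (a/b) < ∑ S ∈ pmSet (range n) (Kn n r), p^m * Pr (Kn n r) p (fun W => (pmCount (range n) (W ∪ S) : ℝ) < a) :=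
    sum_lt_sum_of_nonempty hne fun S hS => mul_lt_mul_of_pos_left (hcon S hS) hpm
  rw [sum_const, nsmul_eq_mul] at h2
  have h3 := h2.trans_le h1
  have h4 : a ≤ ((pmSet (range n) (Kn n r)).card : ℝ) * (p^m * (a/b)) := by
    have : ((pmSet (range n) (Kn n r)).card : ℝ) * (p^m * (a/b)) = (pmCount (range n) (Kn n r) * p^m) * a / b := by
      unfold pmCount; ring
    rw [this, le_div_iff₀ hb, mul_comm a b]
    exact mul_le_mul_of_nonneg_right hN ha
  linarith

/-- exact number of perfect matchings of the complete r-graph -/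
theorem pmCount_Kn {n r : ℕ} (hr : 1 ≤ r) (m : ℕ) : ∀ U : Finset ℕ, U ⊆ range n → U.card = m * r →
    pmCount U (Kn n r) * ((r-1).factorial ^ m * (r^m * m.factorial)) = (m*r).factorial := by
  have hne : ∅ ∉ Kn n r := by
    intro h
    have := (mem_powersetCard.1 h).2
    rw [card_empty] at this; omega
  induction m with
  | zero =>
    intro U _ hU
    rw [zero_mul, card_eq_zero] at hU
    subst hU
    have : pmSet ∅ (Kn n r) = {∅} := by
      ext S
      rw [mem_pmSet, mem_singleton]
      constructor
      · rintro ⟨h1, _, h3⟩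
        rw [eq_empty_iff_forall_notMem]
        intro f hf
        have h4 : f ⊆ ∅ := by rw [← h3]; exact subset_biUnion_of_mem id hf
        rw [subset_empty] at h4
        subst h4
        exact hne (h1 hf)
      · rintro rfl
        simp
    simp [pmCount, this]
  | succ m ih =>
    intro U hUn hU
    obtain ⟨v, hv⟩ := card_pos.1 (by rw [hU]; positivity : 0 < U.card)
    rw [pmCount_vertex hne hv, sum_mul]
    have e1 : ∀ f ∈ (Kn n r).filter (fun f => v ∈ f ∧ f ⊆ U),
        pmCount (U \ f) (Kn n r) * ((r-1).factorial ^ (m+1) * (r^(m+1) * (m+1).factorial)) =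
        (m*r).factorial * ((r-1).factorial * (r * (m+1))) := by
      intro f hf
      rw [mem_filter, Kn, mem_powersetCard] at hf
      rw [← ih (U \ f) (sdiff_subset.trans hUn) (by rw [card_sdiff_of_subset hf.2.2, hU, hf.1.2, Nat.succ_mul]; omega)]
      rw [Nat.factorial_succ]; ring
    rw [sum_congr rfl e1, sum_const, smul_eq_mul]
    have e2 : ((Kn n r).filter (fun f => v ∈ f ∧ f ⊆ U)).card = ((m+1)*r - 1).choose (r-1) := by
      have : (Kn n r).filter (fun f => v ∈ f ∧ f ⊆ U) = (powersetCard (r-1) (U.erase v)).image (fun T => insert v T) := by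
        ext f
        rw [mem_filter, Kn, mem_powersetCard, mem_image]
        constructor
        · rintro ⟨⟨_, h2⟩, h3, h4⟩
          exact ⟨f.erase v, mem_powersetCard.2 ⟨erase_subset_erase _ h4, by rw [card_erase_of_mem h3, h2]⟩, insert_erase h3⟩
        · rintro ⟨T, hT, rfl⟩
          rw [mem_powersetCard] at hT
          have hvT : v ∉ T := fun h => (mem_erase.1 (hT.1 h)).1 rfl
          have hs : insert v T ⊆ U := insert_subset hv (hT.1.trans (erase_subset _ _))
          refine ⟨⟨hs.trans hUn, ?_⟩, mem_insert_self _ _, hs⟩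
          rw [card_insert_of_notMem hvT, hT.2]; omega
      rw [this, card_image_of_injOn, card_powersetCard, card_erase_of_mem hv, hU]
      intro T hT T' hT' h
      have h1 : v ∉ T := fun h => (mem_erase.1 ((mem_powersetCard.1 hT).1 h)).1 rfl
      have h2 : v ∉ T' := fun h => (mem_erase.1 ((mem_powersetCard.1 hT').1 h)).1 rfl
      simp only at h
      rw [← erase_insert h1, h, erase_insert h2]
    rw [e2]
    have e3 : (m+1)*r = ((m+1)*r - 1) + 1 := by
      have : 0 < (m+1)*r := by positivity
      omega
    have e4 : (m+1)*r - 1 - (r-1) = m*r := by rw [Nat.succ_mul]; omega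
    have e5 := Nat.choose_mul_factorial_mul_factorial (n := (m+1)*r - 1) (k := r-1) (by rw [Nat.succ_mul]; omega)
    rw [e4] at e5
    have e6 : ((m+1)*r).factorial = ((m+1)*r) * ((m+1)*r - 1).factorial := by
      rw [e3, Nat.factorial_succ]; simp
    rw [e6, ← e5]
    ring

theorem factorial_upper (m : ℕ) (hm : 1 ≤ m) : (m.factorial : ℝ) ≤ (m:ℝ)^m * Real.exp (-m) * (Real.exp 1 * m) := by
  induction m, hm using Nat.le_induction with
  | base => simp [← Real.exp_add]
  | succ m hm ih =>
    have hm0 : (0:ℝ) < m := by exact_mod_cast hm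
    have h1 : (m:ℝ)^(m+1) * Real.exp 1 ≤ ((m:ℝ)+1)^(m+1) := by
      have h2 : Real.exp 1 ≤ (((m:ℝ)+1)/m)^(m+1) := by
        have h3 : -Real.log (((m:ℝ)+1)/m) ≤ (m:ℝ)/(m+1) - 1 := by
          rw [← Real.log_inv, inv_div]
          exact Real.log_le_sub_one_of_pos (by positivity)
        have h4 : 1/((m:ℝ)+1) ≤ Real.log (((m:ℝ)+1)/m) := by
          have : (m:ℝ)/(m+1) - 1 = -(1/((m:ℝ)+1)) := by field_simp; ring
          linarith
        have h5 : Real.exp (1/((m:ℝ)+1)) ≤ ((m:ℝ)+1)/m := by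
          rw [← Real.le_log_iff_exp_le (by positivity)]; exact h4
        calc Real.exp 1 = (Real.exp (1/((m:ℝ)+1)))^(m+1) := by
              rw [← Real.exp_nat_mul]; congr 1; push_cast; field_simp
          _ ≤ _ := pow_le_pow_left₀ (Real.exp_pos _).le h5 _
      rw [div_pow, le_div_iff₀ (by positivity)] at h2
      linarith
    rw [Nat.factorial_succ]
    push_cast
    have e1 : Real.exp (-(m:ℝ)) = Real.exp (-((m:ℝ)+1)) * Real.exp 1 := by rw [← Real.exp_add]; congr 1; ring
    rw [e1] at ih
    calc ((m:ℝ)+1) * m.factorial ≤ ((m:ℝ)+1) * ((m:ℝ)^m * (Real.exp (-((m:ℝ)+1)) * Real.exp 1) * (Real.exp 1 * m)) := by gcongr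
      _ = ((m:ℝ)^(m+1) * Real.exp 1) * (((m:ℝ)+1) * (Real.exp (-((m:ℝ)+1)) * Real.exp 1)) := by ring
      _ ≤ ((m:ℝ)+1)^(m+1) * (((m:ℝ)+1) * (Real.exp (-((m:ℝ)+1)) * Real.exp 1)) := mul_le_mul_of_nonneg_right h1 (by positivity)
      _ = _ := by ring

theorem factorial_lower (n : ℕ) : (n:ℝ)^n * Real.exp (-n) ≤ n.factorial := by
  have h := Real.pow_div_factorial_le_exp (n:ℝ) (by positivity) n
  rw [div_le_iff₀ (by positivity)] at h
  rw [Real.exp_neg, ← div_eq_mul_inv, div_le_iff₀ (Real.exp_pos _)]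
  linarith


open Filter in
theorem mean_lower (r : ℕ) (hr : 2 ≤ r) (ε : ℝ) (hε : 0 < ε) (δ : ℝ) (hδ : 0 < δ) : ∀ᶠ n : ℕ in atTop, r ∣ n →
    thr r ε δ n ≤ pmCount (range n) (Kn n r) * (pp r ε n)^(n/r) := by
  filter_upwards [ev_pow_exp (Real.exp 1) δ hδ 1 1 one_pos, (DD_tendsto hε).eventually_gt_atTop 0, eventually_ge_atTop r]
    with n g1 hD hrn' hrn
  set m := n/r with hm
  have hn : m * r = n := Nat.div_mul_cancel hrn
  have hm1 : 1 ≤ m := by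
    by_contra h
    have : m = 0 := Nat.lt_one_iff.1 (not_le.1 h)
    rw [this] at hn; omega
  have hn0 : (0:ℝ) < n := by exact_mod_cast (by omega : 0 < n)
  have hm0 : (0:ℝ) < m := by exact_mod_cast hm1
  have hnr : (m:ℝ) * r = n := by exact_mod_cast hn
  have hmn : (m:ℝ) ≤ n := by exact_mod_cast Nat.div_le_self n r
  have hC : (0:ℝ) < (((n-1).choose (r-1) : ℕ):ℝ) := by exact_mod_cast Nat.choose_pos (by omega)
  have k1 : (pmCount (range n) (Kn n r) : ℝ) * (((r-1).factorial : ℕ) ^ m * (r^m * (m.factorial : ℕ))) = (n.factorial : ℕ) := by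
    have := pmCount_Kn (n := n) (by omega : 1 ≤ r) m (range n) (subset_refl _) (by rw [card_range, hn])
    rw [hn] at this
    exact_mod_cast this
  have k2 : (((r-1).factorial : ℕ):ℝ) * ((n-1).choose (r-1) : ℕ) ≤ (n:ℝ)^(r-1) := by
    have h1 := Nat.descFactorial_le_pow (n-1) (r-1)
    rw [Nat.descFactorial_eq_factorial_mul_choose] at h1
    have h2 := h1.trans (Nat.pow_le_pow_left (Nat.sub_le n 1) (r-1))
    exact_mod_cast h2
  have k3 := factorial_upper m hm1
  have k4 := factorial_lower n
  set f : ℝ := (((r-1).factorial : ℕ):ℝ) with hf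
  have hf0 : 0 < f := by rw [hf]; exact_mod_cast Nat.factorial_pos _
  set Cn : ℝ := (((n-1).choose (r-1) : ℕ):ℝ) with hCn
  set D := DD ε n with hDD
  have k5 : (f * Cn)^m * (r^m * (m.factorial : ℕ)) ≤ (n:ℝ)^n * Real.exp (-m) * (Real.exp 1 * m) := by
    have hr0 : (0:ℝ) < r := by exact_mod_cast (by omega : 0 < r)
    calc (f * Cn)^m * (r^m * (m.factorial : ℕ)) ≤ ((n:ℝ)^(r-1))^m * (r^m * ((m:ℝ)^m * Real.exp (-m) * (Real.exp 1 * m))) := by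
          gcongr
      _ = ((n:ℝ)^(r-1))^m * (m * r)^m * Real.exp (-m) * (Real.exp 1 * m) := by rw [mul_pow]; ring
      _ = _ := by
          rw [hnr, ← mul_pow, ← pow_succ, Nat.sub_add_cancel (by omega), ← pow_mul]
          congr 3
          rw [mul_comm, hn]
  set N : ℝ := (pmCount (range n) (Kn n r) : ℝ) with hN
  have k6 : N * (pp r ε n)^m * ((f * Cn)^m * (r^m * (m.factorial : ℕ))) = (n.factorial:ℕ) * D^m := by
    rw [← k1]
    unfold pp
    rw [div_pow, mul_pow]
    rw [← hDD, ← hCn]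
    field_simp
  have hNp : 0 ≤ N * (pp r ε n)^m := by
    have : 0 ≤ pp r ε n := div_nonneg hD.le hC.le
    positivity
  have k7 : (n:ℝ)^n * Real.exp (-n) * D^m ≤ N * (pp r ε n)^m * ((n:ℝ)^n * Real.exp (-m) * (Real.exp 1 * m)) := by
    calc _ ≤ (n.factorial:ℕ) * D^m := mul_le_mul_of_nonneg_right k4 (by positivity)
      _ = _ := k6.symm
      _ ≤ _ := mul_le_mul_of_nonneg_left k5 hNp
  have k8 : thr r ε δ n * ((n:ℝ)^n * Real.exp (-m) * (Real.exp 1 * m)) ≤ (n:ℝ)^n * Real.exp (-n) * D^m := by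
    have e1 : D^m = Real.exp (m * Real.log D) := by
      rw [mul_comm, Real.exp_mul, Real.exp_log hD, Real.rpow_natCast]
    have e2 : thr r ε δ n * Real.exp (-m) = Real.exp (-n) * D^m * Real.exp (-(δ * n)) := by
      rw [e1, thr, ← Real.exp_add, ← Real.exp_add, ← Real.exp_add]
      congr 1
      rw [← hm, ← hDD]
      have : (m:ℝ) * (Real.log D - (r - 1)) = m * Real.log D - (m*r) + m := by ring
      rw [this, hnr]; ring
    have e3 : Real.exp (-(δ * n)) * (Real.exp 1 * m) ≤ 1 := by
      refine le_trans ?_ g1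
      rw [pow_one]
      have := mul_le_mul_of_nonneg_left hmn (by positivity : 0 ≤ Real.exp 1 * Real.exp (-(δ * n)))
      linarith
    calc _ = (n:ℝ)^n * (thr r ε δ n * Real.exp (-m)) * (Real.exp 1 * m) := by ring
      _ = ((n:ℝ)^n * Real.exp (-n) * D^m) * (Real.exp (-(δ * n)) * (Real.exp 1 * m)) := by rw [e2]; ring
      _ ≤ ((n:ℝ)^n * Real.exp (-n) * D^m) * 1 := mul_le_mul_of_nonneg_left e3 (by positivity)
      _ = _ := mul_one _
  exact le_of_mul_le_mul_right (k8.trans k7) (by positivity)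

open Filter in
theorem size_asym (r : ℕ) (hr : 2 ≤ r) (ε : ℝ) (hε : 0 < ε) (δ : ℝ) (hδ : 0 < δ) (τ : ℝ) (hτ : 0 < τ) :
    ∀ᶠ n : ℕ in atTop, r ∣ n →
    Pr (Kn n r) (pp r ε n) (fun W => (1 + δ) * (n/r : ℕ) * DD ε n ≤ (W.card : ℝ)) ≤ τ := by
  set θ : ℝ := min 1 δ / 2 with hθ
  have hθ0 : 0 < θ := by have := lt_min one_pos hδ; positivity
  have hθ1 : θ ≤ 1 := by have := min_le_left 1 δ; linarith
  have hθδ : θ ≤ δ/2 := by have := min_le_right 1 δ; linarith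
  have hexp : Real.exp θ - 1 ≤ θ + θ^2 := by
    have := Real.abs_exp_sub_one_sub_id_le (x := θ) (by rw [abs_of_pos hθ0]; exact hθ1)
    have := (abs_le.1 this).2
    linarith
  have hr0 : (0:ℝ) < r := by exact_mod_cast (by omega : 0 < r)
  filter_upwards [ev_pp_range r hr ε hε, ev_pow_exp 1 (θ*(δ/2)/r) (by positivity) 0 τ hτ, (DD_tendsto hε).eventually_ge_atTop 1, eventually_ge_atTop r]
    with n hp g1 hD hrn' hrn
  have h1 := chernoff_upper (Kn n r) hp.1 hp.2 θ hθ0.le ((1 + δ) * (n/r : ℕ) * DD ε n)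
  refine h1.trans (le_trans ?_ g1)
  rw [pow_zero, one_mul, one_mul]
  refine Real.exp_le_exp.2 ?_
  have hC : (0:ℝ) < (((n-1).choose (r-1) : ℕ):ℝ) := by exact_mod_cast Nat.choose_pos (by omega)
  have hnm : ((n/r : ℕ) : ℝ) * r = n := by exact_mod_cast Nat.div_mul_cancel hrn
  have e1 : pp r ε n * (Kn n r).card = (n/r : ℕ) * DD ε n := by
    have e2 : n.choose r * r = n * (n-1).choose (r-1) := by
      have := Nat.add_one_mul_choose_eq (n-1) (r-1)
      rw [Nat.sub_add_cancel (by omega), Nat.sub_add_cancel (by omega)] at this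
      exact this.symm
    have e3 : (n.choose r : ℝ) * r = n * ((n-1).choose (r-1) : ℕ) := by exact_mod_cast e2
    rw [Kn, card_powersetCard, card_range]
    unfold pp
    have e4 : (n.choose r : ℝ) = (n/r : ℕ) * ((n-1).choose (r-1) : ℕ) := by
      rw [← hnm] at e3
      have : ((n.choose r : ℝ) - (n/r : ℕ) * ((n-1).choose (r-1) : ℕ)) * r = 0 := by linarith
      rcases mul_eq_zero.1 this with h | h
      · linarith
      · exact absurd h hr0.ne'
    rw [e4]; field_simp
  rw [mul_assoc (Real.exp θ - 1), e1]
  set x : ℝ := (n/r : ℕ) * DD ε n with hx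
  have hx0 : ((n/r : ℕ) : ℝ) ≤ x := by
    have : (0:ℝ) ≤ (n/r : ℕ) := by positivity
    nlinarith
  have hx1 : 0 ≤ x := le_trans (by positivity) hx0
  have e5 : θ * (δ/2)/r * n = θ * (δ/2) * (n/r : ℕ) := by rw [← hnm]; field_simp
  rw [e5, mul_assoc (1+δ), ← hx]
  have e6 : (Real.exp θ - 1) * x ≤ (θ + θ^2) * x := mul_le_mul_of_nonneg_right hexp hx1
  have e7 : θ * (δ/2) * (n/r : ℕ) ≤ θ * (δ/2) * x := mul_le_mul_of_nonneg_left hx0 (by positivity)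
  have e8 : θ^2 * x ≤ θ * (δ/2) * x := by
    refine mul_le_mul_of_nonneg_right ?_ hx1
    rw [sq]; exact mul_le_mul_of_nonneg_left hθδ hθ0.le
  linarith

open Filter in
open scoped Classical in
theorem codeg_asym (r : ℕ) (hr : 2 ≤ r) (ε : ℝ) (hε : 0 < ε) (τ : ℝ) (hτ : 0 < τ) :
    ∀ᶠ n : ℕ in atTop,
    Pr (Kn n r) (pp r ε n) (fun W => ∃ u v, u ≠ v ∧ 2 < (W.filter (fun f => u ∈ f ∧ v ∈ f)).card) ≤ τ := by
  set A : ℝ := (1 + ε) * (2^(r-1) * ((r-1).factorial : ℕ)) with hA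
  have hA0 : 0 < A := by positivity
  have hlim : ∀ᶠ n : ℕ in atTop, A^3 * ((Real.log n)^3 / n) ≤ τ := by
    filter_upwards [ev_log_exp (A^3) (1) (by norm_num) 3 τ hτ, eventually_gt_atTop 0] with n h hn
    have hn0 : (0:ℝ) < n := by exact_mod_cast hn
    have e1 : Real.exp (-((1+1) * Real.log n)) = 1/(n:ℝ)^2 := by
      rw [show -((1+1:ℝ) * Real.log n) = -Real.log n + -Real.log n by ring, Real.exp_add, Real.exp_neg, Real.exp_log hn0]
      field_simp
    rw [e1, le_div_iff₀ hn0] at h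
    refine le_trans (le_of_eq ?_) h
    field_simp
  filter_upwards [ev_pp_range r hr ε hε, ev_pp r ε hε, hlim, eventually_ge_atTop 1] with n hp g1 g2 hn
  have hn0 : (0:ℝ) < n := by exact_mod_cast hn
  set I : Finset (Σ _ : ℕ × ℕ, Finset (Finset ℕ)) := ((range n ×ˢ range n).filter (fun q => q.1 ≠ q.2)).sigma
    (fun q => powersetCard 3 ((Kn n r).filter (fun f => q.1 ∈ f ∧ q.2 ∈ f))) with hI
  have h1 := Pr_exists I (E := Kn n r) hp.1 hp.2 (fun q W => q.2 ⊆ W)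
  refine (Pr_mono hp.1 hp.2 ?_).trans (h1.trans ?_)
  · rintro W hW ⟨u, v, huv, hc⟩
    obtain ⟨F, hF, hFc⟩ := exists_subset_card_eq (show 3 ≤ (W.filter (fun f => u ∈ f ∧ v ∈ f)).card by omega)
    have hlt : u ∈ range n ∧ v ∈ range n := by
      obtain ⟨f, hf⟩ := card_pos.1 (by omega : 0 < F.card)
      have hf' := mem_filter.1 (hF hf)
      have hfs := (mem_powersetCard.1 (hW hf'.1)).1
      exact ⟨hfs hf'.2.1, hfs hf'.2.2⟩
    refine ⟨⟨(u, v), F⟩, ?_, fun f hf => (mem_filter.1 (hF hf)).1⟩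
    rw [hI, mem_sigma, mem_filter, mem_product, mem_powersetCard]
    refine ⟨⟨hlt, huv⟩, fun f hf => ?_, hFc⟩
    have := mem_filter.1 (hF hf)
    exact mem_filter.2 ⟨hW this.1, this.2⟩
  · have h2 : ∀ q ∈ I, Pr (Kn n r) (pp r ε n) (fun W => q.2 ⊆ W) ≤ (pp r ε n)^3 := by
      intro q hq
      rw [hI, mem_sigma, mem_powersetCard] at hq
      have := Pr_subset_le (hq.2.1.trans (filter_subset _ _)) hp.1 hp.2
      rwa [hq.2.2] at this
    have h3 := sum_le_card_nsmul I _ _ h2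
    refine h3.trans ?_
    rw [nsmul_eq_mul]
    have hIc : (I.card : ℝ) ≤ n^2 * (n^(r-2))^3 := by
      have : I.card ≤ ((range n ×ˢ range n).filter (fun q : ℕ × ℕ => q.1 ≠ q.2)).card * (n^(r-2))^3 := by
        rw [hI, card_sigma, ← smul_eq_mul]
        refine sum_le_card_nsmul _ _ _ fun q hq => ?_
        rw [card_powersetCard]
        refine (Nat.choose_le_pow _ _).trans (Nat.pow_le_pow_left ?_ 3)
        have hq' := (mem_filter.1 hq).2
        have hle : ((Kn n r).filter (fun f => q.1 ∈ f ∧ q.2 ∈ f)).card ≤ (powersetCard (r-2) (range n)).card := by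
          refine card_le_card_of_injOn (fun f => (f.erase q.1).erase q.2) ?_ ?_
          · intro f hf
            rw [mem_coe, mem_filter, Kn, mem_powersetCard] at hf
            rw [mem_coe, mem_powersetCard]
            refine ⟨((erase_subset _ _).trans (erase_subset _ _)).trans hf.1.1, ?_⟩
            rw [card_erase_of_mem (mem_erase.2 ⟨Ne.symm hq', hf.2.2⟩), card_erase_of_mem hf.2.1, hf.1.2]; omega
          · intro f hf f' hf' h
            rw [mem_coe, mem_filter] at hf hf'
            simp only at h
            have i1 : insert q.2 ((f.erase q.1).erase q.2) = f.erase q.1 := insert_erase (mem_erase.2 ⟨Ne.symm hq', hf.2.2⟩)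
            have i2 : insert q.2 ((f'.erase q.1).erase q.2) = f'.erase q.1 := insert_erase (mem_erase.2 ⟨Ne.symm hq', hf'.2.2⟩)
            have i3 : f.erase q.1 = f'.erase q.1 := by rw [← i1, ← i2, h]
            rw [← insert_erase hf.2.1, i3, insert_erase hf'.2.1]
        refine hle.trans ?_
        rw [card_powersetCard, card_range]
        exact Nat.choose_le_pow _ _
      have h4 : ((range n ×ˢ range n).filter (fun q : ℕ × ℕ => q.1 ≠ q.2)).card ≤ n^2 := by
        refine (card_le_card (filter_subset _ _)).trans ?_
        rw [card_product, card_range, sq]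
      exact_mod_cast this.trans (Nat.mul_le_mul_right _ h4)
    refine le_trans ?_ g2
    have hl : 0 ≤ Real.log n := Real.log_natCast_nonneg n
    calc (I.card : ℝ) * (pp r ε n)^3 ≤ (n^2 * (n^(r-2))^3) * (A * (Real.log n / (n:ℝ)^(r-1)))^3 := by
          refine mul_le_mul hIc (pow_le_pow_left₀ hp.1 g1 3) (pow_nonneg hp.1 _) (by positivity)
      _ = A^3 * ((Real.log n)^3 / n) := by
          have : (n:ℝ)^(r-1) = n^(r-2) * n := by rw [← pow_succ]; congr 1; omega
          rw [this]
          field_simp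

open Filter in
open scoped Classical in
theorem binom_asym (r : ℕ) (hr : 2 ≤ r) (ε : ℝ) (hε : 0 < ε) :
    ∃ δ0 : ℝ, 0 < δ0 ∧ ∀ δ1 : ℝ, 0 < δ1 → δ1 ≤ δ0 → ∀ τ : ℝ, 0 < τ → ∀ᶠ n : ℕ in atTop, r ∣ n →
      Pr (Kn n r) (pp r ε n) (fun W => (1 + δ1) * (n/r : ℕ) * DD ε n < (W.card : ℝ) ∨
        (pmCount (range n) W : ℝ) < thr r ε (δ1 + δ1) n) ≤ τ := by
  obtain ⟨δ0, hδ0, hpath⟩ := path_asym r hr ε hε 2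
  refine ⟨δ0, hδ0, fun δ1 hδ1 hδ1' τ hτ => ?_⟩
  filter_upwards [ev_pp_range r hr ε hε, hpath δ1 hδ1 hδ1' (τ/4) (by positivity), mean_lower r hr ε hε (δ1/2) (by positivity),
    size_asym r hr ε hε δ1 hδ1 (τ/4) (by positivity), codeg_asym r hr ε hε (τ/4) (by positivity),
    ev_pow_exp 1 (δ1/2) (by positivity) 0 (τ/4) (by positivity)] with n hp g1 g2 g3 g4 g5 hrn
  obtain ⟨S, hS, hSp⟩ := planted_exists (by omega : 1 ≤ r) (Nat.div_mul_cancel hrn).symm hp.1 hp.2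
    (thr_pos r ε δ1 n).le (thr_pos r ε (δ1/2) n) (g2 hrn)
  have e1 : thr r ε δ1 n / thr r ε (δ1/2) n ≤ τ/4 := by
    have : thr r ε δ1 n = Real.exp (-(δ1/2*n)) * thr r ε (δ1/2) n := by
      rw [← thr_split]; congr 1; ring
    rw [this, mul_div_cancel_right₀ _ (thr_pos _ _ _ _).ne']
    simpa using g5
  have h1 := g1 hrn S hS
  have h3 := g3 hrn
  rw [show τ = ((τ/4 + τ/4) + τ/4) + τ/4 by ring]
  refine le_trans ?_ (add_le_add (add_le_add (add_le_add h3 g4) (hSp.trans e1)) h1)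
  refine le_trans ?_ (add_le_add_left (add_le_add_left (Pr_or hp.1 hp.2 _ _) _) _)
  refine le_trans ?_ (add_le_add_left (Pr_or hp.1 hp.2 _ _) _)
  refine le_trans (Pr_mono hp.1 hp.2 ?_) (Pr_or hp.1 hp.2 _ _)
  rintro W hW hor
  by_cases c1 : (1 + δ1) * (n/r : ℕ) * DD ε n ≤ (W.card : ℝ)
  · exact Or.inl (Or.inl (Or.inl c1))
  by_cases c2 : ∃ u v, u ≠ v ∧ 2 < (W.filter (fun f => u ∈ f ∧ v ∈ f)).card
  · exact Or.inl (Or.inl (Or.inr c2))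
  by_cases c3 : (pmCount (range n) (W ∪ S) : ℝ) < thr r ε δ1 n
  · exact Or.inl (Or.inr c3)
  right
  push Not at c1 c2 c3
  refine ⟨⟨c2, c1.le⟩, c3, ?_⟩
  rcases hor with h | h
  · linarith
  · exact h


section
variable {α : Type*} [DecidableEq α]

open scoped Classical in
theorem exists_level {E : Finset α} {p τ τ' M0 : ℝ} (hp : 0 ≤ p) (hp1 : p ≤ 1) (hτ : τ < τ') (hτ1 : τ' ≤ 1) (bad : Finset α → Prop)
    (h : Pr E p (fun W => M0 < (W.card : ℝ) ∨ bad W) ≤ τ) :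
    ∃ j : ℕ, (j:ℝ) ≤ M0 ∧ (((powersetCard j E).filter bad).card : ℝ) ≤ τ' * (powersetCard j E).card := by
  by_contra hcon
  push Not at hcon
  have h1 : τ' ≤ Pr E p (fun W => M0 < (W.card : ℝ) ∨ bad W) := by
    rw [← Ex_const E p τ']
    unfold Pr Ex
    rw [sum_powerset, sum_powerset]
    refine sum_le_sum fun j hj => ?_
    have e1 : ∀ f : Finset α → ℝ, ∑ W ∈ powersetCard j E, p ^ W.card * (1 - p) ^ (E \ W).card * f W =
        p^j * (1-p)^(E.card - j) * ∑ W ∈ powersetCard j E, f W := by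
      intro f
      rw [mul_sum]
      refine sum_congr rfl fun W hW => ?_
      rw [mem_powersetCard] at hW
      rw [card_sdiff_of_subset hW.1, hW.2]
    rw [e1 (fun _ => τ')]
    refine le_of_le_of_eq ?_ (e1 _).symm
    beta_reduce
    refine mul_le_mul_of_nonneg_left ?_ (mul_nonneg (pow_nonneg hp _) (pow_nonneg (by linarith) _))
    rw [sum_const, nsmul_eq_mul]
    by_cases hjM : (j:ℝ) ≤ M0
    · have h2 := (hcon j hjM).le
      rw [mul_comm] at h2
      refine h2.trans ?_
      rw [card_filter, Nat.cast_sum]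
      refine sum_le_sum fun W hW => ?_
      by_cases hb : bad W
      · simp [hb]
      · simp only [hb, if_false, or_false, Nat.cast_zero]
        positivity
    · have h3 : ∑ W ∈ powersetCard j E, (1:ℝ) = ((powersetCard j E).card : ℝ) * 1 := by
        rw [sum_const, nsmul_eq_mul]
      refine le_trans (b := ((powersetCard j E).card : ℝ) * 1) ?_ ?_
      swap
      · rw [← h3]
        refine sum_le_sum fun W hW => ?_
        rw [if_pos]
        left
        rw [(mem_powersetCard.1 hW).2]
        exact not_le.1 hjM
      exact mul_le_mul_of_nonneg_left hτ1 (by positivity)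
  linarith

theorem super_count {S H : Finset α} (hS : S ⊆ H) {j : ℕ} (hj : S.card ≤ j) :
    ((powersetCard j H).filter (fun W => S ⊆ W)).card ≤ (H.card - S.card).choose (j - S.card) := by
  rw [← card_sdiff_of_subset hS, ← card_powersetCard]
  refine card_le_card_of_injOn (fun W => W \ S) ?_ ?_
  · intro W hW
    rw [mem_coe, mem_filter, mem_powersetCard] at hW
    rw [mem_coe, mem_powersetCard]
    refine ⟨sdiff_subset_sdiff hW.1.1 (subset_refl _), ?_⟩
    rw [card_sdiff_of_subset hW.2, hW.1.2]
  · intro W hW W' hW' h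
    rw [mem_coe, mem_filter] at hW hW'
    simp only at h
    rw [← sdiff_union_of_subset hW.2, h, sdiff_union_of_subset hW'.2]

theorem desc_le {j M : ℕ} (h : j ≤ M) (m : ℕ) : j.descFactorial m * M^m ≤ M.descFactorial m * j^m := by
  induction m with
  | zero => simp
  | succ m ih =>
    rw [Nat.descFactorial_succ, Nat.descFactorial_succ, pow_succ, pow_succ]
    have e1 : (j - m) * M ≤ (M - m) * j := by
      rw [Nat.sub_mul, Nat.sub_mul, mul_comm M j]
      exact Nat.sub_le_sub_left (Nat.mul_le_mul_left m h) _
    calc (j - m) * j.descFactorial m * (M^m * M) = ((j-m)*M) * (j.descFactorial m * M^m) := by ring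
      _ ≤ ((M-m)*j) * (M.descFactorial m * j^m) := Nat.mul_le_mul e1 ih
      _ = _ := by ring

theorem choose_le' {j M m : ℕ} (h : j ≤ M) (hm : m ≤ j) : (M - m).choose (j - m) * M^m ≤ j^m * M.choose j := by
  have h1 := Nat.choose_mul (n := M) hm
  have h2 := desc_le h m
  rw [Nat.descFactorial_eq_factorial_mul_choose, Nat.descFactorial_eq_factorial_mul_choose, mul_assoc, mul_assoc] at h2
  have h3 := Nat.le_of_mul_le_mul_left h2 m.factorial_pos
  have hpos : 0 < M.choose m := Nat.choose_pos (hm.trans h)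
  refine Nat.le_of_mul_le_mul_left ?_ hpos
  calc M.choose m * ((M-m).choose (j-m) * M^m) = (M.choose m * (M-m).choose (j-m)) * M^m := by ring
    _ = (M.choose j * j.choose m) * M^m := by rw [h1]
    _ = M.choose j * (j.choose m * M^m) := by ring
    _ ≤ M.choose j * (M.choose m * j^m) := Nat.mul_le_mul_left _ h3
    _ = _ := by ring

theorem super_count' {S H : Finset α} (hS : S ⊆ H) {j : ℕ} (hjH : j ≤ H.card) :
    ((powersetCard j H).filter (fun W => S ⊆ W)).card * H.card^S.card ≤ j^S.card * H.card.choose j := by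
  by_cases hj : S.card ≤ j
  · exact (Nat.mul_le_mul_right _ (super_count hS hj)).trans (choose_le' hjH hj)
  · have : (powersetCard j H).filter (fun W => S ⊆ W) = ∅ := by
      rw [filter_eq_empty_iff]
      intro W hW h
      have := card_le_card h
      rw [(mem_powersetCard.1 hW).2] at this
      exact hj this
    rw [this]; simp
end

open scoped Classical in
theorem avg_sub {U : Finset ℕ} {H : Finset (Finset ℕ)} {m j : ℕ} (hm : ∀ S ∈ pmSet U H, S.card = m) (hj : j ≤ H.card) (hj0 : 0 < H.card)
    {s t : ℝ} (ht : 0 < t) (hs : (pmCount U H : ℝ) ≤ s) (hst : s * ((j:ℝ)/H.card)^m ≤ t/2) :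
    (H.card.choose j : ℝ) / 2 ≤ (((powersetCard j H).filter (fun W => (pmCount U W : ℝ) < t)).card : ℝ) := by
  have hM : (0:ℝ) < H.card := by exact_mod_cast hj0
  have h1 : ∑ W ∈ powersetCard j H, pmCount U W = ∑ S ∈ pmSet U H, ((powersetCard j H).filter (fun W => S ⊆ W)).card := by
    have e1 : ∀ W ∈ powersetCard j H, pmCount U W = ((pmSet U H).filter (fun S => S ⊆ W)).card := by
      intro W hW
      rw [pmCount, pmSet_filter (mem_powersetCard.1 hW).1]
    rw [sum_congr rfl e1]
    exact sum_card_bipartiteAbove_eq_sum_card_bipartiteBelow (s := powersetCard j H) (t := pmSet U H) (fun W S => S ⊆ W)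
  have h2 : ∑ S ∈ pmSet U H, (((powersetCard j H).filter (fun W => S ⊆ W)).card : ℝ) ≤
      pmCount U H * (((j:ℝ)/H.card)^m * H.card.choose j) := by
    have := sum_le_card_nsmul (pmSet U H) (fun S => (((powersetCard j H).filter (fun W => S ⊆ W)).card : ℝ))
      (((j:ℝ)/H.card)^m * H.card.choose j) (fun S hS => by
        have e2 := super_count' (mem_pmSet.1 hS).1 hj
        rw [hm S hS] at e2
        have e3 : (((powersetCard j H).filter (fun W => S ⊆ W)).card : ℝ) * (H.card:ℝ)^m ≤ (j:ℝ)^m * H.card.choose j := by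
          exact_mod_cast e2
        rw [div_pow, div_mul_eq_mul_div, le_div_iff₀ (by positivity)]
        exact e3)
    rw [nsmul_eq_mul] at this
    exact this
  have h3 : (((powersetCard j H).filter (fun W => ¬ (pmCount U W : ℝ) < t)).card : ℝ) * t ≤ ∑ W ∈ powersetCard j H, (pmCount U W : ℝ) := by
    have e1 := card_nsmul_le_sum ((powersetCard j H).filter (fun W => ¬ (pmCount U W : ℝ) < t)) (fun W => (pmCount U W : ℝ)) t
      (fun W hW => not_lt.1 (mem_filter.1 hW).2)
    rw [nsmul_eq_mul] at e1
    exact e1.trans (sum_le_sum_of_subset_of_nonneg (filter_subset _ _) (fun _ _ _ => by positivity))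
  have h1' : ∑ W ∈ powersetCard j H, (pmCount U W : ℝ) = ∑ S ∈ pmSet U H, (((powersetCard j H).filter (fun W => S ⊆ W)).card : ℝ) := by
    exact_mod_cast h1
  have h4 : (pmCount U H : ℝ) * (((j:ℝ)/H.card)^m * H.card.choose j) ≤ (t/2) * H.card.choose j := by
    rw [← mul_assoc]
    refine mul_le_mul_of_nonneg_right (le_trans (mul_le_mul_of_nonneg_right hs (by positivity)) hst) (by positivity)
  have h5 : (((powersetCard j H).filter (fun W => ¬ (pmCount U W : ℝ) < t)).card : ℝ) ≤ (H.card.choose j : ℝ) / 2 := by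
    refine le_of_mul_le_mul_right ?_ ht
    linarith
  have h6 := card_filter_add_card_filter_not (s := powersetCard j H) (fun W => (pmCount U W : ℝ) < t)
  rw [card_powersetCard] at h6
  have h7 : (((powersetCard j H).filter (fun W => (pmCount U W : ℝ) < t)).card : ℝ) +
    (((powersetCard j H).filter (fun W => ¬ (pmCount U W : ℝ) < t)).card : ℝ) = (H.card.choose j : ℝ) := by exact_mod_cast h6
  linarith

set_option maxHeartbeats 1000000 in
open scoped Classical in
theorem transfer {U : Finset ℕ} {E : Finset (Finset ℕ)} {m j M : ℕ} (hm : ∀ S ∈ pmSet U E, S.card = m) (hj : j ≤ M) (hM0 : 0 < M)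
    (hME : M ≤ E.card) {s t τ : ℝ} (ht : 0 < t) (hst : s * ((j:ℝ)/M)^m ≤ t/2)
    (hbad : (((powersetCard j E).filter (fun W => (pmCount U W : ℝ) < t)).card : ℝ) ≤ τ * (powersetCard j E).card) :
    (((powersetCard M E).filter (fun H => (pmCount U H : ℝ) ≤ s)).card : ℝ) ≤ 2 * τ * (powersetCard M E).card := by
  set B := (powersetCard j E).filter (fun W => (pmCount U W : ℝ) < t) with hB
  set A := (powersetCard M E).filter (fun H => (pmCount U H : ℝ) ≤ s) with hA
  have h1 : ∑ H ∈ A, (B.filter (fun W => W ⊆ H)).card = ∑ W ∈ B, (A.filter (fun H => W ⊆ H)).card := by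
    clear_value A B
    simp only [card_filter]
    exact sum_comm
  have h2 : A.card • ((M.choose j : ℝ)/2) ≤ ∑ H ∈ A, ((B.filter (fun W => W ⊆ H)).card : ℝ) := by
    refine card_nsmul_le_sum A _ _ fun H hH => ?_
    rw [hA, mem_filter, mem_powersetCard] at hH
    obtain ⟨⟨hHE, hHM⟩, hHs⟩ := hH
    have e1 := avg_sub (U := U) (H := H) (m := m) (j := j) (fun S hS => by
      rw [pmSet_filter hHE] at hS
      exact hm S (mem_filter.1 hS).1) (by omega) (by omega) ht hHs (by rw [hHM]; exact hst)
    rw [hHM] at e1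
    refine e1.trans ?_
    have : (powersetCard j H).filter (fun W => (pmCount U W : ℝ) < t) ⊆ B.filter (fun W => W ⊆ H) := by
      intro W hW
      rw [mem_filter, mem_powersetCard] at hW
      rw [mem_filter, hB, mem_filter, mem_powersetCard]
      exact ⟨⟨⟨hW.1.1.trans hHE, hW.1.2⟩, hW.2⟩, hW.1.1⟩
    exact_mod_cast card_le_card this
  have h3 : ∑ W ∈ B, ((A.filter (fun H => W ⊆ H)).card : ℝ) ≤ B.card • ((E.card - j).choose (M - j) : ℝ) := by
    refine sum_le_card_nsmul B _ _ fun W hW => ?_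
    rw [hB, mem_filter, mem_powersetCard] at hW
    have e1 := super_count (j := M) hW.1.1 (by omega)
    rw [hW.1.2] at e1
    have e2 : A.filter (fun H => W ⊆ H) ⊆ (powersetCard M E).filter (fun H => W ⊆ H) := filter_subset_filter _ (filter_subset _ _)
    exact_mod_cast (card_le_card e2).trans e1
  rw [nsmul_eq_mul] at h2 h3
  have h1' : ∑ H ∈ A, ((B.filter (fun W => W ⊆ H)).card : ℝ) = ∑ W ∈ B, ((A.filter (fun H => W ⊆ H)).card : ℝ) := by
    exact_mod_cast h1
  rw [card_powersetCard] at hbad ⊢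
  have h4 : (E.card.choose M : ℝ) * M.choose j = E.card.choose j * (E.card - j).choose (M - j) := by
    rw [← Nat.cast_mul, ← Nat.cast_mul, Nat.choose_mul (n := E.card) hj]
  have h5 : (B.card : ℝ) * ((E.card - j).choose (M - j) : ℝ) ≤ τ * E.card.choose j * ((E.card - j).choose (M - j) : ℝ) :=
    mul_le_mul_of_nonneg_right hbad (by positivity)
  have hpos : (0:ℝ) < M.choose j := by exact_mod_cast Nat.choose_pos hj
  refine le_of_mul_le_mul_right ?_ hpos
  have h6 : τ * E.card.choose j * ((E.card - j).choose (M - j) : ℝ) = τ * (E.card.choose M * M.choose j) := by rw [h4]; ring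
  linarith

open scoped Classical in
/-- **Counting version (Theorem 5).** For fixed `r ≥ 3` and `ε > 0`, if
`M > (1+ε)(n/r)·log n` then w.h.p.
`Φ(H^r_{n,M}) > (e^{-(r-1)}·rM/n)^{n/r}·e^{-o(n)}`. -/
theorem shamir_counting (r : ℕ) (hr : 3 ≤ r) (ε : ℝ) (hε : 0 < ε)
    (δ : ℝ) (hδ : 0 < δ) (ρ : ℝ) (hρ : 0 < ρ) :
    ∃ n₀ : ℕ, ∀ n : ℕ, n₀ ≤ n → r ∣ n → ∀ M : ℕ,
      (1 + ε) * ((n : ℝ) / r) * Real.log n < M → M ≤ n.choose r →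
      1 - ρ ≤
        (((Finset.powersetCard M (Kn n r)).filter
            (fun H =>
              (Real.exp (-((r : ℝ) - 1)) * ((r : ℝ) * M / n)) ^ (n / r) *
                  Real.exp (-δ * n) <
                (pmCount (Finset.range n) H : ℝ))).card : ℝ) /
          ((Finset.powersetCard M (Kn n r)).card : ℝ) := by
  obtain ⟨δ0, hδ0, hbin⟩ := binom_asym r (by omega) (ε/2) (by positivity)
  set δ1 : ℝ := min δ0 (min (δ/4) ((ε/2)/(1+ε/2))) with hδ1
  have hδ10 : 0 < δ1 := lt_min hδ0 (lt_min (by positivity) (by positivity))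
  have hd0 : δ1 ≤ δ0 := min_le_left _ _
  have hd1 : δ1 ≤ δ/4 := (min_le_right _ _).trans (min_le_left _ _)
  have hd2 : (1 + δ1) * (1 + ε/2) ≤ 1 + ε := by
    have : δ1 ≤ (ε/2)/(1+ε/2) := (min_le_right _ _).trans (min_le_right _ _)
    rw [le_div_iff₀ (by positivity)] at this
    linarith
  set τ' : ℝ := min (ρ/2) 1 with hτ'
  have hτ0 : 0 < τ' := lt_min (by positivity) one_pos
  have hτ1 : τ' ≤ 1 := min_le_right _ _
  have hτρ : 2 * τ' ≤ ρ := by have : τ' ≤ ρ/2 := min_le_left _ _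
                              linarith
  have hev := (((hbin δ1 hδ10 hd0 (τ'/2) (by positivity)).and (ev_pp_range r (by omega) (ε/2) (by positivity))).and
    (((ev_pow_exp 1 δ1 hδ10 0 (1/2) (by norm_num))).and ((DD_tendsto (ε := ε/2) (by positivity)).eventually_gt_atTop 0))).and
    (Filter.eventually_ge_atTop 1)
  obtain ⟨n₀, hn₀⟩ := Filter.eventually_atTop.1 hev
  refine ⟨n₀, fun n hn hrn M hM hMc => ?_⟩
  obtain ⟨⟨⟨g1, hp⟩, g2, hD⟩, hn1⟩ := hn₀ n hn
  have hn0 : (0:ℝ) < n := by exact_mod_cast hn1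
  have hr0 : (0:ℝ) < r := by exact_mod_cast (by omega : 0 < r)
  have hnm : ((n/r : ℕ) : ℝ) * r = n := by exact_mod_cast Nat.div_mul_cancel hrn
  have hm' : (n:ℝ)/r = (n/r : ℕ) := by rw [← hnm]; field_simp
  have hl : 0 ≤ Real.log n := Real.log_natCast_nonneg n
  obtain ⟨j, hj, hjb⟩ := exists_level hp.1 hp.2 (show τ'/2 < τ' by linarith) hτ1 _ (g1 hrn)
  have hM0 : (1 + δ1) * (n/r : ℕ) * DD (ε/2) n ≤ (1 + ε) * ((n : ℝ) / r) * Real.log n := by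
    rw [hm']; unfold DD
    have := mul_le_mul_of_nonneg_right hd2 (by positivity : 0 ≤ ((n/r : ℕ) : ℝ) * Real.log n)
    linarith
  have hjM : (j:ℝ) < M := by linarith
  have hjM' : j < M := by exact_mod_cast hjM
  have hMpos : (0:ℝ) < M := by exact_mod_cast (by omega : 0 < M)
  have hKc : (Kn n r).card = n.choose r := by rw [Kn, card_powersetCard, card_range]
  set s : ℝ := (Real.exp (-((r : ℝ) - 1)) * ((r : ℝ) * M / n)) ^ (n / r) * Real.exp (-δ * n) with hs
  have hst : s * ((j:ℝ)/M)^(n/r) ≤ thr r (ε/2) (δ1+δ1) n / 2 := by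
    have e1 : s * ((j:ℝ)/M)^(n/r) = (Real.exp (-((r : ℝ) - 1)) * ((r : ℝ) * j / n)) ^ (n / r) * Real.exp (-δ * n) := by
      rw [hs, mul_right_comm, ← mul_pow]
      congr 2
      field_simp
    have e2 : (r:ℝ) * j / n ≤ DD (ε/2) n * Real.exp δ1 := by
      rw [div_le_iff₀ hn0]
      calc (r:ℝ) * j ≤ r * ((1 + δ1) * (n/r : ℕ) * DD (ε/2) n) := mul_le_mul_of_nonneg_left hj hr0.le
        _ = (1 + δ1) * (DD (ε/2) n * n) := by rw [← hnm]; ring_nf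
        _ ≤ Real.exp δ1 * (DD (ε/2) n * n) := by
            refine mul_le_mul_of_nonneg_right ?_ (by positivity)
            linarith [Real.add_one_le_exp δ1]
        _ = _ := by ring
    have e3 : (Real.exp (-((r : ℝ) - 1)) * ((r : ℝ) * j / n)) ^ (n / r) ≤ Real.exp ((n/r : ℕ) * (Real.log (DD (ε/2) n) - (r-1)) + δ1 * n) := by
      calc _ ≤ (Real.exp (-((r : ℝ) - 1)) * (DD (ε/2) n * Real.exp δ1))^(n/r) := by gcongr
        _ = (Real.exp (Real.log (DD (ε/2) n) - (r-1) + δ1))^(n/r) := by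
            congr 1
            rw [show Real.log (DD (ε/2) n) - ((r:ℝ)-1) + δ1 = -((r:ℝ)-1) + (Real.log (DD (ε/2) n) + δ1) by ring,
              Real.exp_add, Real.exp_add, Real.exp_log hD]
        _ = Real.exp ((n/r : ℕ) * (Real.log (DD (ε/2) n) - (r-1) + δ1)) := by rw [← Real.exp_nat_mul]
        _ ≤ _ := by
            refine Real.exp_le_exp.2 ?_
            have : ((n/r : ℕ):ℝ) ≤ n := by exact_mod_cast Nat.div_le_self n r
            have := mul_le_mul_of_nonneg_left this hδ10.le
            linarith
    have e4 : Real.exp (-(δ1 * n)) ≤ 1/2 := by simpa using g2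
    rw [e1]
    calc _ ≤ Real.exp ((n/r : ℕ) * (Real.log (DD (ε/2) n) - (r-1)) + δ1 * n) * Real.exp (-δ * n) :=
          mul_le_mul_of_nonneg_right e3 (Real.exp_pos _).le
      _ ≤ thr r (ε/2) (δ1+δ1) n * Real.exp (-(δ1 * n)) := by
          unfold thr
          rw [← Real.exp_add, ← Real.exp_add]
          refine Real.exp_le_exp.2 ?_
          have : (4 * δ1) * n ≤ δ * n := mul_le_mul_of_nonneg_right (by linarith) hn0.le
          linarith
      _ ≤ thr r (ε/2) (δ1+δ1) n * (1/2) := mul_le_mul_of_nonneg_left e4 (thr_pos _ _ _ _).le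
      _ = _ := by ring
  have hSm : ∀ S ∈ pmSet (range n) (Kn n r), S.card = n/r := by
    intro S hS
    have h1 := pm_card (r := r) (fun f hf => (mem_powersetCard.1 hf).2) hS
    rw [card_range] at h1
    rw [← h1, Nat.mul_div_cancel _ (by omega)]
  have htr := transfer hSm hjM'.le (by omega) (by rw [hKc]; exact hMc) (thr_pos r (ε/2) (δ1+δ1) n) hst hjb
  have hpos : (0:ℝ) < (powersetCard M (Kn n r)).card := by
    rw [card_powersetCard, hKc]
    exact_mod_cast Nat.choose_pos hMc
  rw [le_div_iff₀ hpos]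
  have hsum := card_filter_add_card_filter_not (s := powersetCard M (Kn n r)) (fun H => s < (pmCount (range n) H : ℝ))
  simp only [not_lt] at hsum
  have hsum' : (((powersetCard M (Kn n r)).filter (fun H => s < (pmCount (range n) H : ℝ))).card : ℝ) +
    (((powersetCard M (Kn n r)).filter (fun H => (pmCount (range n) H : ℝ) ≤ s)).card : ℝ) = (powersetCard M (Kn n r)).card := by
    exact_mod_cast hsum
  have := mul_le_mul_of_nonneg_right hτρ hpos.le
  linarith
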